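/- For every prime p > 2 and every n ≥ 0, there is an isomorphism of ℤ_(p)-algebras between the integral KLR algebra R_n^{ℤ_(p)} and the group algebra ℤ_(p)𝔖_n of the symmetric group 𝔖_n over ℤ_(p). -/

import Mathlib

instance instSpanPIsPrime (p : ℕ) [hp : Fact p.Prime] :
    (Ideal.span {(p : ℤ)}).IsPrime := by
  rw [Ideal.span_singleton_prime (by exact_mod_cast hp.out.ne_zero)]
  exact Nat.prime_iff_prime_int.mp hp.out

/-- The localization `ℤ_(p)` of `ℤ` at the prime `p`. -/
abbrev Zp (p : ℕ) [Fact p.Prime] : Type := Localization.AtPrime (Ideal.span {(p : ℤ)})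

/-- The canonical embedding `ℤ_(p) → ℚ`. -/
noncomputable def ZpToQ (p : ℕ) [Fact p.Prime] : Zp p →+* ℚ :=
  IsLocalization.lift (M := (Ideal.span {(p : ℤ)}).primeCompl) (S := Zp p)
    (g := Int.castRingHom ℚ)
    (by
      intro y
      refine IsUnit.mk0 _ ?_
      have hy : (y : ℤ) ≠ 0 := by
        intro h0
        exact y.2 (by rw [h0]; exact Ideal.zero_mem _)
      simpa using (Int.cast_ne_zero (α := ℚ)).mpr hy)

instance instNeZeroOfFactPrime (p : ℕ) [hp : Fact p.Prime] : NeZero p := ⟨hp.out.ne_zero⟩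

/-- The generators of the KLR algebra: idempotents `e(𝐢)` for residue sequences
`𝐢 ∈ (ℤ/p)^n`, crossings `ψ_1, …, ψ_{n−1}` and dots `y_1, …, y_n`. -/
inductive KLRGen (p n : ℕ) : Type
  | e : (Fin n → ZMod p) → KLRGen p n
  | psi : Fin (n - 1) → KLRGen p n
  | y : Fin n → KLRGen p n

/-- The free `ℤ_(p)`-algebra on the KLR generators. -/
abbrev KLRFree (p n : ℕ) [Fact p.Prime] : Type := FreeAlgebra (Zp p) (KLRGen p n)

def Egen (p n : ℕ) [Fact p.Prime] (i : Fin n → ZMod p) : KLRFree p n :=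
  FreeAlgebra.ι (Zp p) (KLRGen.e i)

def Ψgen (p n : ℕ) [Fact p.Prime] (k : Fin (n - 1)) : KLRFree p n :=
  FreeAlgebra.ι (Zp p) (KLRGen.psi k)

def Ygen (p n : ℕ) [Fact p.Prime] (l : Fin n) : KLRFree p n :=
  FreeAlgebra.ι (Zp p) (KLRGen.y l)

/-- The position `k` (holding the residue `i_k`, 1-based `i_{k+1}`). -/
def ka (n : ℕ) (k : Fin (n - 1)) : Fin n := ⟨k.val, by have := k.isLt; omega⟩

/-- The position `k+1` (holding the residue `i_{k+1}`). -/
def kb (n : ℕ) (k : Fin (n - 1)) : Fin n := ⟨k.val + 1, by have := k.isLt; omega⟩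

/-- The residue sequence `𝐢·s_k`, obtained by swapping the entries `k` and `k+1`. -/
def swapSeq (p n : ℕ) (i : Fin n → ZMod p) (k : Fin (n - 1)) : Fin n → ZMod p :=
  i ∘ (Equiv.swap (ka n k) (kb n k))

/-- The defining relations of the integral KLR algebra `R_n^{ℤ_(p)}` of
Hu–Mathas (cyclic quiver on `ℤ/p`, level one, decreasing weight `0`). -/
inductive KLRRel (p n : ℕ) [Fact p.Prime] : KLRFree p n → KLRFree p n → Prop
  /- `1 = Σ_𝐢 e(𝐢)` -/
  | unit : KLRRel p n (∑ i : Fin n → ZMod p, Egen p n i) 1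
  /- `e(𝐢)e(𝐣) = δ_{𝐢𝐣} e(𝐢)` -/
  | ee_same (i : Fin n → ZMod p) : KLRRel p n (Egen p n i * Egen p n i) (Egen p n i)
  | ee_diff (i j : Fin n → ZMod p) (h : i ≠ j) : KLRRel p n (Egen p n i * Egen p n j) 0
  /- `y_l e(𝐢) = e(𝐢) y_l` -/
  | ye (l : Fin n) (i : Fin n → ZMod p) :
      KLRRel p n (Ygen p n l * Egen p n i) (Egen p n i * Ygen p n l)
  /- `ψ_k e(𝐢) = e(𝐢·s_k) ψ_k` -/
  | psie (k : Fin (n - 1)) (i : Fin n → ZMod p) :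
      KLRRel p n (Ψgen p n k * Egen p n i) (Egen p n (swapSeq p n i k) * Ψgen p n k)
  /- `y_l y_m = y_m y_l` -/
  | yy (l m : Fin n) : KLRRel p n (Ygen p n l * Ygen p n m) (Ygen p n m * Ygen p n l)
  /- `ψ_k y_{k+1} e(𝐢) = (y_k ψ_k + δ_{i_k, i_{k+1}}) e(𝐢)` -/
  | psiy_eq (k : Fin (n - 1)) (i : Fin n → ZMod p) (h : i (ka n k) = i (kb n k)) :
      KLRRel p n (Ψgen p n k * Ygen p n (kb n k) * Egen p n i)
        ((Ygen p n (ka n k) * Ψgen p n k + 1) * Egen p n i)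
  | psiy_ne (k : Fin (n - 1)) (i : Fin n → ZMod p) (h : i (ka n k) ≠ i (kb n k)) :
      KLRRel p n (Ψgen p n k * Ygen p n (kb n k) * Egen p n i)
        (Ygen p n (ka n k) * Ψgen p n k * Egen p n i)
  /- `y_{k+1} ψ_k e(𝐢) = (ψ_k y_k + δ_{i_k, i_{k+1}}) e(𝐢)` -/
  | ypsi_eq (k : Fin (n - 1)) (i : Fin n → ZMod p) (h : i (ka n k) = i (kb n k)) :
      KLRRel p n (Ygen p n (kb n k) * Ψgen p n k * Egen p n i)
        ((Ψgen p n k * Ygen p n (ka n k) + 1) * Egen p n i)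
  | ypsi_ne (k : Fin (n - 1)) (i : Fin n → ZMod p) (h : i (ka n k) ≠ i (kb n k)) :
      KLRRel p n (Ygen p n (kb n k) * Ψgen p n k * Egen p n i)
        (Ψgen p n k * Ygen p n (ka n k) * Egen p n i)
  /- `ψ_k y_l = y_l ψ_k` for `l ≠ k, k+1` -/
  | psiy_far (k : Fin (n - 1)) (l : Fin n) (h1 : l.val ≠ k.val) (h2 : l.val ≠ k.val + 1) :
      KLRRel p n (Ψgen p n k * Ygen p n l) (Ygen p n l * Ψgen p n k)
  /- `ψ_k ψ_m = ψ_m ψ_k` for `|k − m| > 1` -/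
  | psipsi_far (k m : Fin (n - 1)) (h : 1 < Nat.dist k.val m.val) :
      KLRRel p n (Ψgen p n k * Ψgen p n m) (Ψgen p n m * Ψgen p n k)
  /- `e(𝐢) = 0` if `i_1 ≠ 0` -/
  | e_first (h0 : 0 < n) (i : Fin n → ZMod p) (h : i ⟨0, h0⟩ ≠ 0) : KLRRel p n (Egen p n i) 0
  /- `y_1 e(𝐢) = 0` -/
  | y_first (h0 : 0 < n) (i : Fin n → ZMod p) :
      KLRRel p n (Ygen p n ⟨0, h0⟩ * Egen p n i) 0
  /- braid relations -/
  | braid_up (k : ℕ) (hk : k + 1 < n - 1) (i : Fin n → ZMod p)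
      (h2 : i ⟨k + 2, by omega⟩ = i ⟨k, by omega⟩)
      (h1 : i ⟨k + 1, by omega⟩ = i ⟨k, by omega⟩ + 1) :
      KLRRel p n
        ((Ψgen p n ⟨k, by omega⟩ * Ψgen p n ⟨k + 1, hk⟩ * Ψgen p n ⟨k, by omega⟩ -
            Ψgen p n ⟨k + 1, hk⟩ * Ψgen p n ⟨k, by omega⟩ * Ψgen p n ⟨k + 1, hk⟩) * Egen p n i)
        (-(Egen p n i))
  | braid_down (k : ℕ) (hk : k + 1 < n - 1) (i : Fin n → ZMod p)
      (h2 : i ⟨k + 2, by omega⟩ = i ⟨k, by omega⟩)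
      (h1 : i ⟨k + 1, by omega⟩ = i ⟨k, by omega⟩ - 1) :
      KLRRel p n
        ((Ψgen p n ⟨k, by omega⟩ * Ψgen p n ⟨k + 1, hk⟩ * Ψgen p n ⟨k, by omega⟩ -
            Ψgen p n ⟨k + 1, hk⟩ * Ψgen p n ⟨k, by omega⟩ * Ψgen p n ⟨k + 1, hk⟩) * Egen p n i)
        (Egen p n i)
  | braid_other (k : ℕ) (hk : k + 1 < n - 1) (i : Fin n → ZMod p)
      (hu : ¬(i ⟨k + 2, by omega⟩ = i ⟨k, by omega⟩ ∧
              i ⟨k + 1, by omega⟩ = i ⟨k, by omega⟩ + 1))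
      (hd : ¬(i ⟨k + 2, by omega⟩ = i ⟨k, by omega⟩ ∧
              i ⟨k + 1, by omega⟩ = i ⟨k, by omega⟩ - 1)) :
      KLRRel p n
        ((Ψgen p n ⟨k, by omega⟩ * Ψgen p n ⟨k + 1, hk⟩ * Ψgen p n ⟨k, by omega⟩ -
            Ψgen p n ⟨k + 1, hk⟩ * Ψgen p n ⟨k, by omega⟩ * Ψgen p n ⟨k + 1, hk⟩) * Egen p n i)
        0
  /- quadratic relations for `ψ_k²` -/
  | sq_up (k : Fin (n - 1)) (i : Fin n → ZMod p)
      (h1 : i (kb n k) = i (ka n k) + 1) (h2 : i (kb n k) ≠ 0) :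
      KLRRel p n (Ψgen p n k * Ψgen p n k * Egen p n i)
        ((Ygen p n (ka n k) - Ygen p n (kb n k)) * Egen p n i)
  | sq_up_zero (k : Fin (n - 1)) (i : Fin n → ZMod p)
      (h1 : i (kb n k) = i (ka n k) + 1) (h2 : i (kb n k) = 0) :
      KLRRel p n (Ψgen p n k * Ψgen p n k * Egen p n i)
        ((Ygen p n (ka n k) + (p : KLRFree p n) - Ygen p n (kb n k)) * Egen p n i)
  | sq_down (k : Fin (n - 1)) (i : Fin n → ZMod p)
      (h1 : i (ka n k) = i (kb n k) + 1) (h2 : i (ka n k) ≠ 0) :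
      KLRRel p n (Ψgen p n k * Ψgen p n k * Egen p n i)
        ((Ygen p n (kb n k) - Ygen p n (ka n k)) * Egen p n i)
  | sq_down_zero (k : Fin (n - 1)) (i : Fin n → ZMod p)
      (h1 : i (ka n k) = i (kb n k) + 1) (h2 : i (ka n k) = 0) :
      KLRRel p n (Ψgen p n k * Ψgen p n k * Egen p n i)
        ((Ygen p n (kb n k) + (p : KLRFree p n) - Ygen p n (ka n k)) * Egen p n i)
  | sq_same (k : Fin (n - 1)) (i : Fin n → ZMod p) (h : i (ka n k) = i (kb n k)) :
      KLRRel p n (Ψgen p n k * Ψgen p n k * Egen p n i) 0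
  | sq_other (k : Fin (n - 1)) (i : Fin n → ZMod p)
      (h1 : i (ka n k) ≠ i (kb n k))
      (h2 : i (kb n k) ≠ i (ka n k) + 1) (h3 : i (ka n k) ≠ i (kb n k) + 1) :
      KLRRel p n (Ψgen p n k * Ψgen p n k * Egen p n i) (Egen p n i)

/-- The integral KLR algebra `R_n^{ℤ_(p)}` of Hu–Mathas. -/
abbrev KLR (p n : ℕ) [Fact p.Prime] : Type := RingQuot (KLRRel p n)

/-- The idempotent generator `e(𝐢)` of `R_n^{ℤ_(p)}`. -/
noncomputable def KLRe (p n : ℕ) [Fact p.Prime] (i : Fin n → ZMod p) : KLR p n :=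
  RingQuot.mkAlgHom (Zp p) (KLRRel p n) (Egen p n i)

/-- The dot generator `y_{l+1}` (1-based) of `R_n^{ℤ_(p)}`. -/
noncomputable def KLRy (p n : ℕ) [Fact p.Prime] (l : Fin n) : KLR p n :=
  RingQuot.mkAlgHom (Zp p) (KLRRel p n) (Ygen p n l)

/-- A family of orthogonal idempotents `e 𝐢` indexed by residue sequences, together with elements
`x k`, partial inverses `b k l` of the differences `x k - x l`, and the inverses `h k l` of the
factors comparing crossings with reflections. -/
structure ResidueSystem (p n : ℕ) [NeZero p] (C : Type*) [CommRing C] where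
  e : (Fin n → ZMod p) → C
  x : Fin n → C
  b : Fin n → Fin n → C
  h : Fin n → Fin n → C
  e_mul_self : ∀ i, e i * e i = e i
  e_mul_of_ne : ∀ i j, i ≠ j → e i * e j = 0
  sum_e : ∑ i, e i = 1
  b_of_eq : ∀ k l i, i k = i l → b k l * e i = e i
  b_of_ne : ∀ k l i, i k ≠ i l → (x k - x l) * b k l * e i = e i
  h_of_eq : ∀ k l i, i k = i l → (1 - x k + x l) * h k l * e i = e i
  h_of_down : ∀ k l i, i k = i l + 1 → -b k l * h k l * e i = e i
  h_of_ne : ∀ k l i, i k ≠ i l → i k ≠ i l + 1 → (1 - b k l) * h k l * e i = e i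

namespace ResidueSystem

variable {p n : ℕ} [NeZero p] {C : Type*} [CommRing C] (W : ResidueSystem p n C)

/-- The constant term of the factor `g`. -/
def eps (C : Type*) [CommRing C] (a b : ZMod p) : C := if a = b + 1 then 0 else 1

/-- The factor comparing crossings with reflections. -/
def g (k l : Fin n) : C :=
  ∑ i, W.e i * if i k = i l then 1 - W.x k + W.x l else eps C (i k) (i l) - W.b k l

/-- The value of the square of a crossing. -/
def Q (k l : Fin n) (i : Fin n → ZMod p) : C :=
  if i k = i l then 0 else if i l = i k + 1 then 1 + W.x k - W.x l
  else if i k = i l + 1 then 1 - W.x k + W.x l else 1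

theorem sum_e_mul (c : (Fin n → ZMod p) → C) (i : Fin n → ZMod p) :
    (∑ j, W.e j * c j) * W.e i = c i * W.e i := by
  rw [Finset.sum_mul, Finset.sum_eq_single i]
  · rw [mul_right_comm, W.e_mul_self, mul_comm]
  · intro j _ hj
    rw [mul_right_comm, W.e_mul_of_ne j i hj, zero_mul]
  · simp

theorem ext_e {M : Type*} [AddCommGroup M] [Module C M] {a b : M}
    (hab : ∀ i, W.e i • a = W.e i • b) : a = b := by
  rw [← one_smul C a, ← one_smul C b, ← W.sum_e, Finset.sum_smul, Finset.sum_smul]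
  exact Finset.sum_congr rfl fun i _ ↦ hab i

theorem g_of_eq {k l : Fin n} {i : Fin n → ZMod p} (hi : i k = i l) :
    W.g k l * W.e i = (1 - W.x k + W.x l) * W.e i := by
  rw [g, sum_e_mul, if_pos hi]

theorem g_of_ne {k l : Fin n} {i : Fin n → ZMod p} (hi : i k ≠ i l) :
    W.g k l * W.e i = (eps C (i k) (i l) - W.b k l) * W.e i := by
  rw [g, sum_e_mul, if_neg hi]

theorem g_mul_h (k l : Fin n) : W.g k l * W.h k l = 1 := by
  refine W.ext_e fun i ↦ ?_
  simp only [smul_eq_mul, mul_one]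
  by_cases hi : i k = i l
  · linear_combination W.h k l * W.g_of_eq hi + W.h_of_eq k l i hi
  · have := W.g_of_ne hi
    by_cases hd : i k = i l + 1
    · rw [eps, if_pos hd] at this
      linear_combination W.h k l * this + W.h_of_down k l i hd
    · rw [eps, if_neg hd] at this
      linear_combination W.h k l * this + W.h_of_ne k l i hi hd

theorem b_comm {k l : Fin n} {i : Fin n → ZMod p} (hi : i k ≠ i l) :
    W.b l k * W.e i = -W.b k l * W.e i := by
  linear_combination (-W.b l k) * W.b_of_ne k l i hi - W.b k l * W.b_of_ne l k i hi.symm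

/-- The relation between the factors `g` and the square of a crossing. -/
theorem eps_sub_mul_eps_add_mul_Q (hp : 2 < p) {k l : Fin n} {i : Fin n → ZMod p}
    (hi : i k ≠ i l) :
    (eps C (i k) (i l) - W.b k l) * (eps C (i l) (i k) + W.b k l) * W.Q k l i * W.e i =
      (1 - W.b k l ^ 2) * W.e i := by
  have hb := W.b_of_ne k l i hi
  have two : ∀ a b : ZMod p, a = b + 1 → b ≠ a + 1 := by
    rintro a b rfl h2
    have : ((2 : ℕ) : ZMod p) = 0 := by push_cast; linear_combination -h2
    rw [ZMod.natCast_eq_zero_iff] at this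
    exact absurd (Nat.le_of_dvd two_pos this) (by omega)
  unfold Q eps
  rw [if_neg hi]
  by_cases h1 : i l = i k + 1
  · rw [if_neg (two _ _ h1), if_pos h1, if_pos h1]
    linear_combination (1 - W.b k l) * hb
  · by_cases h2 : i k = i l + 1
    · rw [if_pos h2, if_neg h1, if_neg h1, if_pos h2]
      linear_combination (1 + W.b k l) * hb
    · rw [if_neg h2, if_neg h1, if_neg h1, if_neg h2]
      ring

end ResidueSystem

open ResidueSystem

section Crossing

variable {p n : ℕ} [NeZero p] {C : Type*} [CommRing C] (W : ResidueSystem p n C)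
  {A : Type*} [Ring A] [Module C A] [IsScalarTower C A A]

/-- The relations, other than the quadratic one, between a KLR crossing of the strands `k`, `l`
and the commutative subalgebra. -/
structure IsCrossing (k l : Fin n) (ψ : A) : Prop where
  ne : k ≠ l
  e_smul : ∀ i, W.e i • ψ = ψ * W.e (i ∘ Equiv.swap k l) • (1 : A)
  x_smul : ∀ m, m ≠ k → m ≠ l → W.x m • ψ = ψ * W.x m • (1 : A)
  mul_x_right : ∀ i, W.e i • (ψ * W.x l • (1 : A)) =
    (W.e i * W.x k) • ψ + if i k = i l then W.e i • 1 else 0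
  mul_x_left : ∀ i, W.e i • (ψ * W.x k • (1 : A)) =
    (W.e i * W.x l) • ψ - if i k = i l then W.e i • 1 else 0

/-- The relations, other than the quadratic one, between a simple reflection and the
commutative subalgebra. -/
structure IsReflection (k l : Fin n) (s : A) : Prop where
  ne : k ≠ l
  x_smul : ∀ m, m ≠ k → m ≠ l → W.x m • s = s * W.x m • (1 : A)
  mul_x_right : s * W.x l • (1 : A) = W.x k • s + 1
  mul_x_left : s * W.x k • (1 : A) = W.x l • s - 1
  e_smul_of_eq : ∀ i, i k = i l → W.e i • s = s * W.e i • (1 : A)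
  e_smul_of_ne : ∀ i, i k ≠ i l →
    W.e i • (s + W.b k l • 1) = (s + W.b k l • 1) * W.e (i ∘ Equiv.swap k l) • (1 : A)

variable {W}

theorem smul_one_mul_smul_one (c d : C) : (c • (1 : A)) * d • (1 : A) = (c * d) • (1 : A) := by
  rw [smul_mul_assoc, one_mul, smul_smul]

theorem mul_smul_one_mul (c : C) (v w : A) : v * c • (1 : A) * w = v * c • w := by
  rw [mul_assoc, smul_mul_assoc, one_mul]

omit [NeZero p] in
theorem comp_swap_of_eq {k l : Fin n} {i : Fin n → ZMod p} (hi : i k = i l) :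
    i ∘ Equiv.swap k l = i := by
  funext m
  simp only [Function.comp_apply, Equiv.swap_apply_def]
  split_ifs with h1 h2 <;> simp_all

/-- `g • ψ - b` is a reflection if `ψ` is a crossing. -/
theorem IsCrossing.isReflection {k l : Fin n} {ψ : A} (hψ : IsCrossing W k l ψ) :
    IsReflection W k l (W.g k l • ψ - W.b k l • (1 : A)) where
  ne := hψ.ne
  x_smul m h1 h2 := by
    rw [sub_mul, smul_mul_assoc, ← hψ.x_smul m h1 h2, smul_one_mul_smul_one, smul_sub, smul_smul,
      smul_smul, smul_smul, mul_comm, mul_comm (W.x m)]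
  mul_x_right := by
    refine W.ext_e fun i ↦ ?_
    rw [sub_mul, smul_mul_assoc, smul_sub, smul_comm, hψ.mul_x_right, smul_one_mul_smul_one]
    split_ifs with hi
    · have h1 := congrArg (· • (1 : A)) (W.g_of_eq hi)
      have h2 := congrArg (· • (1 : A)) (W.b_of_eq k l i hi)
      beta_reduce at h1 h2
      linear_combination (norm := module) h1 + (W.x k - W.x l) • h2
    · have h2 := congrArg (· • (1 : A)) (W.b_of_ne k l i hi)
      linear_combination (norm := module) h2
  mul_x_left := by
    refine W.ext_e fun i ↦ ?_
    rw [sub_mul, smul_mul_assoc, smul_sub, smul_comm, hψ.mul_x_left, smul_one_mul_smul_one]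
    split_ifs with hi
    · have h1 := congrArg (· • (1 : A)) (W.g_of_eq hi)
      have h2 := congrArg (· • (1 : A)) (W.b_of_eq k l i hi)
      beta_reduce at h1 h2
      linear_combination (norm := module) -h1 - (W.x k - W.x l) • h2
    · have h2 := congrArg (· • (1 : A)) (W.b_of_ne k l i hi)
      linear_combination (norm := module) -h2
  e_smul_of_eq i hi := by
    have := hψ.e_smul i
    rw [comp_swap_of_eq hi] at this
    rw [sub_mul, smul_mul_assoc, ← this, smul_one_mul_smul_one]
    module
  e_smul_of_ne i hi := by
    rw [sub_add_cancel, smul_mul_assoc, ← hψ.e_smul, smul_comm]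

/-- `h • (s + b)` is a crossing if `s` is a reflection. -/
theorem IsReflection.isCrossing {k l : Fin n} {s : A} (hs : IsReflection W k l s) :
    IsCrossing W k l (W.h k l • (s + W.b k l • (1 : A))) where
  ne := hs.ne
  e_smul i := by
    rw [smul_mul_assoc, smul_comm]
    by_cases hi : i k = i l
    · rw [comp_swap_of_eq hi, add_mul, ← hs.e_smul_of_eq i hi, smul_one_mul_smul_one]
      module
    · rw [hs.e_smul_of_ne i hi]
  x_smul m h1 h2 := by
    rw [smul_mul_assoc, add_mul, ← hs.x_smul m h1 h2, smul_one_mul_smul_one]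
    module
  mul_x_right i := by
    rw [smul_mul_assoc, add_mul, hs.mul_x_right, smul_one_mul_smul_one]
    split_ifs with hi
    · have h1 := congrArg (· • (1 : A)) (W.h_of_eq k l i hi)
      have h2 := congrArg (· • (1 : A)) (W.b_of_eq k l i hi)
      beta_reduce at h1 h2
      linear_combination (norm := module)
        h1 - (W.x k * W.h k l - W.x l * W.h k l) • h2
    · have h2 := congrArg (· • (1 : A)) (W.b_of_ne k l i hi)
      beta_reduce at h2
      linear_combination (norm := module) -W.h k l • h2
  mul_x_left i := by
    rw [smul_mul_assoc, add_mul, hs.mul_x_left, smul_one_mul_smul_one]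
    split_ifs with hi
    · have h1 := congrArg (· • (1 : A)) (W.h_of_eq k l i hi)
      have h2 := congrArg (· • (1 : A)) (W.b_of_eq k l i hi)
      beta_reduce at h1 h2
      linear_combination (norm := module)
        -h1 + (W.x k * W.h k l - W.x l * W.h k l) • h2
    · have h2 := congrArg (· • (1 : A)) (W.b_of_ne k l i hi)
      beta_reduce at h2
      linear_combination (norm := module) W.h k l • h2

end Crossing

section Moves

variable {p n : ℕ} [NeZero p] {C : Type*} [CommRing C] {W : ResidueSystem p n C}
  {A : Type*} [Ring A] [Module C A] [IsScalarTower C A A]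

theorem mul_smul_one_comm (v : A) (c d : C) :
    v * c • (1 : A) * d • (1 : A) = v * d • (1 : A) * c • (1 : A) := by
  rw [mul_assoc, mul_assoc, smul_one_mul_smul_one, smul_one_mul_smul_one, mul_comm]

/-- `v` has right weight `j`. -/
def HasWeight (W : ResidueSystem p n C) (v : A) (j : Fin n → ZMod p) : Prop :=
  v * W.e j • (1 : A) = v

theorem hasWeight_e (j : Fin n → ZMod p) : HasWeight W (W.e j • (1 : A)) j := by
  rw [HasWeight, smul_one_mul_smul_one, W.e_mul_self]

namespace HasWeight

variable {v : A} {j : Fin n → ZMod p}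

theorem mul_smul_one (hv : HasWeight W v j) (c : C) : HasWeight W (v * c • (1 : A)) j := by
  rw [HasWeight, mul_smul_one_comm, hv]

theorem mul_congr (hv : HasWeight W v j) {c d : C} (h : c * W.e j = d * W.e j) :
    v * c • (1 : A) = v * d • (1 : A) := by
  rw [← hv, mul_assoc, mul_assoc, smul_one_mul_smul_one, smul_one_mul_smul_one, mul_comm, h,
    mul_comm]

end HasWeight

namespace IsCrossing

variable {k l : Fin n} {ψ v : A} {j : Fin n → ZMod p}

theorem hasWeight_mul (hψ : IsCrossing W k l ψ) (hv : HasWeight W v j) :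
    HasWeight W (v * ψ) (j ∘ Equiv.swap k l) := by
  rw [HasWeight, mul_assoc, ← hψ.e_smul, ← mul_smul_one_mul, hv]

theorem mul_x_of_ne (hψ : IsCrossing W k l ψ) {m : Fin n} (hk : m ≠ k) (hl : m ≠ l) :
    v * ψ * W.x m • (1 : A) = v * W.x m • (1 : A) * ψ := by
  rw [mul_assoc, ← hψ.x_smul m hk hl, mul_smul_one_mul]

theorem mul_mul_x_right (hψ : IsCrossing W k l ψ) (hv : HasWeight W v j) :
    v * ψ * W.x l • (1 : A) = v * W.x k • (1 : A) * ψ + if j k = j l then v else 0 := by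
  have := congrArg (v * ·) (hψ.mul_x_right j)
  beta_reduce at this
  rw [← mul_smul_one_mul, hv, ← mul_assoc] at this
  rw [this, mul_add, mul_smul, ← mul_smul_one_mul, hv, mul_smul_one_mul]
  split_ifs
  · rw [hv]
  · simp

theorem mul_mul_x_left (hψ : IsCrossing W k l ψ) (hv : HasWeight W v j) :
    v * ψ * W.x k • (1 : A) = v * W.x l • (1 : A) * ψ - if j k = j l then v else 0 := by
  have := congrArg (v * ·) (hψ.mul_x_left j)
  beta_reduce at this
  rw [← mul_smul_one_mul, hv, ← mul_assoc] at this
  rw [this, mul_sub, mul_smul, ← mul_smul_one_mul, hv, mul_smul_one_mul]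
  split_ifs
  · rw [hv]
  · simp

theorem mul_mul_x_of_ne (hψ : IsCrossing W k l ψ) (hv : HasWeight W v j) (hj : j k ≠ j l)
    (m : Fin n) : v * ψ * W.x m • (1 : A) = v * W.x (Equiv.swap k l m) • (1 : A) * ψ := by
  by_cases hk : m = k
  · subst hk
    rw [hψ.mul_mul_x_left hv, if_neg hj, sub_zero, Equiv.swap_apply_left]
  · by_cases hl : m = l
    · subst hl
      rw [hψ.mul_mul_x_right hv, if_neg hj, add_zero, Equiv.swap_apply_right]
    · rw [hψ.mul_x_of_ne hk hl, Equiv.swap_apply_of_ne_of_ne hk hl]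

theorem mul_mul_b_of_ne (hψ : IsCrossing W k l ψ) (hv : HasWeight W v j) (hj : j k ≠ j l)
    (m q : Fin n) : v * ψ * W.b m q • (1 : A) =
      v * W.b (Equiv.swap k l m) (Equiv.swap k l q) • (1 : A) * ψ := by
  set σ := Equiv.swap k l
  by_cases h : j (σ m) = j (σ q)
  · rw [hv.mul_congr (c := W.b (σ m) (σ q)) (d := 1) (by rw [W.b_of_eq _ _ _ h, one_mul]),
      (hψ.hasWeight_mul hv).mul_congr (c := W.b m q) (d := 1)
        (by rw [W.b_of_eq m q (j ∘ σ) h, one_mul])]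
    simp
  · have h1 := W.b_of_ne _ _ _ h
    have hw := hv.mul_smul_one (W.b (σ m) (σ q))
    have key : v * W.b (σ m) (σ q) • (1 : A) * ψ * (W.x m - W.x q) • (1 : A) = v * ψ := by
      rw [sub_smul, mul_sub, hψ.mul_mul_x_of_ne hw hj, hψ.mul_mul_x_of_ne hw hj, ← sub_mul,
        ← mul_sub, ← sub_smul, mul_assoc v, smul_one_mul_smul_one,
        hv.mul_congr (d := 1) (by rw [mul_comm (W.b _ _), h1, one_mul])]
      simp
    rw [← key, mul_assoc _ (_ • (1 : A)), smul_one_mul_smul_one,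
      (hψ.hasWeight_mul hw).mul_congr (d := 1)
        (by rw [W.b_of_ne m q (j ∘ σ) h, one_mul])]
    simp

/-- Moving a function through a crossing which does not involve its arguments. -/
theorem mul_mul_b_of_disjoint (hψ : IsCrossing W k l ψ) (hv : HasWeight W v j) {m q : Fin n}
    (hmk : m ≠ k) (hml : m ≠ l) (hqk : q ≠ k) (hql : q ≠ l) :
    v * ψ * W.b m q • (1 : A) = v * W.b m q • (1 : A) * ψ := by
  have hσm : Equiv.swap k l m = m := Equiv.swap_apply_of_ne_of_ne hmk hml
  have hσq : Equiv.swap k l q = q := Equiv.swap_apply_of_ne_of_ne hqk hql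
  have hw := hv.mul_smul_one (W.b m q)
  by_cases h : j m = j q
  · rw [hv.mul_congr (c := W.b m q) (d := 1) (by rw [W.b_of_eq _ _ _ h, one_mul]),
      (hψ.hasWeight_mul hv).mul_congr (c := W.b m q) (d := 1)
        (by rw [W.b_of_eq _ _ _ (by simpa [hσm, hσq] using h), one_mul])]
    simp
  · have h1 := W.b_of_ne _ _ _ h
    have key : v * W.b m q • (1 : A) * ψ * (W.x m - W.x q) • (1 : A) = v * ψ := by
      rw [sub_smul, mul_sub, hψ.mul_x_of_ne hmk hml, hψ.mul_x_of_ne hqk hql, ← sub_mul,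
        ← mul_sub, ← sub_smul, mul_assoc v (W.b m q • (1 : A)), smul_one_mul_smul_one,
        hv.mul_congr (d := 1) (by rw [mul_comm (W.b _ _), h1, one_mul])]
      simp
    rw [← key, mul_assoc _ ((W.x m - W.x q) • (1 : A)), smul_one_mul_smul_one,
      (hψ.hasWeight_mul hw).mul_congr (d := 1)
        (by rw [W.b_of_ne m q (j ∘ Equiv.swap k l) (by simpa [hσm, hσq] using h), one_mul])]
    simp

theorem mul_b_of_disjoint (hψ : IsCrossing W k l ψ) {m q : Fin n} (hmk : m ≠ k) (hml : m ≠ l)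
    (hqk : q ≠ k) (hql : q ≠ l) : ψ * W.b m q • (1 : A) = W.b m q • ψ := by
  refine W.ext_e fun i ↦ ?_
  have := hψ.mul_mul_b_of_disjoint (hasWeight_e (A := A) i) hmk hml hqk hql
  rwa [smul_mul_assoc, one_mul, smul_mul_assoc, smul_one_mul_smul_one, smul_mul_assoc, one_mul,
    mul_smul] at this

theorem mul_mul_b_left_of_eq (hψ : IsCrossing W k l ψ) (hv : HasWeight W v j) (hj : j k = j l)
    {m : Fin n} (hmk : m ≠ k) (hml : m ≠ l) (hm : j k ≠ j m) :
    v * ψ * W.b k m • (1 : A) = v * W.b l m • (1 : A) * ψ +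
      v * (W.b k m * W.b l m) • (1 : A) := by
  have hw := hv.mul_smul_one (W.b l m)
  have hσ := comp_swap_of_eq hj
  have hψv := hψ.hasWeight_mul hv
  have hψw := hψ.hasWeight_mul hw
  rw [hσ] at hψv hψw
  have key : v * W.b l m • (1 : A) * ψ * (W.x k - W.x m) • (1 : A) =
      v * ψ - v * W.b l m • (1 : A) := by
    rw [sub_smul, mul_sub, hψ.mul_mul_x_left hw, hψ.mul_x_of_ne hmk hml, if_pos hj, sub_right_comm,
      ← sub_mul, ← mul_sub, ← sub_smul, mul_assoc v (W.b l m • (1 : A)), smul_one_mul_smul_one,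
      hv.mul_congr (d := 1) (by rw [mul_comm (W.b _ _), W.b_of_ne _ _ _ (hj ▸ hm), one_mul])]
    simp
  have := congrArg (· * W.b k m • (1 : A)) key
  beta_reduce at this
  rw [mul_assoc _ ((W.x k - W.x m) • (1 : A)), smul_one_mul_smul_one,
    hψw.mul_congr (d := 1) (by rw [W.b_of_ne _ _ _ hm, one_mul]), one_smul, mul_one,
    sub_mul, mul_assoc v (W.b l m • (1 : A)) (W.b k m • (1 : A)), smul_one_mul_smul_one] at this
  rw [this, mul_comm (W.b k m)]
  abel

theorem mul_mul_b_right_of_eq (hψ : IsCrossing W k l ψ) (hv : HasWeight W v j) (hj : j k = j l)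
    {m : Fin n} (hmk : m ≠ k) (hml : m ≠ l) (hm : j k ≠ j m) :
    v * ψ * W.b l m • (1 : A) = v * W.b k m • (1 : A) * ψ -
      v * (W.b k m * W.b l m) • (1 : A) := by
  have hw := hv.mul_smul_one (W.b k m)
  have hσ := comp_swap_of_eq hj
  have hψv := hψ.hasWeight_mul hv
  have hψw := hψ.hasWeight_mul hw
  rw [hσ] at hψv hψw
  have key : v * W.b k m • (1 : A) * ψ * (W.x l - W.x m) • (1 : A) =
      v * ψ + v * W.b k m • (1 : A) := by
    rw [sub_smul, mul_sub, hψ.mul_mul_x_right hw, hψ.mul_x_of_ne hmk hml, if_pos hj,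
      add_sub_right_comm, ← sub_mul, ← mul_sub, ← sub_smul, mul_assoc v (W.b k m • (1 : A)),
      smul_one_mul_smul_one,
      hv.mul_congr (d := 1) (by rw [mul_comm (W.b _ _), W.b_of_ne _ _ _ hm, one_mul])]
    simp
  have := congrArg (· * W.b l m • (1 : A)) key
  beta_reduce at this
  rw [mul_assoc _ ((W.x l - W.x m) • (1 : A)), smul_one_mul_smul_one,
    hψw.mul_congr (d := 1) (by rw [W.b_of_ne _ _ _ (hj ▸ hm), one_mul]), one_smul, mul_one,
    add_mul, mul_assoc v (W.b k m • (1 : A)) (W.b l m • (1 : A)), smul_one_mul_smul_one] at this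
  rw [this]
  abel

end IsCrossing

/-- The reflection attached to `ψ`. -/
def reflectionOf (W : ResidueSystem p n C) (k l : Fin n) (ψ : A) : A :=
  W.g k l • ψ - W.b k l • (1 : A)

variable {k l : Fin n} {ψ v : A} {j : Fin n → ZMod p}

theorem HasWeight.mul_reflectionOf_of_eq (hv : HasWeight W v j) (hj : j k = j l) :
    v * reflectionOf W k l ψ =
      (v - v * W.x k • (1 : A) + v * W.x l • (1 : A)) * ψ - v := by
  rw [reflectionOf, mul_sub, ← mul_smul_one_mul, hv.mul_congr (W.g_of_eq hj),
    hv.mul_congr (c := W.b k l) (d := 1) (by rw [W.b_of_eq _ _ _ hj, one_mul])]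
  simp only [add_smul, sub_smul, mul_add, mul_sub, one_smul, mul_one]

theorem HasWeight.mul_reflectionOf_of_ne (hv : HasWeight W v j) (hj : j k ≠ j l) :
    v * reflectionOf W k l ψ = eps C (j k) (j l) • (v * ψ) - v * W.b k l • (1 : A) * ψ
      - v * W.b k l • (1 : A) := by
  rw [reflectionOf, mul_sub, ← mul_smul_one_mul, hv.mul_congr (W.g_of_ne hj), sub_smul, mul_sub,
    sub_mul, mul_smul_one_mul]
  unfold eps
  split_ifs <;> simp

end Moves

section Quadratic

variable {p n : ℕ} [NeZero p] {C : Type*} [CommRing C] {W : ResidueSystem p n C}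
  {A : Type*} [Ring A] [Module C A] [IsScalarTower C A A]

omit [IsScalarTower C A A] in
theorem smul_congr_of_e {v : A} {i : Fin n → ZMod p} (hv : W.e i • v = v) {c d : C}
    (h : c * W.e i = d * W.e i) : c • v = d • v := by
  rw [← hv, smul_smul, smul_smul, h]

theorem exists_e_smul_one (W : ResidueSystem p n C) (A : Type*) [Ring A] [Module C A]
    [IsScalarTower C A A] (i : Fin n → ZMod p) :
    ∃ E : A, E = W.e i • 1 ∧ HasWeight W E i ∧ W.e i • E = E ∧ ∀ c : C, E * c • (1 : A) = c • E :=
  ⟨_, rfl, hasWeight_e i, by rw [smul_smul, W.e_mul_self], fun c ↦ by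
    rw [smul_one_mul_smul_one, smul_smul, mul_comm]⟩

variable {k l : Fin n} {ψ : A}

theorem IsCrossing.reflectionOf_sq_sub (hp : 2 < p) (hψ : IsCrossing W k l ψ)
    (i : Fin n → ZMod p) :
    W.e i • (1 : A) * reflectionOf W k l ψ * reflectionOf W k l ψ - W.e i • (1 : A) =
      (W.g k l * W.g l k) • (W.e i • (1 : A) * ψ * ψ - W.Q k l i • W.e i • (1 : A)) := by
  obtain ⟨E, hE', hE, hEe, hEc⟩ := exists_e_smul_one W A i
  rw [← hE']
  have h1 := hψ.hasWeight_mul hE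
  have h1e : W.e i • (E * ψ) = E * ψ := by rw [← smul_mul_assoc, hEe]
  have h11e : W.e i • (E * ψ * ψ) = E * ψ * ψ := by rw [← smul_mul_assoc, h1e]
  by_cases hi : i k = i l
  · have e1 := hE.mul_reflectionOf_of_eq (ψ := ψ) hi
    rw [comp_swap_of_eq hi] at h1
    have e2 := h1.mul_reflectionOf_of_eq (ψ := ψ) hi
    rw [hψ.mul_mul_x_left hE, hψ.mul_mul_x_right hE, if_pos hi] at e2
    simp only [hEc, sub_mul, add_mul, smul_mul_assoc] at e1 e2
    have hg : W.g k l * W.g l k * W.e i = (1 - W.x k + W.x l) * (1 - W.x l + W.x k) * W.e i := by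
      linear_combination W.g l k * W.g_of_eq hi + (1 - W.x k + W.x l) * W.g_of_eq hi.symm
    have hQ : W.Q k l i = 0 := if_pos hi
    rw [hQ, zero_smul, sub_zero, smul_congr_of_e h11e hg, e1]
    simp only [sub_mul, add_mul, smul_mul_assoc, e2, e1]
    module
  · have hl : (i ∘ Equiv.swap k l) k = i l := by simp
    have hr : (i ∘ Equiv.swap k l) l = i k := by simp
    have e1 := hE.mul_reflectionOf_of_ne (ψ := ψ) hi
    have e2 := h1.mul_reflectionOf_of_ne (ψ := ψ) (k := k) (l := l)
      (by rw [hl, hr]; exact Ne.symm hi)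
    rw [hψ.mul_mul_b_of_ne hE hi, hl, hr, Equiv.swap_apply_left, Equiv.swap_apply_right] at e2
    simp only [hEc, smul_mul_assoc] at e1 e2
    have hg : W.g k l * W.g l k * W.e i =
        (eps C (i k) (i l) - W.b k l) * (eps C (i l) (i k) + W.b k l) * W.e i := by
      linear_combination W.g l k * W.g_of_ne hi + (eps C (i k) (i l) - W.b k l) *
        W.g_of_ne (Ne.symm hi) - (eps C (i k) (i l) - W.b k l) * W.b_comm hi
    have hQ : W.g k l * W.g l k * W.Q k l i * W.e i = (1 - W.b k l ^ 2) * W.e i := by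
      linear_combination W.Q k l i * hg + W.eps_sub_mul_eps_add_mul_Q hp hi
    rw [smul_sub, smul_congr_of_e h11e hg, smul_smul, smul_congr_of_e hEe hQ, e1]
    simp only [sub_mul, smul_mul_assoc, e2, e1]
    have hb1 := smul_congr_of_e h1e (W.b_comm hi)
    have hb2 := smul_congr_of_e h11e (W.b_comm hi)
    linear_combination (norm := module) (-eps C (i k) (i l) + W.b k l) • (hb1 + hb2)

end Quadratic

section Braid

variable {p n : ℕ} [NeZero p] {C : Type*} [CommRing C] {W : ResidueSystem p n C}
  {A : Type*} [Ring A] [Module C A] [IsScalarTower C A A]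

theorem mul_mul_smul_one (v : A) (c d : C) :
    v * (c * d) • (1 : A) = v * c • (1 : A) * d • (1 : A) := by
  rw [mul_assoc, smul_one_mul_smul_one]

namespace IsCrossing

variable {k l m : Fin n} {ψ v : A} {j : Fin n → ZMod p}

theorem exists_hasWeight_mul (hψ : IsCrossing W k l ψ) (hv : HasWeight W v j) (hk : m ≠ k)
    (hl : m ≠ l) :
    ∃ j', HasWeight W (v * ψ) j' ∧ j' k = j l ∧ j' l = j k ∧ j' m = j m :=
  ⟨_, hψ.hasWeight_mul hv, by simp, by simp, by simp [Equiv.swap_apply_of_ne_of_ne hk hl]⟩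

theorem mul_mul_b_swap (hψ : IsCrossing W k l ψ) (hv : HasWeight W v j) (hj : j k ≠ j l) :
    v * ψ * W.b k l • (1 : A) = v * W.b l k • (1 : A) * ψ := by
  rw [hψ.mul_mul_b_of_ne hv hj, Equiv.swap_apply_left, Equiv.swap_apply_right]

theorem mul_mul_b_left (hψ : IsCrossing W k l ψ) (hv : HasWeight W v j) (hj : j k ≠ j l)
    (hk : m ≠ k) (hl : m ≠ l) :
    v * ψ * W.b k m • (1 : A) = v * W.b l m • (1 : A) * ψ := by
  rw [hψ.mul_mul_b_of_ne hv hj, Equiv.swap_apply_left, Equiv.swap_apply_of_ne_of_ne hk hl]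

theorem mul_mul_b_right (hψ : IsCrossing W k l ψ) (hv : HasWeight W v j) (hj : j k ≠ j l)
    (hk : m ≠ k) (hl : m ≠ l) :
    v * ψ * W.b l m • (1 : A) = v * W.b k m • (1 : A) * ψ := by
  rw [hψ.mul_mul_b_of_ne hv hj, Equiv.swap_apply_right, Equiv.swap_apply_of_ne_of_ne hk hl]

theorem mul_mul_b_left' (hψ : IsCrossing W k l ψ) (hv : HasWeight W v j) (hj : j k ≠ j l)
    (hk : m ≠ k) (hl : m ≠ l) :
    v * ψ * W.b m k • (1 : A) = v * W.b m l • (1 : A) * ψ := by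
  rw [hψ.mul_mul_b_of_ne hv hj, Equiv.swap_apply_left, Equiv.swap_apply_of_ne_of_ne hk hl]

theorem mul_mul_b_right' (hψ : IsCrossing W k l ψ) (hv : HasWeight W v j) (hj : j k ≠ j l)
    (hk : m ≠ k) (hl : m ≠ l) :
    v * ψ * W.b m l • (1 : A) = v * W.b m k • (1 : A) * ψ := by
  rw [hψ.mul_mul_b_of_ne hv hj, Equiv.swap_apply_right, Equiv.swap_apply_of_ne_of_ne hk hl]

theorem mul_mul_b_left_of_eq' (hψ : IsCrossing W k l ψ) (hv : HasWeight W v j) (hj : j k = j l)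
    (hk : m ≠ k) (hl : m ≠ l) (hm : j k ≠ j m) :
    v * ψ * W.b m k • (1 : A) = v * W.b m l • (1 : A) * ψ -
      v * (W.b m k * W.b m l) • (1 : A) := by
  have hψv := hψ.hasWeight_mul hv
  rw [comp_swap_of_eq hj] at hψv
  rw [hψv.mul_congr (W.b_comm hm), hv.mul_congr (W.b_comm (hj ▸ hm)),
    hv.mul_congr (c := W.b m k * W.b m l) (d := W.b k m * W.b l m) (by
      linear_combination W.b m l * W.b_comm hm - W.b k m * W.b_comm (hj ▸ hm : j l ≠ j m)),
    neg_smul, mul_neg, hψ.mul_mul_b_left_of_eq hv hj hk hl hm]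
  simp [sub_eq_add_neg, add_comm]

theorem mul_mul_b_right_of_eq' (hψ : IsCrossing W k l ψ) (hv : HasWeight W v j) (hj : j k = j l)
    (hk : m ≠ k) (hl : m ≠ l) (hm : j k ≠ j m) :
    v * ψ * W.b m l • (1 : A) = v * W.b m k • (1 : A) * ψ +
      v * (W.b m k * W.b m l) • (1 : A) := by
  have hψv := hψ.hasWeight_mul hv
  rw [comp_swap_of_eq hj] at hψv
  rw [hψv.mul_congr (W.b_comm (hj ▸ hm)), hv.mul_congr (W.b_comm hm),
    hv.mul_congr (c := W.b m k * W.b m l) (d := W.b k m * W.b l m) (by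
      linear_combination W.b m l * W.b_comm hm - W.b k m * W.b_comm (hj ▸ hm : j l ≠ j m)),
    neg_smul, mul_neg, hψ.mul_mul_b_right_of_eq hv hj hk hl hm]
  simp [sub_eq_add_neg, add_comm]

end IsCrossing

variable {k l m : Fin n} {ψ₁ ψ₂ : A}

theorem b_mul_b {i : Fin n → ZMod p} (hkl : i k ≠ i l) (hlm : i l ≠ i m) (hkm : i k ≠ i m) :
    W.b k l * W.b l m * W.e i = (W.b k l * W.b k m + W.b k m * W.b l m) * W.e i := by
  linear_combination (-W.b k l * W.b l m) * W.b_of_ne k m i hkm +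
    W.b k l * W.b k m * W.b_of_ne l m i hlm + W.b k m * W.b l m * W.b_of_ne k l i hkl

omit [NeZero p] in
theorem two_ne_zero_of_two_lt (hp : 2 < p) : (2 : ZMod p) ≠ 0 := by
  intro h
  have : ((2 : ℕ) : ZMod p) = 0 := by exact_mod_cast h
  rw [ZMod.natCast_eq_zero_iff] at this
  exact absurd (Nat.le_of_dvd two_pos this) (by omega)

/-- The right-hand side of the KLR braid relation. -/
def braidConst (C : Type*) [Ring C] (k l m : Fin n) (i : Fin n → ZMod p) : C :=
  if i m = i k ∧ i l = i k + 1 then -1 else if i m = i k ∧ i l = i k - 1 then 1 else 0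

section

variable {i : Fin n → ZMod p} {E : A} (hp : 2 < p) (h₁ : IsCrossing W k l ψ₁)
  (h₂ : IsCrossing W l m ψ₂) (hkm : k ≠ m) (hE : HasWeight W E i) (hEe : W.e i • E = E)
  (hEc : ∀ c : C, E * c • (1 : A) = c • E) (q₁ : E * ψ₁ * ψ₁ = W.Q k l i • E)
  (q₂ : E * ψ₂ * ψ₂ = W.Q l m i • E)
include hp h₁ h₂ hkm hE hEe hEc q₁ q₂

theorem braid_sub_of_distinct (hkl : i k ≠ i l) (hlm : i l ≠ i m) (hikm : i k ≠ i m) :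
    E * reflectionOf W k l ψ₁ * reflectionOf W l m ψ₂ * reflectionOf W k l ψ₁ -
      E * reflectionOf W l m ψ₂ * reflectionOf W k l ψ₁ * reflectionOf W l m ψ₂ =
      (W.g k l * W.g k m * W.g l m) • (E * ψ₁ * ψ₂ * ψ₁ - E * ψ₂ * ψ₁ * ψ₂ -
        braidConst C k l m i • E) := by
  have hc : braidConst C k l m i = 0 := by
    rw [braidConst, if_neg (fun h ↦ hikm h.1.symm), if_neg (fun h ↦ hikm h.1.symm)]
  have hkl' := h₁.ne
  have hlm' := h₂.ne
  obtain ⟨j₁, w₁, j₁k, j₁l, j₁m⟩ := h₁.exists_hasWeight_mul hE hkm.symm hlm'.symm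
  obtain ⟨j₂, w₂, j₂l, j₂m, j₂k⟩ := h₂.exists_hasWeight_mul hE hkl' hkm
  obtain ⟨j₁₂, w₁₂, j₁₂l, j₁₂m, j₁₂k⟩ := h₂.exists_hasWeight_mul w₁ hkl' hkm
  obtain ⟨j₂₁, w₂₁, j₂₁k, j₂₁l, j₂₁m⟩ := h₁.exists_hasWeight_mul w₂ hkm.symm hlm'.symm
  simp only [j₁k, j₁l, j₁m, j₂k, j₂l, j₂m] at j₁₂k j₁₂l j₁₂m j₂₁k j₂₁l j₂₁m
  have e₁ : W.e i • (E * ψ₁) = E * ψ₁ := by rw [← smul_mul_assoc, hEe]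
  have e₂ : W.e i • (E * ψ₂) = E * ψ₂ := by rw [← smul_mul_assoc, hEe]
  have s₁ := hE.mul_reflectionOf_of_ne (k := k) (l := l) (ψ := ψ₁) hkl
  have s₂ := hE.mul_reflectionOf_of_ne (k := l) (l := m) (ψ := ψ₂) hlm
  have s₁₁ := w₁.mul_reflectionOf_of_ne (k := k) (l := l) (ψ := ψ₁) (by simpa [*] using hkl.symm)
  have s₂₂ := w₂.mul_reflectionOf_of_ne (k := l) (l := m) (ψ := ψ₂) (by simpa [*] using hlm.symm)
  have s₁₂ := w₁.mul_reflectionOf_of_ne (k := l) (l := m) (ψ := ψ₂) (by simp [*])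
  have s₂₁ := w₂.mul_reflectionOf_of_ne (k := k) (l := l) (ψ := ψ₁) (by simp [*])
  have s₁₂₁ := w₁₂.mul_reflectionOf_of_ne (k := k) (l := l) (ψ := ψ₁) (by simp [*])
  have s₂₁₂ := w₂₁.mul_reflectionOf_of_ne (k := l) (l := m) (ψ := ψ₂) (by simp [*])
  simp only [hEc, smul_mul_assoc] at s₁ s₂
  rw [h₁.mul_mul_b_swap hE hkl, j₁k, j₁l] at s₁₁
  rw [h₂.mul_mul_b_swap hE hlm, j₂l, j₂m] at s₂₂
  rw [h₁.mul_mul_b_right hE hkl hkm.symm hlm'.symm, j₁l, j₁m] at s₁₂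
  rw [h₂.mul_mul_b_left' hE hlm hkl' hkm, j₂k, j₂l] at s₂₁
  rw [h₂.mul_mul_b_left' w₁ (by rwa [j₁l, j₁m]) hkl' hkm, j₁₂k, j₁₂l,
    h₁.mul_mul_b_left hE hkl hkm.symm hlm'.symm] at s₁₂₁
  rw [h₁.mul_mul_b_right w₂ (by rwa [j₂k, j₂l]) hkm.symm hlm'.symm, j₂₁l, j₂₁m,
    h₂.mul_mul_b_right' hE hlm hkl' hkm] at s₂₁₂
  simp only [hEc, smul_mul_assoc, q₁, q₂] at s₁₁ s₂₂ s₁₂ s₂₁ s₁₂₁ s₂₁₂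
  rw [s₁, s₂, hc]
  simp only [sub_mul, smul_mul_assoc, s₁, s₂, s₁₁, s₂₂, s₁₂, s₂₁, s₁₂₁, s₂₁₂]
  have e₁₂ : W.e i • (E * ψ₁ * ψ₂) = E * ψ₁ * ψ₂ := by rw [← smul_mul_assoc, e₁]
  have e₂₁ : W.e i • (E * ψ₂ * ψ₁) = E * ψ₂ * ψ₁ := by rw [← smul_mul_assoc, e₂]
  have e₁₂₁ : W.e i • (E * ψ₁ * ψ₂ * ψ₁) = E * ψ₁ * ψ₂ * ψ₁ := by rw [← smul_mul_assoc, e₁₂]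
  have e₂₁₂ : W.e i • (E * ψ₂ * ψ₁ * ψ₂) = E * ψ₂ * ψ₁ * ψ₂ := by rw [← smul_mul_assoc, e₂₁]
  have hG : W.g k l * W.g k m * W.g l m * W.e i = (eps C (i k) (i l) - W.b k l) *
      (eps C (i k) (i m) - W.b k m) * (eps C (i l) (i m) - W.b l m) *
        W.e i := by
    linear_combination W.g k m * W.g l m * W.g_of_ne hkl + (eps C (i k) (i l) - W.b k l) *
      W.g l m * W.g_of_ne hikm + (eps C (i k) (i l) - W.b k l) *
      (eps C (i k) (i m) - W.b k m) * W.g_of_ne hlm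
  have hR := b_mul_b (W := W) hkl hlm hikm
  have hQ₁ := W.eps_sub_mul_eps_add_mul_Q hp hkl
  have hQ₂ := W.eps_sub_mul_eps_add_mul_Q hp hlm
  have hb₁ := W.b_comm hkl
  have hb₂ := W.b_comm hlm
  have cE : (-(eps C (i k) (i l) - W.b k l) * W.b k m * (eps C (i l) (i k) - W.b l k) *
      W.Q k l i - W.b k l * W.b k l * W.b l m + (eps C (i l) (i m) - W.b l m) * W.b k m *
      (eps C (i m) (i l) - W.b m l) * W.Q l m i + W.b l m * W.b l m * W.b k l) * W.e i =
      0 * W.e i := by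
    linear_combination (-W.b k m) * hQ₁ +
      W.b k m * (eps C (i k) (i l) - W.b k l) * W.Q k l i * hb₁ + W.b k m * hQ₂ -
      W.b k m * (eps C (i l) (i m) - W.b l m) * W.Q l m i * hb₂ - (W.b k l - W.b l m) * hR
  have c₁ : (eps C (i k) (i l) - W.b k l) * (W.b k m * W.b l k + W.b k l * W.b l m -
      W.b k m * W.b l m) * W.e i = 0 * W.e i := by
    linear_combination (eps C (i k) (i l) - W.b k l) * (W.b k m * hb₁ + hR)
  have c₂ : (eps C (i l) (i m) - W.b l m) * (W.b k l * W.b k m - W.b k m * W.b m l -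
      W.b k l * W.b l m) * W.e i = 0 * W.e i := by
    linear_combination (eps C (i l) (i m) - W.b l m) * (-W.b k m * hb₂ - hR)
  linear_combination (norm := module) smul_congr_of_e e₂₁₂ hG - smul_congr_of_e e₁₂₁ hG +
    smul_congr_of_e hEe cE + smul_congr_of_e e₁ c₁ + smul_congr_of_e e₂ c₂

theorem braid_sub_of_eq_left (hkl : i k = i l) (hlm : i l ≠ i m) :
    E * reflectionOf W k l ψ₁ * reflectionOf W l m ψ₂ * reflectionOf W k l ψ₁ -
      E * reflectionOf W l m ψ₂ * reflectionOf W k l ψ₁ * reflectionOf W l m ψ₂ =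
      (W.g k l * W.g k m * W.g l m) • (E * ψ₁ * ψ₂ * ψ₁ - E * ψ₂ * ψ₁ * ψ₂ -
        braidConst C k l m i • E) := by
  have hikm : i k ≠ i m := hkl ▸ hlm
  have hc : braidConst C k l m i = 0 := by
    rw [braidConst, if_neg (fun h ↦ hikm h.1.symm), if_neg (fun h ↦ hikm h.1.symm)]
  have hQ : W.Q k l i = 0 := if_pos hkl
  have hkl' := h₁.ne
  have hlm' := h₂.ne
  obtain ⟨j₁, w₁, j₁k, j₁l, j₁m⟩ := h₁.exists_hasWeight_mul hE hkm.symm hlm'.symm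
  obtain ⟨j₂, w₂, j₂l, j₂m, j₂k⟩ := h₂.exists_hasWeight_mul hE hkl' hkm
  obtain ⟨j₁₂, w₁₂, j₁₂l, j₁₂m, j₁₂k⟩ := h₂.exists_hasWeight_mul w₁ hkl' hkm
  obtain ⟨j₂₁, w₂₁, j₂₁k, j₂₁l, j₂₁m⟩ := h₁.exists_hasWeight_mul w₂ hkm.symm hlm'.symm
  simp only [j₁k, j₁l, j₁m, j₂k, j₂l, j₂m] at j₁₂k j₁₂l j₁₂m j₂₁k j₂₁l j₂₁m
  have e₁ : W.e i • (E * ψ₁) = E * ψ₁ := by rw [← smul_mul_assoc, hEe]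
  have e₂ : W.e i • (E * ψ₂) = E * ψ₂ := by rw [← smul_mul_assoc, hEe]
  have e₁₂₁ : W.e i • (E * ψ₁ * ψ₂ * ψ₁) = E * ψ₁ * ψ₂ * ψ₁ := by
    simp only [← smul_mul_assoc, hEe]
  have e₂₁₂ : W.e i • (E * ψ₂ * ψ₁ * ψ₂) = E * ψ₂ * ψ₁ * ψ₂ := by
    simp only [← smul_mul_assoc, hEe]
  have s₁ := hE.mul_reflectionOf_of_eq (k := k) (l := l) (ψ := ψ₁) hkl
  have s₂ := hE.mul_reflectionOf_of_ne (k := l) (l := m) (ψ := ψ₂) hlm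
  have s₁₁ := w₁.mul_reflectionOf_of_eq (k := k) (l := l) (ψ := ψ₁) (by simp [*])
  have s₂₂ := w₂.mul_reflectionOf_of_ne (k := l) (l := m) (ψ := ψ₂) (by simpa [*] using hlm.symm)
  have s₁₂ := w₁.mul_reflectionOf_of_ne (k := l) (l := m) (ψ := ψ₂) (by simp [*])
  have s₂₁ := w₂.mul_reflectionOf_of_ne (k := k) (l := l) (ψ := ψ₁) (by simp [*])
  have s₁₂₁ := w₁₂.mul_reflectionOf_of_ne (k := k) (l := l) (ψ := ψ₁) (by simp [*])
  have s₂₁₂ := w₂₁.mul_reflectionOf_of_eq (k := l) (l := m) (ψ := ψ₂) (by simp [*])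
  rw [h₁.mul_mul_x_left hE, h₁.mul_mul_x_right hE, if_pos hkl] at s₁₁
  rw [h₂.mul_mul_b_swap hE hlm, j₂l, j₂m] at s₂₂
  rw [h₁.mul_mul_b_right_of_eq hE hkl hkm.symm hlm'.symm hikm, mul_mul_smul_one, j₁l, j₁m] at s₁₂
  rw [h₂.mul_mul_b_left' hE hlm hkl' hkm, j₂k, j₂l] at s₂₁
  rw [h₂.mul_mul_b_left' w₁ (by simp [*]) hkl' hkm, j₁₂k, j₁₂l,
    h₁.mul_mul_b_left_of_eq hE hkl hkm.symm hlm'.symm hikm, mul_mul_smul_one] at s₁₂₁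
  rw [h₁.mul_mul_x_right w₂, if_neg (by simp [*]), h₁.mul_x_of_ne hkm.symm hlm'.symm,
    h₂.mul_x_of_ne hkl' hkm, h₂.mul_mul_x_right hE, if_neg hlm] at s₂₁₂
  simp only [hEc, smul_mul_assoc, add_mul, sub_mul, q₁, q₂, hQ, hkl, zero_smul, smul_zero,
    add_zero] at s₁ s₂ s₁₁ s₂₂ s₁₂ s₂₁ s₁₂₁ s₂₁₂
  rw [s₁, s₂, hc]
  simp only [sub_mul, add_mul, smul_mul_assoc, s₁, s₂, s₁₁, s₂₂, s₁₂, s₂₁, s₁₂₁, s₂₁₂]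
  have hG : W.g k l * W.g k m * W.g l m * W.e i =
      (1 - W.x k + W.x l) * (eps C (i k) (i m) - W.b k m) * (eps C (i l) (i m) - W.b l m) *
        W.e i := by
    linear_combination W.g k m * W.g l m * W.g_of_eq hkl +
      (1 - W.x k + W.x l) * W.g l m * W.g_of_ne hikm +
      (1 - W.x k + W.x l) * (eps C (i k) (i m) - W.b k m) * W.g_of_ne hlm
  rw [hkl] at hG
  have hQ₂ := W.eps_sub_mul_eps_add_mul_Q hp hlm
  have hb₂ := W.b_comm hlm
  have hR : (W.b k m - W.b l m + (W.x k - W.x l) * W.b k m * W.b l m) * W.e i = 0 := by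
    linear_combination W.b l m * W.b_of_ne k m i hikm - W.b k m * W.b_of_ne l m i hlm
  have cE : (-(1 - W.x k + W.x l) * W.b k m * W.b l m - W.b l m +
      W.b k m * (eps C (i l) (i m) - W.b l m) * (eps C (i m) (i l) - W.b m l) * W.Q l m i +
      W.b l m * (1 - W.x k + W.x l) * W.b k m * W.b l m + W.b l m ^ 2) * W.e i =
      0 * W.e i := by
    linear_combination W.b k m * hQ₂ -
      W.b k m * (eps C (i l) (i m) - W.b l m) * W.Q l m i * hb₂ + (1 - W.b l m) * hR
  have c₁ : (1 - W.x k + W.x l) * (-W.b k m + W.b l m -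
      (W.x k - W.x l) * W.b k m * W.b l m) * W.e i = 0 * W.e i := by
    linear_combination (-(1 - W.x k + W.x l)) * hR
  have c₂ : (eps C (i l) (i m) - W.b l m) * (-(1 - W.x k + W.x l) * W.b k m * W.b l m +
      W.b k m - W.b k m * W.b m l - W.b l m) * W.e i = 0 * W.e i := by
    linear_combination (eps C (i l) (i m) - W.b l m) * (hR - W.b k m * hb₂)
  linear_combination (norm := module) smul_congr_of_e e₂₁₂ hG - smul_congr_of_e e₁₂₁ hG +
    smul_congr_of_e hEe cE + smul_congr_of_e e₁ c₁ + smul_congr_of_e e₂ c₂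

theorem braid_sub_of_eq_right (hkl : i k ≠ i l) (hlm : i l = i m) :
    E * reflectionOf W k l ψ₁ * reflectionOf W l m ψ₂ * reflectionOf W k l ψ₁ -
      E * reflectionOf W l m ψ₂ * reflectionOf W k l ψ₁ * reflectionOf W l m ψ₂ =
      (W.g k l * W.g k m * W.g l m) • (E * ψ₁ * ψ₂ * ψ₁ - E * ψ₂ * ψ₁ * ψ₂ -
        braidConst C k l m i • E) := by
  have hikm : i k ≠ i m := hlm ▸ hkl
  have hc : braidConst C k l m i = 0 := by
    rw [braidConst, if_neg (fun h ↦ hikm h.1.symm), if_neg (fun h ↦ hikm h.1.symm)]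
  have hQ : W.Q l m i = 0 := if_pos hlm
  have hkl' := h₁.ne
  have hlm' := h₂.ne
  obtain ⟨j₁, w₁, j₁k, j₁l, j₁m⟩ := h₁.exists_hasWeight_mul hE hkm.symm hlm'.symm
  obtain ⟨j₂, w₂, j₂l, j₂m, j₂k⟩ := h₂.exists_hasWeight_mul hE hkl' hkm
  obtain ⟨j₁₂, w₁₂, j₁₂l, j₁₂m, j₁₂k⟩ := h₂.exists_hasWeight_mul w₁ hkl' hkm
  obtain ⟨j₂₁, w₂₁, j₂₁k, j₂₁l, j₂₁m⟩ := h₁.exists_hasWeight_mul w₂ hkm.symm hlm'.symm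
  simp only [j₁k, j₁l, j₁m, j₂k, j₂l, j₂m] at j₁₂k j₁₂l j₁₂m j₂₁k j₂₁l j₂₁m
  have e₁ : W.e i • (E * ψ₁) = E * ψ₁ := by rw [← smul_mul_assoc, hEe]
  have e₂ : W.e i • (E * ψ₂) = E * ψ₂ := by rw [← smul_mul_assoc, hEe]
  have e₁₂₁ : W.e i • (E * ψ₁ * ψ₂ * ψ₁) = E * ψ₁ * ψ₂ * ψ₁ := by
    simp only [← smul_mul_assoc, hEe]
  have e₂₁₂ : W.e i • (E * ψ₂ * ψ₁ * ψ₂) = E * ψ₂ * ψ₁ * ψ₂ := by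
    simp only [← smul_mul_assoc, hEe]
  have s₁ := hE.mul_reflectionOf_of_ne (k := k) (l := l) (ψ := ψ₁) hkl
  have s₂ := hE.mul_reflectionOf_of_eq (k := l) (l := m) (ψ := ψ₂) hlm
  have s₁₁ := w₁.mul_reflectionOf_of_ne (k := k) (l := l) (ψ := ψ₁) (by simpa [*] using hkl.symm)
  have s₂₂ := w₂.mul_reflectionOf_of_eq (k := l) (l := m) (ψ := ψ₂) (by simp [*])
  have s₁₂ := w₁.mul_reflectionOf_of_ne (k := l) (l := m) (ψ := ψ₂) (by simp [*])
  have s₂₁ := w₂.mul_reflectionOf_of_ne (k := k) (l := l) (ψ := ψ₁) (by simp [*])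
  have s₁₂₁ := w₁₂.mul_reflectionOf_of_eq (k := k) (l := l) (ψ := ψ₁) (by simp [*])
  have s₂₁₂ := w₂₁.mul_reflectionOf_of_ne (k := l) (l := m) (ψ := ψ₂) (by simp [*])
  rw [h₁.mul_mul_b_swap hE hkl, j₁k, j₁l] at s₁₁
  rw [h₂.mul_mul_x_left hE, h₂.mul_mul_x_right hE, if_pos hlm] at s₂₂
  rw [h₁.mul_mul_b_right hE hkl hkm.symm hlm'.symm, j₁l, j₁m] at s₁₂
  rw [h₂.mul_mul_b_left_of_eq' hE hlm hkl' hkm hkl.symm, mul_mul_smul_one, j₂k, j₂l] at s₂₁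
  rw [h₂.mul_x_of_ne hkl' hkm, h₁.mul_mul_x_left hE, if_neg hkl, h₂.mul_mul_x_left w₁,
    if_neg (by simp [*]), h₁.mul_x_of_ne hkm.symm hlm'.symm] at s₁₂₁
  rw [h₁.mul_mul_b_right w₂ (by simp [*]) hkm.symm hlm'.symm, j₂₁l, j₂₁m,
    h₂.mul_mul_b_right_of_eq' hE hlm hkl' hkm hkl.symm, mul_mul_smul_one] at s₂₁₂
  simp only [hEc, smul_mul_assoc, add_mul, sub_mul, q₁, q₂, hQ, hlm, zero_smul, smul_zero,
    sub_zero] at s₁ s₂ s₁₁ s₂₂ s₁₂ s₂₁ s₁₂₁ s₂₁₂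
  rw [s₁, s₂, hc]
  simp only [sub_mul, add_mul, smul_mul_assoc, s₁, s₂, s₁₁, s₂₂, s₁₂, s₂₁, s₁₂₁, s₂₁₂]
  have hG : W.g k l * W.g k m * W.g l m * W.e i =
      (eps C (i k) (i l) - W.b k l) * (eps C (i k) (i m) - W.b k m) * (1 - W.x l + W.x m) *
        W.e i := by
    linear_combination W.g k m * W.g l m * W.g_of_ne hkl +
      (eps C (i k) (i l) - W.b k l) * W.g l m * W.g_of_ne hikm +
      (eps C (i k) (i l) - W.b k l) * (eps C (i k) (i m) - W.b k m) * W.g_of_eq hlm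
  have hQ₁ := W.eps_sub_mul_eps_add_mul_Q hp hkl
  have hb₁ := W.b_comm hkl
  rw [hlm] at hG hQ₁
  have hR : (W.b k m - W.b k l + (W.x l - W.x m) * W.b k l * W.b k m) * W.e i = 0 := by
    linear_combination W.b k l * W.b_of_ne k m i hikm - W.b k m * W.b_of_ne k l i hkl
  have cE : (-(eps C (i k) (i m) - W.b k l) * W.b k m * (eps C (i m) (i k) - W.b l k) *
      W.Q k l i - W.b k l * (1 - W.x l + W.x m) * W.b k l * W.b k m - W.b k l ^ 2 +
      (1 - W.x l + W.x m) * W.b k l * W.b k m + W.b k l) * W.e i = 0 * W.e i := by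
    linear_combination (-W.b k m) * hQ₁ +
      W.b k m * (eps C (i k) (i m) - W.b k l) * W.Q k l i * hb₁ - (1 - W.b k l) * hR
  have c₁ : (eps C (i k) (i m) - W.b k l) * (W.b k m * W.b l k + W.b k l - W.b k m +
      W.b k l * W.b k m * (1 - W.x l + W.x m)) * W.e i = 0 * W.e i := by
    linear_combination (eps C (i k) (i m) - W.b k l) * (W.b k m * hb₁ - hR)
  have c₂ : (1 - W.x l + W.x m) * (W.b k m - W.b k l +
      (W.x l - W.x m) * W.b k l * W.b k m) * W.e i = 0 * W.e i := by
    linear_combination (1 - W.x l + W.x m) * hR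
  linear_combination (norm := module) smul_congr_of_e e₂₁₂ hG - smul_congr_of_e e₁₂₁ hG +
    smul_congr_of_e hEe cE + smul_congr_of_e e₁ c₁ + smul_congr_of_e e₂ c₂

theorem braid_sub_of_eq_outer (hkl : i k ≠ i l) (hikm : i k = i m) :
    E * reflectionOf W k l ψ₁ * reflectionOf W l m ψ₂ * reflectionOf W k l ψ₁ -
      E * reflectionOf W l m ψ₂ * reflectionOf W k l ψ₁ * reflectionOf W l m ψ₂ =
      (W.g k l * W.g k m * W.g l m) • (E * ψ₁ * ψ₂ * ψ₁ - E * ψ₂ * ψ₁ * ψ₂ -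
        braidConst C k l m i • E) := by
  have hlm : i l ≠ i m := hikm ▸ hkl.symm
  have hkl' := h₁.ne
  have hlm' := h₂.ne
  obtain ⟨j₁, w₁, j₁k, j₁l, j₁m⟩ := h₁.exists_hasWeight_mul hE hkm.symm hlm'.symm
  obtain ⟨j₂, w₂, j₂l, j₂m, j₂k⟩ := h₂.exists_hasWeight_mul hE hkl' hkm
  obtain ⟨j₁₂, w₁₂, j₁₂l, j₁₂m, j₁₂k⟩ := h₂.exists_hasWeight_mul w₁ hkl' hkm
  obtain ⟨j₂₁, w₂₁, j₂₁k, j₂₁l, j₂₁m⟩ := h₁.exists_hasWeight_mul w₂ hkm.symm hlm'.symm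
  simp only [j₁k, j₁l, j₁m, j₂k, j₂l, j₂m] at j₁₂k j₁₂l j₁₂m j₂₁k j₂₁l j₂₁m
  have e₁ : W.e i • (E * ψ₁) = E * ψ₁ := by rw [← smul_mul_assoc, hEe]
  have e₂ : W.e i • (E * ψ₂) = E * ψ₂ := by rw [← smul_mul_assoc, hEe]
  have e₁₂₁ : W.e i • (E * ψ₁ * ψ₂ * ψ₁) = E * ψ₁ * ψ₂ * ψ₁ := by
    simp only [← smul_mul_assoc, hEe]
  have e₂₁₂ : W.e i • (E * ψ₂ * ψ₁ * ψ₂) = E * ψ₂ * ψ₁ * ψ₂ := by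
    simp only [← smul_mul_assoc, hEe]
  have s₁ := hE.mul_reflectionOf_of_ne (k := k) (l := l) (ψ := ψ₁) hkl
  have s₂ := hE.mul_reflectionOf_of_ne (k := l) (l := m) (ψ := ψ₂) hlm
  have s₁₁ := w₁.mul_reflectionOf_of_ne (k := k) (l := l) (ψ := ψ₁) (by simp [*])
  have s₂₂ := w₂.mul_reflectionOf_of_ne (k := l) (l := m) (ψ := ψ₂) (by simpa [*] using hlm.symm)
  have s₁₂ := w₁.mul_reflectionOf_of_eq (k := l) (l := m) (ψ := ψ₂) (by simp [*])
  have s₂₁ := w₂.mul_reflectionOf_of_eq (k := k) (l := l) (ψ := ψ₁) (by simp [*])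
  have s₁₂₁ := w₁₂.mul_reflectionOf_of_ne (k := k) (l := l) (ψ := ψ₁) (by simp [*])
  have s₂₁₂ := w₂₁.mul_reflectionOf_of_ne (k := l) (l := m) (ψ := ψ₂) (by simpa [*] using hkl)
  rw [h₁.mul_mul_b_swap hE hkl, j₁k, j₁l] at s₁₁
  rw [h₂.mul_mul_b_swap hE hlm, j₂l, j₂m] at s₂₂
  rw [h₁.mul_mul_x_right hE, if_neg hkl, h₁.mul_x_of_ne hkm.symm hlm'.symm] at s₁₂
  rw [h₂.mul_mul_x_left hE, if_neg hlm, h₂.mul_x_of_ne hkl' hkm] at s₂₁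
  rw [h₂.mul_mul_b_left_of_eq' w₁ (by simp [*]) hkl' hkm (by simpa [*] using hkl), j₁₂k, j₁₂l,
    mul_mul_smul_one, h₁.mul_mul_b_left hE hkl hkm.symm hlm'.symm,
    h₁.mul_mul_b_swap hE hkl] at s₁₂₁
  rw [h₁.mul_mul_b_right_of_eq w₂ (by simp [*]) hkm.symm hlm'.symm (by simpa [*] using hlm.symm),
    j₂₁l, j₂₁m, mul_comm (W.b k m), mul_mul_smul_one, h₂.mul_mul_b_right' hE hlm hkl' hkm,
    h₂.mul_mul_b_swap hE hlm] at s₂₁₂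
  simp only [hEc, smul_mul_assoc, add_mul, sub_mul, q₁, q₂, add_zero, sub_zero,
    h₁.mul_mul_b_left hE hkl hkm.symm hlm'.symm, h₂.mul_mul_b_right' hE hlm hkl' hkm, ← hikm]
    at s₁ s₂ s₁₁ s₂₂ s₁₂ s₂₁ s₁₂₁ s₂₁₂
  rw [s₁, s₂]
  simp only [sub_mul, add_mul, smul_mul_assoc, s₁, s₂, s₁₁, s₂₂, s₁₂, s₂₁, s₁₂₁, s₂₁₂]
  have hG : W.g k l * W.g k m * W.g l m * W.e i =
      (eps C (i k) (i l) - W.b k l) * (1 - W.x k + W.x m) * (eps C (i l) (i m) - W.b l m) *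
        W.e i := by
    linear_combination W.g k m * W.g l m * W.g_of_ne hkl +
      (eps C (i k) (i l) - W.b k l) * W.g l m * W.g_of_eq hikm +
      (eps C (i k) (i l) - W.b k l) * (1 - W.x k + W.x m) * W.g_of_ne hlm
  have hQ₁ := W.eps_sub_mul_eps_add_mul_Q hp hkl
  have hQ₂ := W.eps_sub_mul_eps_add_mul_Q hp hlm
  have hb₁ := W.b_comm hkl
  have hb₂ := W.b_comm hlm
  rw [← hikm] at hG hQ₂
  have h₁₂ := W.b_of_ne k l i hkl
  have h₂₃ := W.b_of_ne l m i hlm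
  have hR : ((W.x k - W.x m) * W.b k l * W.b l m - W.b k l - W.b l m) * W.e i = 0 := by
    linear_combination W.b l m * h₁₂ + W.b k l * h₂₃
  have hrest : (-(eps C (i k) (i l) - W.b k l) * (1 - W.x k + W.x m) * W.b k l * W.b l m *
      W.Q k l i + W.b k l ^ 2 - W.b k l ^ 2 * W.b l m + (eps C (i l) (i k) - W.b l m) *
      (1 - W.x k + W.x m) * W.b k l * W.b l m * W.Q l m i - W.b l m ^ 2 + W.b k l * W.b l m ^ 2 +
      (1 - W.x k + W.x m) * (eps C (i k) (i l) - W.b k l) * (eps C (i l) (i k) - W.b l m) *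
      braidConst C k l m i) * W.e i = 0 := by
    have := two_ne_zero_of_two_lt hp
    by_cases hu : i l = i k + 1
    · have hd : i k ≠ i l + 1 := fun h ↦ this (by linear_combination -h - hu)
      rw [braidConst, if_pos ⟨hikm.symm, hu⟩, eps, eps, Q, Q, if_neg hkl, if_neg hlm, ← hikm,
        if_neg hd, if_pos hu, if_pos hu, if_neg hd, if_pos hu]
      linear_combination (-(1 - W.b k l) * (1 - W.x k + W.x m) * W.b l m -
        (W.b k l - W.b l m) * W.b l m) * h₁₂ + ((1 - W.x k + W.x m) * W.b k l * W.b l m -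
        (W.b k l - W.b l m) * W.b k l) * h₂₃
    · by_cases hd : i k = i l + 1
      · rw [braidConst, if_neg (fun h ↦ hu h.2), if_pos ⟨hikm.symm, eq_sub_of_add_eq hd.symm⟩,
          eps, eps, Q, Q, if_neg hkl, if_neg hlm, ← hikm, if_pos hd, if_neg hu, if_neg hu,
          if_pos hd, if_pos hd]
        linear_combination (-W.b k l * (1 - W.x k + W.x m) * W.b l m -
          (W.b k l - W.b l m) * W.b l m) * h₁₂ + ((1 - W.b l m) * (1 - W.x k + W.x m) * W.b k l -
          (W.b k l - W.b l m) * W.b k l) * h₂₃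
      · rw [braidConst, if_neg (fun h ↦ hu h.2),
          if_neg (fun h ↦ hd (eq_add_of_sub_eq h.2.symm)), eps, eps, Q, Q, if_neg hkl, if_neg hlm,
          ← hikm, if_neg hd, if_neg hu, if_neg hu, if_neg hd, if_neg hd, if_neg hu]
        linear_combination (-(W.b k l - W.b l m) * W.b l m) * h₁₂ -
          (W.b k l - W.b l m) * W.b k l * h₂₃
  have cE : ((eps C (i k) (i l) - W.b k l) * (1 - W.x k + W.x m) * W.b l k * W.b l m * W.Q k l i -
      (eps C (i k) (i l) - W.b k l) * (eps C (i l) (i k) - W.b l k) * W.Q k l i -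
      W.b k l ^ 2 * W.b l m - (eps C (i l) (i k) - W.b l m) * (1 - W.x k + W.x m) * W.b k l *
      W.b m l * W.Q l m i + (eps C (i l) (i k) - W.b l m) * (eps C (i k) (i l) - W.b m l) *
      W.Q l m i + W.b k l * W.b l m ^ 2 + (1 - W.x k + W.x m) * (eps C (i k) (i l) - W.b k l) *
      (eps C (i l) (i k) - W.b l m) * braidConst C k l m i) * W.e i = 0 * W.e i := by
    linear_combination hrest - hQ₁ + hQ₂ + (eps C (i k) (i l) - W.b k l) * W.Q k l i *
      (1 + (1 - W.x k + W.x m) * W.b l m) * hb₁ - (eps C (i l) (i k) - W.b l m) * W.Q l m i *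
      (1 + (1 - W.x k + W.x m) * W.b k l) * hb₂
  have c₁ : (eps C (i k) (i l) - W.b k l) * ((1 - W.x k + W.x m) * W.b l k * W.b l m + W.b l k +
      W.b k l * W.b l m - W.b l m) * W.e i = 0 * W.e i := by
    linear_combination (eps C (i k) (i l) - W.b k l) *
      (((1 - W.x k + W.x m) * W.b l m + 1) * hb₁ + hR)
  have c₂ : (eps C (i l) (i k) - W.b l m) * (W.b k l - (1 - W.x k + W.x m) * W.b k l * W.b m l -
      W.b m l - W.b k l * W.b l m) * W.e i = 0 * W.e i := by
    linear_combination (eps C (i l) (i k) - W.b l m) *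
      (-((1 - W.x k + W.x m) * W.b k l + 1) * hb₂ - hR)
  have hG' : W.g k l * W.g k m * W.g l m * braidConst C k l m i * W.e i =
      (eps C (i k) (i l) - W.b k l) * (1 - W.x k + W.x m) *
      (eps C (i l) (i k) - W.b l m) * braidConst C k l m i * W.e i := by
    linear_combination braidConst C k l m i * hG
  linear_combination (norm := module) smul_congr_of_e e₂₁₂ hG - smul_congr_of_e e₁₂₁ hG +
    smul_congr_of_e hEe hG' + smul_congr_of_e hEe cE + smul_congr_of_e e₁ c₁ +
    smul_congr_of_e e₂ c₂

theorem braid_sub_of_eq (hkl : i k = i l) (hlm : i l = i m) :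
    E * reflectionOf W k l ψ₁ * reflectionOf W l m ψ₂ * reflectionOf W k l ψ₁ -
      E * reflectionOf W l m ψ₂ * reflectionOf W k l ψ₁ * reflectionOf W l m ψ₂ =
      (W.g k l * W.g k m * W.g l m) • (E * ψ₁ * ψ₂ * ψ₁ - E * ψ₂ * ψ₁ * ψ₂ -
        braidConst C k l m i • E) := by
  have hikm : i k = i m := hkl.trans hlm
  have hc : braidConst C k l m i = 0 := by
    have := Fact.mk (show 1 < p by omega)
    rw [braidConst, if_neg (fun h ↦ ?_), if_neg (fun h ↦ ?_)]
    · exact one_ne_zero (α := ZMod p) (by linear_combination hkl + h.2)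
    · exact one_ne_zero (α := ZMod p) (by linear_combination -hkl - h.2)
  have hQ₁ : W.Q k l i = 0 := if_pos hkl
  have hQ₂ : W.Q l m i = 0 := if_pos hlm
  have hkl' := h₁.ne
  have hlm' := h₂.ne
  obtain ⟨j₁, w₁, j₁k, j₁l, j₁m⟩ := h₁.exists_hasWeight_mul hE hkm.symm hlm'.symm
  obtain ⟨j₂, w₂, j₂l, j₂m, j₂k⟩ := h₂.exists_hasWeight_mul hE hkl' hkm
  obtain ⟨j₁₂, w₁₂, j₁₂l, j₁₂m, j₁₂k⟩ := h₂.exists_hasWeight_mul w₁ hkl' hkm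
  obtain ⟨j₂₁, w₂₁, j₂₁k, j₂₁l, j₂₁m⟩ := h₁.exists_hasWeight_mul w₂ hkm.symm hlm'.symm
  simp only [j₁k, j₁l, j₁m, j₂k, j₂l, j₂m] at j₁₂k j₁₂l j₁₂m j₂₁k j₂₁l j₂₁m
  have e₁ : W.e i • (E * ψ₁) = E * ψ₁ := by rw [← smul_mul_assoc, hEe]
  have e₂ : W.e i • (E * ψ₂) = E * ψ₂ := by rw [← smul_mul_assoc, hEe]
  have e₁₂₁ : W.e i • (E * ψ₁ * ψ₂ * ψ₁) = E * ψ₁ * ψ₂ * ψ₁ := by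
    simp only [← smul_mul_assoc, hEe]
  have e₂₁₂ : W.e i • (E * ψ₂ * ψ₁ * ψ₂) = E * ψ₂ * ψ₁ * ψ₂ := by
    simp only [← smul_mul_assoc, hEe]
  have s₁ := hE.mul_reflectionOf_of_eq (k := k) (l := l) (ψ := ψ₁) hkl
  have s₂ := hE.mul_reflectionOf_of_eq (k := l) (l := m) (ψ := ψ₂) hlm
  have s₁₁ := w₁.mul_reflectionOf_of_eq (k := k) (l := l) (ψ := ψ₁) (by simp [*])
  have s₂₂ := w₂.mul_reflectionOf_of_eq (k := l) (l := m) (ψ := ψ₂) (by simp [*])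
  have s₁₂ := w₁.mul_reflectionOf_of_eq (k := l) (l := m) (ψ := ψ₂) (by simp [*])
  have s₂₁ := w₂.mul_reflectionOf_of_eq (k := k) (l := l) (ψ := ψ₁) (by simp [*])
  have s₁₂₁ := w₁₂.mul_reflectionOf_of_eq (k := k) (l := l) (ψ := ψ₁) (by simp [*])
  have s₂₁₂ := w₂₁.mul_reflectionOf_of_eq (k := l) (l := m) (ψ := ψ₂) (by simp [*])
  have x₁k := h₁.mul_mul_x_left hE
  have x₁l := h₁.mul_mul_x_right hE
  have x₂l := h₂.mul_mul_x_left hE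
  have x₂m := h₂.mul_mul_x_right hE
  have x₁m := h₁.mul_x_of_ne (v := E) hkm.symm hlm'.symm
  have x₂k := h₂.mul_x_of_ne (v := E) hkl' hkm
  rw [if_pos hkl] at x₁k x₁l
  rw [if_pos hlm] at x₂l x₂m
  rw [h₂.mul_x_of_ne hkl' hkm, h₂.mul_mul_x_left w₁, if_pos (by simp [*])] at s₁₂₁
  rw [h₁.mul_x_of_ne hkm.symm hlm'.symm, h₁.mul_mul_x_right w₂, if_pos (by simp [*])] at s₂₁₂
  simp only [x₁k, x₁l, x₁m, x₂k, x₂l, x₂m, hEc, smul_mul_assoc, add_mul, sub_mul, q₁, q₂, hQ₁,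
    hQ₂, zero_smul, smul_zero] at s₁ s₂ s₁₁ s₂₂ s₁₂ s₂₁ s₁₂₁ s₂₁₂
  rw [s₁, s₂, hc]
  simp only [sub_mul, add_mul, smul_mul_assoc, s₁, s₂, s₁₁, s₂₂, s₁₂, s₂₁, s₁₂₁, s₂₁₂]
  have hG : W.g k l * W.g k m * W.g l m * W.e i =
      (1 - W.x k + W.x l) * (1 - W.x k + W.x m) * (1 - W.x l + W.x m) *
        W.e i := by
    linear_combination W.g k m * W.g l m * W.g_of_eq hkl +
      (1 - W.x k + W.x l) * W.g l m * W.g_of_eq hikm +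
      (1 - W.x k + W.x l) * (1 - W.x k + W.x m) * W.g_of_eq hlm
  linear_combination (norm := module) smul_congr_of_e e₂₁₂ hG - smul_congr_of_e e₁₂₁ hG

end

end Braid

section CoxeterRelations

variable {p n : ℕ} [NeZero p] {C : Type*} [CommRing C] {W : ResidueSystem p n C}
  {A : Type*} [Ring A] [Module C A] [IsScalarTower C A A]

theorem ext_e_mul {a b : A} (h : ∀ i, W.e i • (1 : A) * a = W.e i • (1 : A) * b) : a = b :=
  W.ext_e fun i ↦ by simpa [smul_mul_assoc] using h i

omit [IsScalarTower C A A] in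
theorem g_smul_injective (k l : Fin n) : Function.Injective (W.g k l • · : A → A) := by
  intro a b h
  have := congrArg (W.h k l • ·) h
  simpa [smul_smul, mul_comm (W.h k l), W.g_mul_h] using this

variable {k l m : Fin n} {ψ ψ₁ ψ₂ : A}

theorem IsCrossing.reflectionOf_mul_self_iff (hp : 2 < p) (hψ : IsCrossing W k l ψ) :
    reflectionOf W k l ψ * reflectionOf W k l ψ = 1 ↔
      ∀ i, W.e i • (1 : A) * ψ * ψ = W.Q k l i • W.e i • (1 : A) := by
  constructor
  · intro h i
    have := hψ.reflectionOf_sq_sub hp i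
    rw [mul_assoc, h, mul_one, sub_self, mul_smul] at this
    exact sub_eq_zero.1 (g_smul_injective (W := W) l k (g_smul_injective (W := W) k l
      (by simpa using this.symm)))
  · refine fun h ↦ ext_e_mul (W := W) fun i ↦ ?_
    have := hψ.reflectionOf_sq_sub hp i
    rw [h, sub_self, smul_zero, sub_eq_zero] at this
    rw [← mul_assoc, this, mul_one]

theorem IsCrossing.braid_sub (hp : 2 < p) (h₁ : IsCrossing W k l ψ₁) (h₂ : IsCrossing W l m ψ₂)
    (hkm : k ≠ m) (q₁ : ∀ i, W.e i • (1 : A) * ψ₁ * ψ₁ = W.Q k l i • W.e i • (1 : A))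
    (q₂ : ∀ i, W.e i • (1 : A) * ψ₂ * ψ₂ = W.Q l m i • W.e i • (1 : A)) (i : Fin n → ZMod p) :
    W.e i • (1 : A) * reflectionOf W k l ψ₁ * reflectionOf W l m ψ₂ * reflectionOf W k l ψ₁ -
      W.e i • (1 : A) * reflectionOf W l m ψ₂ * reflectionOf W k l ψ₁ * reflectionOf W l m ψ₂ =
      (W.g k l * W.g k m * W.g l m) • (W.e i • (1 : A) * ψ₁ * ψ₂ * ψ₁ -
        W.e i • (1 : A) * ψ₂ * ψ₁ * ψ₂ - braidConst C k l m i • W.e i • (1 : A)) := by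
  obtain ⟨E, hE', hE, hEe, hEc⟩ := exists_e_smul_one W A i
  have q₁ := q₁ i
  have q₂ := q₂ i
  rw [← hE'] at q₁ q₂ ⊢
  by_cases hkl : i k = i l
  · by_cases hlm : i l = i m
    · exact braid_sub_of_eq hp h₁ h₂ hkm hE hEe hEc q₁ q₂ hkl hlm
    · exact braid_sub_of_eq_left hp h₁ h₂ hkm hE hEe hEc q₁ q₂ hkl hlm
  · by_cases hlm : i l = i m
    · exact braid_sub_of_eq_right hp h₁ h₂ hkm hE hEe hEc q₁ q₂ hkl hlm
    · by_cases hikm : i k = i m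
      · exact braid_sub_of_eq_outer hp h₁ h₂ hkm hE hEe hEc q₁ q₂ hkl hikm
      · exact braid_sub_of_distinct hp h₁ h₂ hkm hE hEe hEc q₁ q₂ hkl hlm hikm

theorem IsCrossing.braid_iff (hp : 2 < p) (h₁ : IsCrossing W k l ψ₁) (h₂ : IsCrossing W l m ψ₂)
    (hkm : k ≠ m) (q₁ : ∀ i, W.e i • (1 : A) * ψ₁ * ψ₁ = W.Q k l i • W.e i • (1 : A))
    (q₂ : ∀ i, W.e i • (1 : A) * ψ₂ * ψ₂ = W.Q l m i • W.e i • (1 : A)) :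
    reflectionOf W k l ψ₁ * reflectionOf W l m ψ₂ * reflectionOf W k l ψ₁ =
      reflectionOf W l m ψ₂ * reflectionOf W k l ψ₁ * reflectionOf W l m ψ₂ ↔
      ∀ i, W.e i • (1 : A) * ψ₁ * ψ₂ * ψ₁ - W.e i • (1 : A) * ψ₂ * ψ₁ * ψ₂ =
        braidConst C k l m i • W.e i • (1 : A) := by
  constructor
  · intro h i
    have := h₁.braid_sub hp h₂ hkm q₁ q₂ i
    simp only [mul_assoc] at h this
    rw [h, sub_self, mul_smul, mul_smul] at this
    simp only [mul_assoc]
    exact sub_eq_zero.1 (g_smul_injective (W := W) l m (g_smul_injective (W := W) k m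
      (g_smul_injective (W := W) k l (by simpa using this.symm))))
  · refine fun h ↦ ext_e_mul (W := W) fun i ↦ ?_
    have := h₁.braid_sub hp h₂ hkm q₁ q₂ i
    rw [h, sub_self, smul_zero, sub_eq_zero] at this
    simpa only [mul_assoc] using this

theorem IsCrossing.mul_g_of_disjoint (hψ : IsCrossing W k l ψ) {m q : Fin n} (hmk : m ≠ k)
    (hml : m ≠ l) (hqk : q ≠ k) (hql : q ≠ l) : ψ * W.g m q • (1 : A) = W.g m q • ψ := by
  refine ext_e_mul (W := W) fun i ↦ ?_
  obtain ⟨E, hE', hE, -, hEc⟩ := exists_e_smul_one W A i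
  rw [← hE', ← mul_assoc, ← mul_smul_one_mul (W.g m q) E]
  have hw := hψ.hasWeight_mul hE
  have hjm : (i ∘ Equiv.swap k l) m = i m := by simp [Equiv.swap_apply_of_ne_of_ne hmk hml]
  have hjq : (i ∘ Equiv.swap k l) q = i q := by simp [Equiv.swap_apply_of_ne_of_ne hqk hql]
  by_cases h : i m = i q
  · rw [hw.mul_congr (c := W.g m q) (W.g_of_eq (by rw [hjm, hjq, h])),
      hE.mul_congr (c := W.g m q) (W.g_of_eq h)]
    simp only [add_smul, sub_smul, mul_add, mul_sub, hψ.mul_x_of_ne hmk hml,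
      hψ.mul_x_of_ne hqk hql, add_mul, sub_mul, one_smul, mul_one]
  · rw [hw.mul_congr (c := W.g m q) (W.g_of_ne (by rwa [hjm, hjq])),
      hE.mul_congr (c := W.g m q) (W.g_of_ne h), hjm, hjq]
    simp only [sub_smul, mul_sub, hψ.mul_mul_b_of_disjoint hE hmk hml hqk hql, sub_mul]
    unfold eps
    split_ifs <;> simp

theorem IsCrossing.commute_reflectionOf_iff (h₁ : IsCrossing W k l ψ₁) {m q : Fin n}
    (h₂ : IsCrossing W m q ψ₂) (hmk : m ≠ k) (hml : m ≠ l) (hqk : q ≠ k) (hql : q ≠ l) :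
    reflectionOf W k l ψ₁ * reflectionOf W m q ψ₂ =
      reflectionOf W m q ψ₂ * reflectionOf W k l ψ₁ ↔ ψ₁ * ψ₂ = ψ₂ * ψ₁ := by
  have b₁ := h₁.mul_b_of_disjoint hmk hml hqk hql
  have g₁ := h₁.mul_g_of_disjoint hmk hml hqk hql
  have b₂ := h₂.mul_b_of_disjoint hmk.symm hqk.symm hml.symm hql.symm
  have g₂ := h₂.mul_g_of_disjoint hmk.symm hqk.symm hml.symm hql.symm
  have e₁ : reflectionOf W k l ψ₁ * reflectionOf W m q ψ₂ =
      W.g k l • W.g m q • (ψ₁ * ψ₂) - (W.g k l * W.b m q) • ψ₁ - (W.g m q * W.b k l) • ψ₂ +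
        (W.b k l * W.b m q) • 1 := by
    rw [reflectionOf, reflectionOf, sub_mul, mul_sub, mul_sub, smul_mul_assoc,
      ← mul_smul_one_mul, g₁, smul_mul_assoc _ _ (W.b m q • (1 : A)), b₁,
      smul_mul_assoc (W.b k l), one_mul, smul_one_mul_smul_one, smul_mul_assoc]
    module
  have e₂ : reflectionOf W m q ψ₂ * reflectionOf W k l ψ₁ =
      W.g k l • W.g m q • (ψ₂ * ψ₁) - (W.g k l * W.b m q) • ψ₁ - (W.g m q * W.b k l) • ψ₂ +
        (W.b k l * W.b m q) • 1 := by
    rw [reflectionOf, reflectionOf, sub_mul, mul_sub, mul_sub, smul_mul_assoc,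
      ← mul_smul_one_mul, g₂, smul_mul_assoc _ _ (W.b k l • (1 : A)), b₂,
      smul_mul_assoc (W.b m q), one_mul, smul_one_mul_smul_one, smul_mul_assoc]
    module
  rw [e₁, e₂, add_left_inj, sub_left_inj, sub_left_inj]
  exact ⟨fun h ↦ g_smul_injective (W := W) m q (g_smul_injective (W := W) k l h),
    fun h ↦ by rw [h]⟩

end CoxeterRelations

section Near

open Polynomial

/-- The monic polynomial with a given multiset of integral roots. -/
noncomputable def ofIntRoots (R : Type*) [CommRing R] (m : Multiset ℤ) : R[X] :=
  (m.map fun c : ℤ ↦ X - (c : R[X])).prod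

theorem aeval_ofIntRoots {R B : Type*} [CommRing R] [CommRing B] [Algebra R B] (m : Multiset ℤ)
    (z : B) : aeval z (ofIntRoots R m) = (m.map fun c : ℤ ↦ z - (c : B)).prod := by
  simp [ofIntRoots, map_multiset_prod, Multiset.map_map]

theorem ofIntRoots_add (R : Type*) [CommRing R] (m₁ m₂ : Multiset ℤ) :
    ofIntRoots R (m₁ + m₂) = ofIntRoots R m₁ * ofIntRoots R m₂ := by
  simp [ofIntRoots]

/-- Multisets of integers with prescribed residue modulo `p`. -/
def AllResidue (p : ℕ) (m : Multiset ℤ) (a : ZMod p) : Prop := ∀ c ∈ m, (c : ZMod p) = a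

theorem isCoprime_ofIntRoots {p : ℕ} {R : Type*} [CommRing R]
    (hR : ∀ c : ℤ, (c : ZMod p) ≠ 0 → IsUnit (c : R)) {m₁ m₂ : Multiset ℤ} {a b : ZMod p}
    (h₁ : AllResidue p m₁ a) (h₂ : AllResidue p m₂ b) (hab : a ≠ b) :
    IsCoprime (ofIntRoots R m₁) (ofIntRoots R m₂) := by
  have key : ∀ c ∈ m₁, ∀ d ∈ m₂, IsCoprime (X - (c : R[X])) (X - (d : R[X])) := by
    intro c hc d hd
    obtain ⟨u, hu⟩ := (hR (d - c) (by
      rw [Int.cast_sub, h₁ c hc, h₂ d hd]; exact sub_ne_zero.2 hab.symm)).exists_left_inv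
    refine ⟨C u, -C u, ?_⟩
    have := congrArg (C : R →+* R[X]) hu
    simp only [map_mul, map_intCast, map_one] at this
    push_cast at this
    linear_combination this
  rw [ofIntRoots, ofIntRoots]
  refine Multiset.prod_induction (fun q ↦ IsCoprime q _) _ (fun _ _ ↦ IsCoprime.mul_left)
    isCoprime_one_left fun q hq ↦ ?_
  obtain ⟨c, hc, rfl⟩ := Multiset.mem_map.1 hq
  refine Multiset.prod_induction (fun q ↦ IsCoprime _ q) _ (fun _ _ ↦ IsCoprime.mul_right)
    isCoprime_one_right fun q hq ↦ ?_
  obtain ⟨d, hd, rfl⟩ := Multiset.mem_map.1 hq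
  exact key c hc d hd

section Shift

variable {R B : Type*} [CommRing R] [CommRing B] [Algebra R B]

theorem sub_sub_dvd_aeval_sub (m : Multiset ℤ) (x y : B) (t : ℤ) :
    x - y - t ∣ aeval x (ofIntRoots R (m.map (· + t))) - aeval y (ofIntRoots R m) := by
  have := ((ofIntRoots R m).map (algebraMap R B)).sub_dvd_eval_sub (x - t) y
  rw [eval_map_algebraMap, eval_map_algebraMap, aeval_ofIntRoots m (x - t)] at this
  rw [aeval_ofIntRoots (m.map _)]
  simp only [Multiset.map_map, Function.comp_def, Int.cast_add]
  convert this using 1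
  · ring
  · refine congrArg (fun M : Multiset B ↦ M.prod - _) (Multiset.map_congr rfl fun c _ ↦ ?_)
    ring

theorem AllResidue.add {p : ℕ} {m₁ m₂ : Multiset ℤ} {a : ZMod p} (h₁ : AllResidue p m₁ a)
    (h₂ : AllResidue p m₂ a) : AllResidue p (m₁ + m₂) a := fun c hc ↦
  (Multiset.mem_add.1 hc).elim (h₁ c) (h₂ c)

theorem AllResidue.map_add {p : ℕ} {m : Multiset ℤ} {a : ZMod p} (h : AllResidue p m a) (t : ℤ) :
    AllResidue p (m.map (· + t)) (a + t) := by
  intro c hc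
  obtain ⟨d, hd, rfl⟩ := Multiset.mem_map.1 hc
  rw [Int.cast_add, h d hd]

theorem aeval_ofIntRoots_shift {m : Multiset ℤ} {x y c : B} {t : ℤ}
    (hx : aeval x (ofIntRoots R m) * c = 0) (hy : (y - x - t) * c = 0) :
    aeval y (ofIntRoots R (m.map (· + t))) * c = 0 := by
  obtain ⟨D, hD⟩ := sub_sub_dvd_aeval_sub (R := R) m y x t
  linear_combination c * hD + hx + D * hy

end Shift

theorem exists_sub_mul_eq {p : ℕ} {R B : Type*} [CommRing R] [CommRing B] [Algebra R B]
    (hR : ∀ c : ℤ, (c : ZMod p) ≠ 0 → IsUnit (c : R)) {m₁ m₂ : Multiset ℤ} {a b : ZMod p}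
    (h₁ : AllResidue p m₁ a) (h₂ : AllResidue p m₂ b) {x y e : B}
    (hx : aeval x (ofIntRoots R m₁) * e = 0) (hy : aeval y (ofIntRoots R m₂) * e = 0) (t : ℤ)
    (hab : a ≠ b + t) : ∃ v, (x - y - t) * v * e = e := by
  obtain ⟨α, β, h⟩ := isCoprime_ofIntRoots hR h₁ (h₂.map_add t) hab
  have h' := congrArg (aeval x) h
  obtain ⟨D, hD⟩ := sub_sub_dvd_aeval_sub (R := R) m₂ x y t
  simp only [map_add, map_mul, map_one] at h'
  refine ⟨D * aeval x β, ?_⟩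
  linear_combination e * h' - aeval x α * hx - aeval x β * hy - aeval x β * e * hD

/-- Elements whose eigenvalues on each idempotent are integers of the prescribed residue modulo `p`
give rise to a residue system. -/
theorem exists_residueSystem {p n : ℕ} [Fact p.Prime] {R B : Type*} [CommRing R] [CommRing B]
    [Algebra R B] (hR : ∀ c : ℤ, (c : ZMod p) ≠ 0 → IsUnit (c : R))
    {e : (Fin n → ZMod p) → B} (he : CompleteOrthogonalIdempotents e) (x : Fin n → B)
    (hx : ∀ i k, ∃ m, AllResidue p m (i k) ∧ aeval (x k) (ofIntRoots R m) * e i = 0) :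
    ∃ W : ResidueSystem p n B, W.e = e ∧ W.x = x := by
  have inv (i : Fin n → ZMod p) (k l : Fin n) (t : ℤ) (h : i k ≠ i l + t) :
      ∃ v, (x k - x l - t) * v * e i = e i := by
    obtain ⟨m₁, h₁, hk⟩ := hx i k
    obtain ⟨m₂, h₂, hl⟩ := hx i l
    exact exists_sub_mul_eq hR h₁ h₂ hk hl t h
  have hβ : ∀ k l i, ∃ β : B, (i k = i l → β * e i = e i) ∧
      (i k ≠ i l → (x k - x l) * β * e i = e i) := by
    intro k l i
    by_cases h : i k = i l
    · exact ⟨1, by simp [h]⟩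
    · obtain ⟨v, hv⟩ := inv i k l 0 (by simpa using h)
      exact ⟨v, by simpa [h] using hv⟩
  choose β hβ₁ hβ₂ using hβ
  have hη : ∀ k l i, ∃ η : B, (i k = i l → (1 - x k + x l) * η * e i = e i) ∧
      (i k = i l + 1 → -β k l i * η * e i = e i) ∧
      (i k ≠ i l → i k ≠ i l + 1 → (1 - β k l i) * η * e i = e i) := by
    intro k l i
    by_cases h : i k = i l
    · obtain ⟨v, hv⟩ := inv i k l 1 (by simp [h])
      refine ⟨-v, fun _ ↦ ?_, by simp [h], by simp [h]⟩
      push_cast at hv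
      linear_combination hv
    · by_cases h' : i k = i l + 1
      · exact ⟨-(x k - x l), by simp [h], fun _ ↦ by linear_combination hβ₂ k l i h, by simp [h']⟩
      · obtain ⟨v, hv⟩ := inv i k l 1 (by simpa using h')
        refine ⟨(x k - x l) * v, by simp [h], by simp [h'], fun _ _ ↦ ?_⟩
        push_cast at hv
        linear_combination hv - v * hβ₂ k l i h
  choose η hη₁ hη₂ hη₃ using hη
  have key (c : (Fin n → ZMod p) → B) (i) : (∑ j, e j * c j) * e i = c i * e i := by
    rw [Finset.sum_mul, Finset.sum_eq_single i]
    · rw [mul_right_comm, he.idem i, mul_comm]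
    · intro j _ hj
      rw [mul_right_comm, he.ortho hj, zero_mul]
    · simp
  have key₂ (c d : (Fin n → ZMod p) → B) (i) :
      (∑ j, e j * c j) * (∑ j, e j * d j) * e i = c i * d i * e i := by
    rw [mul_assoc, key, mul_left_comm, key]
    ring
  refine ⟨{
    e := e
    x := x
    b := fun k l ↦ ∑ i, e i * β k l i
    h := fun k l ↦ ∑ i, e i * η k l i
    e_mul_self := he.idem
    e_mul_of_ne := fun i j h ↦ he.ortho h
    sum_e := he.complete
    b_of_eq := fun k l i h ↦ by rw [key, hβ₁ k l i h]
    b_of_ne := fun k l i h ↦ by rw [mul_assoc, key, ← mul_assoc, hβ₂ k l i h]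
    h_of_eq := fun k l i h ↦ by rw [mul_assoc, key, ← mul_assoc, hη₁ k l i h]
    h_of_down := fun k l i h ↦ by rw [neg_mul, neg_mul, key₂]; simpa using hη₂ k l i h
    h_of_ne := fun k l i h h' ↦ by
      rw [sub_mul, one_mul, sub_mul, key, key₂]
      linear_combination hη₃ k l i h h' }, rfl, rfl⟩

end Near

section Spectral

open Polynomial

theorem isUnit_intCast_Zp {p : ℕ} [Fact p.Prime] (c : ℤ) (hc : (c : ZMod p) ≠ 0) :
    IsUnit (c : Zp p) := by
  have := IsLocalization.map_units (Zp p) (M := (Ideal.span {(p : ℤ)}).primeCompl)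
    ⟨c, fun h ↦ hc ((ZMod.intCast_zmod_eq_zero_iff_dvd c p).2 (Ideal.mem_span_singleton.1 h))⟩
  simpa using this

theorem ofIntRoots_dvd_of_le (R : Type*) [CommRing R] {m₁ m₂ : Multiset ℤ} (h : m₁ ≤ m₂) :
    ofIntRoots R m₁ ∣ ofIntRoots R m₂ :=
  Multiset.prod_dvd_prod_of_le (Multiset.map_le_map h)

theorem prod_ofIntRoots_filter {p : ℕ} (R : Type*) [CommRing R] (M : Multiset ℤ)
    (S : Finset (ZMod p)) :
    ∏ b ∈ S, ofIntRoots R (M.filter fun c : ℤ ↦ (c : ZMod p) = b) =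
      ofIntRoots R (M.filter fun c : ℤ ↦ (c : ZMod p) ∈ S) := by
  induction S using Finset.induction_on with
  | empty => simp [ofIntRoots]
  | insert b S hb ih =>
    rw [Finset.prod_insert hb, ih, ← ofIntRoots_add, Multiset.filter_add_filter]
    have h : (M.filter fun c : ℤ ↦ (c : ZMod p) = b ∧ (c : ZMod p) ∈ S) = 0 :=
      Multiset.filter_eq_nil.2 fun c _ ⟨h₁, h₂⟩ ↦ hb (h₁ ▸ h₂)
    rw [h, add_zero]
    simp

/-- Polynomials which become the spectral projections, modulo `p`, of elements annihilated by
`ofIntRoots R M`. -/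
theorem exists_spectral_polynomials {p : ℕ} [NeZero p] {R : Type*} [CommRing R]
    (hR : ∀ c : ℤ, (c : ZMod p) ≠ 0 → IsUnit (c : R)) (M : Multiset ℤ) :
    ∃ ε : ZMod p → R[X], ∑ a, ε a = 1 ∧
      ∀ a, ofIntRoots R (M.filter fun c : ℤ ↦ (c : ZMod p) ≠ a) ∣ ε a := by
  have hcop : Pairwise (Function.onFun IsCoprime fun b : ZMod p ↦
      ofIntRoots R (M.filter fun c : ℤ ↦ (c : ZMod p) = b)) := fun a b hab ↦
    isCoprime_ofIntRoots hR (fun c hc ↦ (Multiset.mem_filter.1 hc).2)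
      (fun c hc ↦ (Multiset.mem_filter.1 hc).2) hab
  obtain ⟨μ, hμ⟩ := (exists_sum_eq_one_iff_pairwise_coprime' (R := R[X])).2 hcop
  refine ⟨_, hμ, fun a ↦ ?_⟩
  rw [prod_ofIntRoots_filter]
  refine dvd_mul_of_dvd_right (dvd_of_eq ?_) _
  simp

variable {p : ℕ} {R : Type*} [CommRing R] {M : Multiset ℤ} {ε : ZMod p → R[X]}

theorem ofIntRoots_filter_dvd
    (hε : ∀ a, ofIntRoots R (M.filter fun c : ℤ ↦ (c : ZMod p) ≠ a) ∣ ε a) {a b : ZMod p}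
    (h : a ≠ b) : ofIntRoots R (M.filter fun c : ℤ ↦ (c : ZMod p) = b) ∣ ε a :=
  (ofIntRoots_dvd_of_le R (Multiset.monotone_filter_right M fun _ h' ↦ h' ▸ h.symm)).trans (hε a)

theorem ofIntRoots_dvd_filter_mul
    (hε : ∀ a, ofIntRoots R (M.filter fun c : ℤ ↦ (c : ZMod p) ≠ a) ∣ ε a) (a : ZMod p) :
    ofIntRoots R M ∣ ofIntRoots R (M.filter fun c : ℤ ↦ (c : ZMod p) = a) * ε a := by
  refine dvd_trans (dvd_of_eq ?_) (mul_dvd_mul_left _ (hε a))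
  rw [← ofIntRoots_add, Multiset.filter_add_not]

theorem ofIntRoots_dvd_mul
    (hε : ∀ a, ofIntRoots R (M.filter fun c : ℤ ↦ (c : ZMod p) ≠ a) ∣ ε a) {a b : ZMod p}
    (h : a ≠ b) : ofIntRoots R M ∣ ε a * ε b :=
  (ofIntRoots_dvd_filter_mul hε a).trans (mul_comm (ε a) (ε b) ▸
    mul_dvd_mul_right (ofIntRoots_filter_dvd hε h.symm) _)

end Spectral

section DividedDifference

open Polynomial

open scoped IsMulCommutative in
/-- A subalgebra generated by commuting elements, as a commutative ring. -/
theorem exists_commRing_range_eq_adjoin.{u, v} (R : Type u) {A : Type v} [CommRing R] [Ring A]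
    [Algebra R A] (S : Set A) (hS : ∀ a ∈ S, ∀ b ∈ S, a * b = b * a) :
    ∃ (C : Type v) (_ : CommRing C) (_ : Algebra R C) (_ : Module C A) (_ : IsScalarTower C A A)
      (φ : C →ₐ[R] A), Function.Injective φ ∧ φ.range = Algebra.adjoin R S ∧
        ∀ (c : C) (a : A), c • a = φ c * a := by
  have := Algebra.isMulCommutative_adjoin R hS
  exact ⟨Algebra.adjoin R S, inferInstance, inferInstance, inferInstance, inferInstance,
    (Algebra.adjoin R S).val, Subtype.val_injective, Subalgebra.range_val _, fun _ _ ↦ rfl⟩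

variable {R A : Type*} [CommRing R] [Ring A] [Algebra R A]

/-- Moving a polynomial through an operator acting like a divided difference. -/
theorem exists_divided_difference {v e x x' : A} (hxx : Commute x x') (hex : Commute e x)
    (hex' : Commute e x') (hr : v * x' = x * v + e) (hl : v * x = x' * v - e) (q : R[X]) :
    ∃ D : A, (∀ z, Commute z x → Commute z x' → Commute z D) ∧
      (x' - x) * D = aeval x' q - aeval x q ∧
      v * aeval x' q = aeval x q * v + D * e ∧ v * aeval x q = aeval x' q * v - D * e := by
  induction q using Polynomial.induction_on' with
  | add q r hq hr =>
    obtain ⟨D₁, c₁, d₁, r₁, l₁⟩ := hq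
    obtain ⟨D₂, c₂, d₂, r₂, l₂⟩ := hr
    refine ⟨D₁ + D₂, fun z h h' ↦ (c₁ z h h').add_right (c₂ z h h'), ?_, ?_, ?_⟩
    · rw [mul_add, d₁, d₂, map_add, map_add]; abel
    · rw [map_add, mul_add, r₁, r₂, map_add, add_mul, add_mul]; abel
    · rw [map_add, mul_add, l₁, l₂, map_add, add_mul, add_mul]; abel
  | monomial k c =>
    induction k with
    | zero =>
      refine ⟨0, fun z _ _ ↦ Commute.zero_right z, by simp, ?_, ?_⟩ <;>
        simp [Algebra.commutes c v]
    | succ k ih =>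
      obtain ⟨D, cD, dD, rD, lD⟩ := ih
      have hX : ∀ z : A, aeval z (monomial (k + 1) c) = aeval z (monomial k c) * z := fun z ↦ by
        simp [pow_succ, mul_assoc]
      have hcomm : ∀ z z' : A, Commute z z' → Commute z (aeval z' (monomial k c)) := fun z z' h ↦ by
        rw [aeval_monomial]
        exact (Algebra.commute_algebraMap_right c z).mul_right (h.pow_right k)
      have hDx := cD x (Commute.refl x) hxx
      have hDx' := cD x' hxx.symm (Commute.refl x')
      simp only [hX]
      have hD : aeval x (monomial k c) + x' * D = aeval x' (monomial k c) + x * D := by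
        rw [← sub_eq_zero, ← sub_eq_zero.2 dD]; noncomm_ring
      refine ⟨aeval x (monomial k c) + x' * D, fun z h h' ↦ ?_, ?_, ?_, ?_⟩
      · rw [aeval_monomial]
        exact ((Algebra.commute_algebraMap_right c z).mul_right (h.pow_right k)).add_right
          (h'.mul_right (cD z h h'))
      · rw [mul_add, ← mul_assoc (x' - x), ((Commute.refl x').sub_left hxx).eq, mul_assoc x', dD,
          sub_mul, (hcomm x' x hxx.symm).eq, (hcomm x x (Commute.refl x)).eq,
          mul_sub, (hcomm x' x' (Commute.refl x')).eq, (hcomm x' x hxx.symm).eq]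
        abel
      · rw [← mul_assoc, rD, add_mul, mul_assoc, hr, mul_assoc D, hex'.eq, add_mul,
          ← mul_assoc D, hDx'.eq]
        noncomm_ring
      · rw [hD, ← mul_assoc, lD, sub_mul, mul_assoc, hl, mul_assoc D, hex.eq, add_mul,
          ← mul_assoc D, hDx.eq]
        noncomm_ring

end DividedDifference

section JucysMurphy

/-- Elements satisfying the Coxeter relations of type `A_N`. -/
structure IsCoxeterFamily {A : Type*} [Monoid A] (N : ℕ) (s : ℕ → A) : Prop where
  mul_self : ∀ k < N, s k * s k = 1
  braid : ∀ k, k + 1 < N → s k * s (k + 1) * s k = s (k + 1) * s k * s (k + 1)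
  comm : ∀ k l, k + 1 < l → l < N → s k * s l = s l * s k

/-- The Jucys–Murphy elements attached to a sequence of reflections. -/
def jucysMurphy {A : Type*} [Ring A] (s : ℕ → A) : ℕ → A
  | 0 => 0
  | k + 1 => s k * jucysMurphy s k * s k + s k

namespace IsCoxeterFamily

variable {A : Type*} [Ring A] {N : ℕ} {s : ℕ → A} (hs : IsCoxeterFamily N s)

include hs

theorem mul_jucysMurphy_succ {k : ℕ} (hk : k < N) :
    s k * jucysMurphy s (k + 1) = jucysMurphy s k * s k + 1 := by
  rw [jucysMurphy, mul_add, ← mul_assoc, ← mul_assoc, hs.mul_self k hk, one_mul]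

theorem jucysMurphy_succ_mul {k : ℕ} (hk : k < N) :
    jucysMurphy s (k + 1) * s k = s k * jucysMurphy s k + 1 := by
  rw [jucysMurphy, add_mul, mul_assoc, hs.mul_self k hk, mul_one]

theorem commute_jucysMurphy_of_lt {j k : ℕ} (hj : j < N) (hk : k < j) :
    Commute (s j) (jucysMurphy s k) := by
  induction k with
  | zero => exact Commute.zero_right _
  | succ k ih =>
    have h : Commute (s j) (s k) := (hs.comm k j hk hj).symm
    exact ((h.mul_right (ih (by omega))).mul_right h).add_right h

theorem commute_jucysMurphy_of_gt {j k : ℕ} (hk : k ≤ N) (hj : j + 1 < k) :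
    Commute (s j) (jucysMurphy s k) := by
  induction k, hj using Nat.le_induction with
  | base =>
    have hb := hs.braid j (by omega)
    have hjj := hs.mul_self j (by omega)
    have hc := (hs.commute_jucysMurphy_of_lt (j := j + 1) (k := j) (by omega) (by omega)).eq
    have h₁ : s j * (s (j + 1) * s j * s (j + 1)) = s (j + 1) * s j := by
      rw [← hb, ← mul_assoc, ← mul_assoc, hjj, one_mul]
    have h₂ : s (j + 1) * s j * s (j + 1) * s j = s j * s (j + 1) := by
      rw [← hb, mul_assoc, hjj, mul_one]
    have h₃ : s j * (s (j + 1) * s j * jucysMurphy s j * s j * s (j + 1)) =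
        s (j + 1) * s j * jucysMurphy s j * s j * s (j + 1) * s j := by
      calc _ = s j * s (j + 1) * s j * jucysMurphy s j * s j * s (j + 1) := by noncomm_ring
        _ = s (j + 1) * s j * (s (j + 1) * jucysMurphy s j) * s j * s (j + 1) := by
          rw [hb]; noncomm_ring
        _ = s (j + 1) * s j * jucysMurphy s j * (s (j + 1) * s j * s (j + 1)) := by
          rw [hc]; noncomm_ring
        _ = _ := by rw [← hb]; noncomm_ring
    rw [Commute, SemiconjBy, jucysMurphy, jucysMurphy]
    simp only [mul_add, add_mul, ← mul_assoc] at h₁ h₂ h₃ ⊢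
    rw [h₁, h₂, h₃]
    abel
  | succ k hj' ih =>
    have h : Commute (s j) (s k) := hs.comm j k (by omega) (by omega)
    exact ((h.mul_right (ih (by omega))).mul_right h).add_right h

theorem commute_jucysMurphy {k l : ℕ} (hk : k ≤ N) (hl : l ≤ N) :
    Commute (jucysMurphy s k) (jucysMurphy s l) := by
  have key : ∀ k l, k < l → l ≤ N → Commute (jucysMurphy s k) (jucysMurphy s l) := by
    intro k
    induction k with
    | zero => exact fun l _ _ ↦ Commute.zero_left _
    | succ k ih =>
      intro l hkl hl
      have h := hs.commute_jucysMurphy_of_gt (j := k) hl hkl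
      exact ((h.mul_left (ih l (by omega) hl)).mul_left h).add_left h
  rcases lt_trichotomy k l with h | rfl | h
  · exact key k l h hl
  · exact Commute.refl _
  · exact (key l k h hk).symm

open Polynomial in
/-- The eigenvalues of the Jucys–Murphy elements are integers. -/
theorem exists_aeval_jucysMurphy_eq_zero (R : Type*) [CommRing R] [Algebra R A] {k : ℕ}
    (hk : k ≤ N) : ∃ m : Multiset ℤ, aeval (jucysMurphy s k) (ofIntRoots R m) = 0 := by
  induction k with
  | zero => exact ⟨{0}, by simp [ofIntRoots, jucysMurphy]⟩
  | succ k ih =>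
    obtain ⟨m, hm⟩ := ih (by omega)
    have hxx := hs.commute_jucysMurphy (k := k) (l := k + 1) (by omega) hk
    obtain ⟨D, -, hD, hr, hl⟩ := exists_divided_difference (v := s k) (e := 1) hxx
      (Commute.one_left _) (Commute.one_left _) (hs.mul_jucysMurphy_succ hk)
      (by rw [hs.jucysMurphy_succ_mul hk, add_sub_cancel_right]) (ofIntRoots R m)
    obtain ⟨C, _, _, _, _, φ, hφ, hφr, -⟩ := exists_commRing_range_eq_adjoin R
      {jucysMurphy s k, jucysMurphy s (k + 1)} (by
        rintro _ (rfl | rfl) _ (rfl | rfl)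
        exacts [rfl, hxx, hxx.symm, rfl])
    have hmem : ∀ z ∈ ({jucysMurphy s k, jucysMurphy s (k + 1)} : Set A), ∃ c, φ c = z :=
      fun z hz ↦ AlgHom.mem_range _ |>.1 (hφr ▸ Algebra.subset_adjoin hz)
    obtain ⟨x, hx⟩ := hmem _ (Or.inl rfl)
    obtain ⟨y, hy⟩ := hmem _ (Or.inr rfl)
    rw [← hx] at hm hr hl hD
    rw [← hy] at hr hl hD ⊢
    simp only [aeval_algHom_apply, mul_one] at hm hr hl hD ⊢
    have hm' := hφ (hm.trans (map_zero φ).symm)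
    rw [hm', map_zero] at hr hl hD
    rw [zero_mul, zero_add] at hr
    rw [mul_zero, eq_comm, sub_eq_zero] at hl
    rw [sub_zero] at hD
    have hu : (y - x) * (y - x) * aeval y (ofIntRoots R m) = aeval y (ofIntRoots R m) := by
      have hD' : D = (φ y - φ x) * φ (aeval y (ofIntRoots R m)) := by
        calc D = (φ y - φ x) * D * s k := by rw [hD, hl]
          _ = (φ y - φ x) * (φ (aeval y (ofIntRoots R m)) * s k * s k) := by rw [hl, mul_assoc]
          _ = _ := by rw [mul_assoc (φ _), hs.mul_self k hk, mul_one]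
      apply hφ
      rw [map_mul, map_mul, map_sub, mul_assoc, ← hD', hD]
    have h₁ : aeval y (ofIntRoots R (m.map (· + 1))) *
        ((y - x + 1) * aeval y (ofIntRoots R m)) = 0 :=
      aeval_ofIntRoots_shift (x := x) (by rw [hm', zero_mul]) (by
        push_cast
        linear_combination hu)
    have h₂ : aeval y (ofIntRoots R (m.map (· + -1))) *
        (aeval y (ofIntRoots R (m.map (· + 1))) * aeval y (ofIntRoots R m)) = 0 :=
      aeval_ofIntRoots_shift (x := x) (by rw [hm', zero_mul]) (by
        push_cast
        linear_combination h₁)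
    refine ⟨m.map (· + -1) + (m.map (· + 1) + m), ?_⟩
    rw [ofIntRoots_add, ofIntRoots_add, map_mul (aeval y), map_mul (aeval y), h₂, map_zero]

end IsCoxeterFamily

end JucysMurphy

section SpectralIdempotents

open Polynomial

theorem completeOrthogonalIdempotents_prod_aeval {p n : ℕ} [NeZero p] {R B : Type*} [CommRing R]
    [CommRing B] [Algebra R B] {M : Multiset ℤ} {ε : ZMod p → R[X]} (hsum : ∑ a, ε a = 1)
    (hε : ∀ a, ofIntRoots R (M.filter fun c : ℤ ↦ (c : ZMod p) ≠ a) ∣ ε a) {x : Fin n → B}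
    (hx : ∀ k, aeval (x k) (ofIntRoots R M) = 0) :
    CompleteOrthogonalIdempotents fun i : Fin n → ZMod p ↦ ∏ k, aeval (x k) (ε (i k)) := by
  refine CompleteOrthogonalIdempotents.iff_ortho_complete.2 ⟨fun i j hij ↦ ?_, ?_⟩
  · obtain ⟨k, hk⟩ := Function.ne_iff.1 hij
    rw [← Finset.prod_mul_distrib]
    refine Finset.prod_eq_zero (Finset.mem_univ k) ?_
    rw [← map_mul]
    exact aeval_eq_zero_of_dvd_aeval_eq_zero (ofIntRoots_dvd_mul hε hk) (hx k)
  · have := Finset.prod_univ_sum (fun _ : Fin n ↦ (Finset.univ : Finset (ZMod p)))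
      (fun k a ↦ aeval (x k) (ε a))
    simp only [← map_sum, hsum, map_one, Finset.prod_const_one, Fintype.piFinset_univ] at this
    exact this.symm

theorem aeval_filter_mul_prod_aeval {p n : ℕ} {R B : Type*} [CommRing R]
    [CommRing B] [Algebra R B] {M : Multiset ℤ} {ε : ZMod p → R[X]}
    (hε : ∀ a, ofIntRoots R (M.filter fun c : ℤ ↦ (c : ZMod p) ≠ a) ∣ ε a) {x : Fin n → B}
    (hx : ∀ k, aeval (x k) (ofIntRoots R M) = 0) (i : Fin n → ZMod p) (k : Fin n) :
    aeval (x k) (ofIntRoots R (M.filter fun c : ℤ ↦ (c : ZMod p) = i k)) *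
      ∏ k, aeval (x k) (ε (i k)) = 0 := by
  rw [← Finset.mul_prod_erase _ _ (Finset.mem_univ k), ← mul_assoc, ← map_mul,
    aeval_eq_zero_of_dvd_aeval_eq_zero (ofIntRoots_dvd_filter_mul hε (i k)) (hx k), zero_mul]

theorem SemiconjBy.aeval {R A : Type*} [CommRing R] [Ring A] [Algebra R A] {a x y : A}
    (h : SemiconjBy a x y) (q : R[X]) : SemiconjBy a (aeval x q) (aeval y q) := by
  induction q using Polynomial.induction_on' with
  | add q r hq hr => simpa only [map_add] using hq.add_right hr
  | monomial k c =>
    rw [aeval_monomial, aeval_monomial]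
    exact SemiconjBy.mul_right (Algebra.commute_algebraMap_right c a) (h.pow_right k)

theorem SemiconjBy.map_finsetProd {ι B A F : Type*} [CommMonoid B] [Monoid A] [FunLike F B A]
    [MonoidHomClass F B A] (φ : F) {a : A} {c d : ι → B} (S : Finset ι)
    (h : ∀ m ∈ S, SemiconjBy a (φ (c m)) (φ (d m))) :
    SemiconjBy a (φ (∏ m ∈ S, c m)) (φ (∏ m ∈ S, d m)) := by
  classical
  induction S using Finset.induction_on with
  | empty => simp
  | insert m S hm ih =>
    rw [Finset.prod_insert hm, Finset.prod_insert hm, map_mul, map_mul]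
    exact (h m (Finset.mem_insert_self m S)).mul_right
      (ih fun m' hm' ↦ h m' (Finset.mem_insert_of_mem hm'))

end SpectralIdempotents

section ReflectionOfPolynomials

open Polynomial

variable {p n : ℕ} [NeZero p] {R C A : Type*} [CommRing R] [CommRing C] [Ring A] [Algebra R C]
  [Algebra R A] [Module C A] [IsScalarTower C A A] {W : ResidueSystem p n C}

omit [IsScalarTower C A A] in
/-- When the idempotents are given by polynomials, a reflection is determined by its relations
with the elements `x`. -/
theorem IsReflection.of_prod_aeval {φ : C →ₐ[R] A} (hφ : ∀ (c : C) (a : A), c • a = φ c * a)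
    {ε : ZMod p → R[X]} (he : ∀ i, W.e i = ∏ k, aeval (W.x k) (ε (i k))) {k l : Fin n} {s : A}
    (hkl : k ≠ l) (hm : ∀ m, m ≠ k → m ≠ l → Commute s (φ (W.x m)))
    (hr : s * φ (W.x l) = φ (W.x k) * s + 1) (hl : s * φ (W.x k) = φ (W.x l) * s - 1) :
    IsReflection W k l s := by
  have hc : ∀ c d, Commute (φ c) (φ d) := fun c d ↦ by
    rw [Commute, SemiconjBy, ← map_mul, mul_comm, map_mul]
  have hφ1 : ∀ c : C, c • (1 : A) = φ c := fun c ↦ by rw [hφ, mul_one]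
  have h_eq : ∀ i, i k = i l → Commute s (φ (W.e i)) := by
    intro i hi
    rw [he, ← Finset.prod_mul_prod_compl {k, l}, Finset.prod_pair hkl, map_mul, hi]
    refine Commute.mul_right ?_ (SemiconjBy.map_finsetProd φ _ fun m hm' ↦ ?_)
    · obtain ⟨D, cD, -, rD, lD⟩ := exists_divided_difference (v := s) (e := 1) (hc (W.x k) (W.x l))
        (Commute.one_left _) (Commute.one_left _) hr hl (ε (i l))
      have hD := (cD _ (hc _ _) (hc _ _) : Commute (φ (aeval (W.x l) (ε (i l)))) D).eq
      rw [aeval_algHom_apply, aeval_algHom_apply, mul_one] at rD lD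
      rw [Commute, SemiconjBy, map_mul, ← mul_assoc, lD, sub_mul, mul_assoc, rD, ← hD,
        (hc (aeval (W.x k) (ε (i l))) _).eq]
      noncomm_ring
    · simp only [Finset.mem_compl, Finset.mem_insert, Finset.mem_singleton, not_or] at hm'
      rw [← aeval_algHom_apply]
      exact SemiconjBy.aeval (hm m hm'.1 hm'.2) _
  set τ : A := φ (W.x k - W.x l) * s + 1 with hτ
  have hτe : ∀ i, SemiconjBy τ (φ (W.e (i ∘ Equiv.swap k l))) (φ (W.e i)) := by
    intro i
    rw [he, he, ← Equiv.prod_comp (Equiv.swap k l)]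
    refine SemiconjBy.map_finsetProd φ _ fun m _ ↦ ?_
    simp only [Function.comp_apply, Equiv.swap_apply_self]
    rw [← aeval_algHom_apply, ← aeval_algHom_apply]
    refine SemiconjBy.aeval ?_ _
    have hcc := fun c ↦ (hc (W.x k - W.x l) c).eq
    rw [SemiconjBy, hτ, add_mul, mul_assoc]
    by_cases hmk : m = k
    · rw [hmk, Equiv.swap_apply_left, hr, mul_add, ← mul_assoc, hcc, map_sub]
      noncomm_ring
    · by_cases hml : m = l
      · rw [hml, Equiv.swap_apply_right, hl, mul_sub, ← mul_assoc, hcc, map_sub]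
        noncomm_ring
      · rw [Equiv.swap_apply_of_ne_of_ne hmk hml, (hm m hmk hml).eq, ← mul_assoc, hcc]
        noncomm_ring
  have h_ne : ∀ i, i k ≠ i l → φ (W.e i) * (s + φ (W.b k l)) = φ (W.b k l) * φ (W.e i) * τ := by
    intro i hi
    have h := congrArg φ (W.b_of_ne k l i hi)
    rw [mul_comm _ (W.b k l), mul_assoc, mul_comm _ (W.e i), ← mul_assoc, map_mul, map_mul] at h
    rw [hτ, mul_add (φ _ * φ _), ← mul_assoc, h, mul_one, mul_add, (hc (W.e i) (W.b k l)).eq]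
  have h_ne' : ∀ i, i k ≠ i l → φ (W.e i) * (s + φ (W.b k l)) =
      φ (W.e i) * (s + φ (W.b k l)) * φ (W.e (i ∘ Equiv.swap k l)) := by
    intro i hi
    rw [h_ne i hi, mul_assoc _ τ, (hτe i).eq, ← mul_assoc, mul_assoc _ (φ (W.e i)) (φ (W.e i)),
      ← map_mul φ (W.e i), W.e_mul_self]
  refine ⟨hkl, fun m h₁ h₂ ↦ ?_, ?_, ?_, fun i hi ↦ ?_, fun i hi ↦ ?_⟩
  · rw [hφ1, hφ, (hm m h₁ h₂).eq]
  · rw [hφ1, hφ, hr]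
  · rw [hφ1, hφ, hl]
  · rw [hφ1, hφ, (h_eq i hi).eq]
  · refine W.ext_e fun j ↦ ?_
    simp only [hφ1, hφ]
    by_cases hij : j = i
    · rw [hij, ← mul_assoc, ← map_mul, W.e_mul_self, h_ne' i hi, mul_assoc]
    · rw [← mul_assoc, ← map_mul, W.e_mul_of_ne _ _ hij, map_zero, zero_mul, ← mul_assoc]
      by_cases hj : j k = j l
      · have hne : j ≠ i ∘ Equiv.swap k l := by
          rintro rfl
          simp only [Function.comp_apply, Equiv.swap_apply_left, Equiv.swap_apply_right] at hj
          exact hi hj.symm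
        rw [mul_add, ← (h_eq j hj).eq, (hc _ _).eq, ← add_mul, mul_assoc, ← map_mul,
          W.e_mul_of_ne _ _ hne, map_zero, mul_zero]
      · have hne : j ∘ Equiv.swap k l ≠ i ∘ Equiv.swap k l := fun h ↦
          hij (by simpa using (Equiv.swap k l).surjective.injective_comp_right h)
        rw [h_ne' j hj, mul_assoc, ← map_mul, W.e_mul_of_ne _ _ hne, map_zero, mul_zero]

end ReflectionOfPolynomials

section Residues

theorem ZMod.val_add_one_of_add_one_ne_zero {p : ℕ} [NeZero p] {a : ZMod p} (h : a + 1 ≠ 0) :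
    (a + 1).val = a.val + 1 := by
  have h' : a.val + 1 ≠ p := fun h' ↦ h (by
    have := congrArg (Nat.cast : ℕ → ZMod p) h'
    simpa using this)
  have := a.val_lt
  rw [← ZMod.val_natCast_of_lt (show a.val + 1 < p by omega)]
  simp

theorem ZMod.val_add_one_eq_of_add_one_eq_zero {p : ℕ} [NeZero p] {a : ZMod p} (h : a + 1 = 0) :
    a.val + 1 = p := by
  have h' : p ∣ a.val + 1 := by
    rw [← ZMod.natCast_eq_zero_iff]
    simpa using h
  have := a.val_lt
  exact le_antisymm (by omega) (Nat.le_of_dvd (by omega) h')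

end Residues

section RightHanded

variable {p n : ℕ} [NeZero p] {C : Type*} [CommRing C] (W : ResidueSystem p n C)
  {A : Type*} [Ring A] [Module C A] [IsScalarTower C A A]

/-- The dots, obtained from the elements `x` by subtracting the canonical lift of the residue. -/
def ResidueSystem.y (k : Fin n) : C := ∑ i, W.e i * (W.x k - ((i k).val : C))

theorem ResidueSystem.y_mul_e (k : Fin n) (i : Fin n → ZMod p) :
    W.y k * W.e i = (W.x k - ((i k).val : C)) * W.e i := by
  rw [ResidueSystem.y, W.sum_e_mul fun i ↦ W.x k - ((i k).val : C)]

variable {W} {k l m : Fin n} {ψ ψ₁ ψ₂ : A}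

omit [IsScalarTower C A A] in
theorem IsCrossing.mul_e (hψ : IsCrossing W k l ψ) (i : Fin n → ZMod p) :
    ψ * W.e i • (1 : A) = W.e (i ∘ Equiv.swap k l) • ψ := by
  rw [hψ.e_smul]
  congr 3
  ext
  simp

omit [IsScalarTower C A A] in
theorem natCast_smul_mul (c : ℕ) (v : A) : (c : C) • v = v * (c : C) • (1 : A) := by
  rw [Nat.cast_smul_eq_nsmul, Nat.cast_smul_eq_nsmul, mul_smul_comm, mul_one]

theorem IsCrossing.y_smul (hψ : IsCrossing W k l ψ) (hk : m ≠ k) (hl : m ≠ l) :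
    W.y m • ψ = ψ * W.y m • (1 : A) := by
  refine W.ext_e fun i ↦ ?_
  have hi : (i ∘ Equiv.swap k l) m = i m := by simp [Equiv.swap_apply_of_ne_of_ne hk hl]
  rw [← smul_mul_assoc, hψ.e_smul, mul_assoc, smul_one_mul_smul_one, smul_smul, mul_comm,
    y_mul_e, mul_comm (W.e _), y_mul_e, hi, mul_smul, hψ.e_smul, sub_smul, ← smul_mul_assoc,
    hψ.x_smul m hk hl, natCast_smul_mul, mul_assoc, mul_assoc, smul_one_mul_smul_one,
    smul_one_mul_smul_one, sub_mul, sub_smul, mul_sub, mul_comm (W.e _)]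

theorem IsCrossing.mul_y_right (hψ : IsCrossing W k l ψ) (i : Fin n → ZMod p) :
    ψ * W.y l • (1 : A) * W.e i • (1 : A) =
      W.y k • ψ * W.e i • (1 : A) + if i k = i l then W.e i • 1 else 0 := by
  have h := hψ.mul_x_right (i ∘ Equiv.swap k l)
  simp only [Function.comp_apply, Equiv.swap_apply_left, Equiv.swap_apply_right] at h
  have hk := W.y_mul_e k (i ∘ Equiv.swap k l)
  simp only [Function.comp_apply, Equiv.swap_apply_left] at hk
  have hd : (if i l = i k then W.e (i ∘ Equiv.swap k l) • (1 : A) else 0) =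
      if i k = i l then W.e i • 1 else 0 := by
    split_ifs with h1 h2 h2
    · rw [comp_swap_of_eq h2]
    · exact absurd h1.symm h2
    · exact absurd h2.symm h1
    · rfl
  rw [hd] at h
  rw [mul_assoc, smul_one_mul_smul_one, y_mul_e, sub_mul, sub_smul, mul_sub, smul_mul_assoc,
    hψ.mul_e, smul_smul, hk, mul_comm (W.x l), ← smul_one_mul_smul_one, ← mul_assoc, hψ.mul_e,
    smul_mul_assoc, h, ← smul_one_mul_smul_one, ← mul_assoc, ← natCast_smul_mul,
    smul_mul_assoc, hψ.mul_e]
  module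

theorem IsCrossing.mul_y_left (hψ : IsCrossing W k l ψ) (i : Fin n → ZMod p) :
    W.y l • ψ * W.e i • (1 : A) =
      ψ * W.y k • (1 : A) * W.e i • (1 : A) + if i k = i l then W.e i • 1 else 0 := by
  have h := hψ.mul_x_left (i ∘ Equiv.swap k l)
  simp only [Function.comp_apply, Equiv.swap_apply_left, Equiv.swap_apply_right] at h
  have hk := W.y_mul_e l (i ∘ Equiv.swap k l)
  simp only [Function.comp_apply, Equiv.swap_apply_right] at hk
  have hd : (if i l = i k then W.e (i ∘ Equiv.swap k l) • (1 : A) else 0) =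
      if i k = i l then W.e i • 1 else 0 := by
    split_ifs with h1 h2 h2
    · rw [comp_swap_of_eq h2]
    · exact absurd h1.symm h2
    · exact absurd h2.symm h1
    · rfl
  rw [hd] at h
  rw [mul_assoc, smul_one_mul_smul_one, y_mul_e, sub_mul, sub_smul, mul_sub, smul_mul_assoc,
    hψ.mul_e, smul_smul, hk, mul_comm (W.x k), ← smul_one_mul_smul_one, ← mul_assoc, hψ.mul_e,
    smul_mul_assoc, h, ← smul_one_mul_smul_one, ← mul_assoc, ← natCast_smul_mul,
    smul_mul_assoc, hψ.mul_e]
  module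

/-- The value of the square of a crossing in terms of the dots. -/
theorem ResidueSystem.Q_mul_e_of_up {i : Fin n → ZMod p} (hp : 2 < p) (h : i l = i k + 1) :
    W.Q k l i * W.e i =
      (W.y k + (if i l = 0 then (p : C) else 0) - W.y l) * W.e i := by
  have : Fact (1 < p) := ⟨by omega⟩
  have hv : ((i k).val : C) + 1 = (i l).val + if i l = 0 then (p : C) else 0 := by
    split_ifs with h0
    · have := congrArg (Nat.cast : ℕ → C) (ZMod.val_add_one_eq_of_add_one_eq_zero (h ▸ h0))
      rw [h0, ZMod.val_zero, ← this]
      push_cast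
      ring
    · rw [h, ZMod.val_add_one_of_add_one_ne_zero (h ▸ h0)]
      push_cast
      ring
  have hne : i k ≠ i l := by rw [h]; simp
  rw [Q, if_neg hne, if_pos h]
  linear_combination (W.y_mul_e l i) - (W.y_mul_e k i) + W.e i * hv

theorem ResidueSystem.Q_mul_e_of_down {i : Fin n → ZMod p} (hp : 2 < p) (h : i k = i l + 1) :
    W.Q k l i * W.e i =
      (W.y l + (if i k = 0 then (p : C) else 0) - W.y k) * W.e i := by
  rw [← W.Q_mul_e_of_up hp h]
  have : Fact (1 < p) := ⟨by omega⟩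
  have hne : i k ≠ i l := by rw [h]; simp
  have h2 : i l ≠ i k + 1 := fun h' ↦ two_ne_zero_of_two_lt hp
    (by linear_combination -h - h')
  rw [Q, Q, if_neg hne, if_neg hne.symm, if_neg h2, if_pos h, if_pos h]
  ring

end RightHanded

section Family

variable {p n : ℕ} [NeZero p] {C : Type*} [CommRing C]
  {A : Type*} [Ring A] [Module C A] [IsScalarTower C A A]

/-- Crossings satisfying all the KLR relations, with idempotents on the left. -/
structure IsKLRFamily (W : ResidueSystem p n C) (ψ : Fin (n - 1) → A) : Prop where
  isCrossing : ∀ k, IsCrossing W (ka n k) (kb n k) (ψ k)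
  mul_self : ∀ k i, W.e i • (1 : A) * ψ k * ψ k = W.Q (ka n k) (kb n k) i • W.e i • (1 : A)
  comm : ∀ k m : Fin (n - 1), 1 < Nat.dist k m → ψ k * ψ m = ψ m * ψ k
  braid : ∀ (k : ℕ) (hk : k + 1 < n - 1) (i : Fin n → ZMod p),
    W.e i • (1 : A) * ψ ⟨k, by omega⟩ * ψ ⟨k + 1, hk⟩ * ψ ⟨k, by omega⟩ -
      W.e i • (1 : A) * ψ ⟨k + 1, hk⟩ * ψ ⟨k, by omega⟩ * ψ ⟨k + 1, hk⟩ =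
    braidConst C ⟨k, by omega⟩ ⟨k + 1, by omega⟩ ⟨k + 2, by omega⟩ i • W.e i • (1 : A)

/-- Crossings satisfy the KLR relations if and only if the corresponding reflections satisfy the
Coxeter relations. -/
theorem isKLRFamily_iff_isCoxeterFamily (hp : 2 < p) {W : ResidueSystem p n C}
    {ψ : Fin (n - 1) → A} (hψ : ∀ k, IsCrossing W (ka n k) (kb n k) (ψ k)) {s : ℕ → A}
    (hs : ∀ k : Fin (n - 1), s k = reflectionOf W (ka n k) (kb n k) (ψ k)) :
    IsKLRFamily W ψ ↔ IsCoxeterFamily (n - 1) s := by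
  have hcomm (k m : Fin (n - 1)) (h : k.val + 1 < m.val) :
      s k * s m = s m * s k ↔ ψ k * ψ m = ψ m * ψ k := by
    rw [hs, hs]
    refine (hψ k).commute_reflectionOf_iff (hψ m) ?_ ?_ ?_ ?_ <;>
      simp only [ka, kb, ne_eq, Fin.mk.injEq] <;> omega
  have hsq (k : Fin (n - 1)) : s k * s k = 1 ↔ ∀ i, W.e i • (1 : A) * ψ k * ψ k =
      W.Q (ka n k) (kb n k) i • W.e i • (1 : A) := by
    rw [hs]
    exact (hψ k).reflectionOf_mul_self_iff hp
  have hbraid (k : ℕ) (hk : k + 1 < n - 1) (q : ∀ k, ∀ i, W.e i • (1 : A) * ψ k * ψ k =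
      W.Q (ka n k) (kb n k) i • W.e i • (1 : A)) :=
    (hψ ⟨k, by omega⟩).braid_iff hp (hψ ⟨k + 1, hk⟩)
      (by simp only [ka, kb, ne_eq, Fin.mk.injEq]; omega) (q _) (q _)
  constructor
  · intro h
    refine ⟨fun k hk ↦ (hsq ⟨k, hk⟩).2 (h.mul_self _), fun k hk ↦ ?_, fun k l hkl hl ↦
      (hcomm ⟨k, by omega⟩ ⟨l, hl⟩ hkl).2 (h.comm _ _ ?_)⟩
    · have := (hbraid k hk h.mul_self).2 (h.braid k hk)
      rw [hs ⟨k, by omega⟩, hs ⟨k + 1, hk⟩]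
      exact this
    · simp only [Nat.dist]
      omega
  · intro h
    have q := fun k : Fin (n - 1) ↦ (hsq k).1 (h.mul_self k k.2)
    refine ⟨hψ, q, fun k m hkm ↦ ?_, fun k hk ↦ (hbraid k hk q).1 ?_⟩
    · simp only [Nat.dist] at hkm
      rcases lt_or_ge (k.val + 1) m.val with h' | h'
      · exact (hcomm k m h').1 (h.comm k m h' m.2)
      · exact ((hcomm m k (by omega)).1 (h.comm m k (by omega) k.2)).symm
    · have := h.braid k hk
      rw [hs ⟨k, by omega⟩, hs ⟨k + 1, hk⟩] at this
      exact this

omit [NeZero p] in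
theorem braidConst_swap {k l m : Fin n} {i : Fin n → ZMod p} (hkl : k ≠ l) (hlm : l ≠ m) :
    braidConst C k l m (i ∘ Equiv.swap k m) = braidConst C k l m i := by
  simp only [braidConst, Function.comp_apply, Equiv.swap_apply_left, Equiv.swap_apply_right,
    Equiv.swap_apply_of_ne_of_ne hkl.symm hlm]
  by_cases h : i k = i m
  · rw [h]
  · simp [h, Ne.symm h]

theorem braidConst_swap_mul_e (W : ResidueSystem p n C) {k l m : Fin n} {i : Fin n → ZMod p}
    (hkl : k ≠ l) (hlm : l ≠ m) :
    braidConst C k l m (i ∘ Equiv.swap k m) * W.e (i ∘ Equiv.swap k m) =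
      braidConst C k l m i * W.e i := by
  rw [braidConst_swap hkl hlm]
  by_cases hi : i k = i m
  · rw [comp_swap_of_eq hi]
  · simp [braidConst, Ne.symm hi]

theorem IsCrossing.mul_mul_mul_e {k l m : Fin n} {ψ₁ ψ₂ : A} {W : ResidueSystem p n C}
    (h₁ : IsCrossing W k l ψ₁) (h₂ : IsCrossing W l m ψ₂) (hkm : k ≠ m) (i : Fin n → ZMod p) :
    ψ₁ * ψ₂ * ψ₁ * W.e i • (1 : A) = W.e (i ∘ Equiv.swap k m) • (1 : A) * ψ₁ * ψ₂ * ψ₁ ∧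
    ψ₂ * ψ₁ * ψ₂ * W.e i • (1 : A) = W.e (i ∘ Equiv.swap k m) • (1 : A) * ψ₂ * ψ₁ * ψ₂ := by
  have hc {k l : Fin n} {ψ : A} (hψ : IsCrossing W k l ψ) (i : Fin n → ZMod p) (v : A) :
      v * ψ * W.e i • (1 : A) = v * W.e (i ∘ Equiv.swap k l) • (1 : A) * ψ := by
    rw [mul_assoc, hψ.mul_e, mul_smul_one_mul]
  have hc' {k l : Fin n} {ψ : A} (hψ : IsCrossing W k l ψ) (i : Fin n → ZMod p) :
      ψ * W.e i • (1 : A) = W.e (i ∘ Equiv.swap k l) • (1 : A) * ψ := by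
    simpa using hc hψ i 1
  constructor
  · rw [hc h₁, hc h₂, hc' h₁, Function.comp_assoc, Function.comp_assoc, ← Equiv.Perm.coe_mul,
      ← Equiv.Perm.coe_mul, Equiv.swap_comm k l, Equiv.swap_comm l m, ← mul_assoc,
      Equiv.swap_mul_swap_mul_swap h₂.ne.symm hkm.symm]
  · rw [hc h₂, hc h₁, hc' h₂, Function.comp_assoc, Function.comp_assoc, ← Equiv.Perm.coe_mul,
      ← Equiv.Perm.coe_mul, ← mul_assoc, Equiv.swap_mul_swap_mul_swap h₁.ne hkm,
      Equiv.swap_comm m k]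

theorem IsCrossing.braid_mul_e_iff {k l m : Fin n} {ψ₁ ψ₂ : A} {W : ResidueSystem p n C}
    (h₁ : IsCrossing W k l ψ₁) (h₂ : IsCrossing W l m ψ₂) (hkm : k ≠ m) :
    (∀ i, (ψ₁ * ψ₂ * ψ₁ - ψ₂ * ψ₁ * ψ₂) * W.e i • (1 : A) =
      (braidConst C k l m i * W.e i) • (1 : A)) ↔
    ∀ i, W.e i • (1 : A) * ψ₁ * ψ₂ * ψ₁ - W.e i • (1 : A) * ψ₂ * ψ₁ * ψ₂ =
      braidConst C k l m i • W.e i • (1 : A) := by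
  have hswap (i : Fin n → ZMod p) : (i ∘ Equiv.swap k m) ∘ Equiv.swap k m = i := by
    ext
    simp
  constructor
  · intro h i
    have := h (i ∘ Equiv.swap k m)
    rwa [sub_mul, (h₁.mul_mul_mul_e h₂ hkm _).1, (h₁.mul_mul_mul_e h₂ hkm _).2, hswap,
      braidConst_swap_mul_e W h₁.ne h₂.ne, mul_smul] at this
  · intro h i
    rw [sub_mul, (h₁.mul_mul_mul_e h₂ hkm _).1, (h₁.mul_mul_mul_e h₂ hkm _).2, h,
      smul_smul, braidConst_swap_mul_e W h₁.ne h₂.ne]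

namespace IsKLRFamily

variable {W : ResidueSystem p n C} {ψ : Fin (n - 1) → A} (hψ : IsKLRFamily W ψ)

include hψ

theorem mul_self_mul_e (k : Fin (n - 1)) (i : Fin n → ZMod p) :
    ψ k * ψ k * W.e i • (1 : A) = (W.Q (ka n k) (kb n k) i * W.e i) • (1 : A) := by
  have h := hψ.mul_self k i
  rw [smul_mul_assoc, smul_mul_assoc, one_mul] at h
  rw [mul_assoc, (hψ.isCrossing k).mul_e, ← mul_smul_one_mul, (hψ.isCrossing k).mul_e,
    smul_mul_assoc, ← smul_smul, ← h]
  congr 2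
  ext
  simp

theorem braid_mul_e (k : ℕ) (hk : k + 1 < n - 1) (i : Fin n → ZMod p) :
    (ψ ⟨k, by omega⟩ * ψ ⟨k + 1, hk⟩ * ψ ⟨k, by omega⟩ -
      ψ ⟨k + 1, hk⟩ * ψ ⟨k, by omega⟩ * ψ ⟨k + 1, hk⟩) * W.e i • (1 : A) =
    (braidConst C ⟨k, by omega⟩ ⟨k + 1, by omega⟩ ⟨k + 2, by omega⟩ i * W.e i) • (1 : A) :=
  ((hψ.isCrossing ⟨k, by omega⟩).braid_mul_e_iff (hψ.isCrossing ⟨k + 1, hk⟩)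
    (by simp only [ka, kb, ne_eq, Fin.mk.injEq]; omega)).2 (hψ.braid k hk) i

end IsKLRFamily

end Family

section Hom

variable {p n : ℕ} [Fact p.Prime] {C : Type*} [CommRing C]
  {A : Type*} [Ring A] [Algebra (Zp p) A] [Module C A] [IsScalarTower C A A]
  {W : ResidueSystem p n C} {ψ : Fin (n - 1) → A}

/-- A family satisfying the KLR relations defines a representation of the KLR algebra. -/
theorem IsKLRFamily.exists_algHom (hp : 2 < p) (hψ : IsKLRFamily W ψ)
    (he : ∀ h0 : 0 < n, ∀ i : Fin n → ZMod p, i ⟨0, h0⟩ ≠ 0 → W.e i = 0)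
    (hx : ∀ h0 : 0 < n, W.x ⟨0, h0⟩ = 0) :
    ∃ f : KLR p n →ₐ[Zp p] A,
      (∀ i, f (RingQuot.mkAlgHom (Zp p) _ (Egen p n i)) = W.e i • (1 : A)) ∧
      (∀ k, f (RingQuot.mkAlgHom (Zp p) _ (Ψgen p n k)) = ψ k) ∧
      ∀ l, f (RingQuot.mkAlgHom (Zp p) _ (Ygen p n l)) = W.y l • (1 : A) := by
  let F : KLRFree p n →ₐ[Zp p] A := FreeAlgebra.lift (Zp p) fun
    | .e i => W.e i • (1 : A)
    | .psi k => ψ k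
    | .y l => W.y l • (1 : A)
  have hFe (i) : F (Egen p n i) = W.e i • (1 : A) := FreeAlgebra.lift_ι_apply _ _
  have hFψ (k) : F (Ψgen p n k) = ψ k := FreeAlgebra.lift_ι_apply _ _
  have hFy (l) : F (Ygen p n l) = W.y l • (1 : A) := FreeAlgebra.lift_ι_apply _ _
  have hpA : (p : A) = (p : C) • (1 : A) := by
    rw [Nat.cast_smul_eq_nsmul, nsmul_one]
  have hrel : ∀ ⦃a b⦄, KLRRel p n a b → F a = F b := by
    intro a b h
    cases h with
    | unit => simp only [map_sum, hFe, map_one, ← Finset.sum_smul, W.sum_e, one_smul]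
    | ee_same i => rw [map_mul, hFe, smul_one_mul_smul_one, W.e_mul_self]
    | ee_diff i j h =>
      rw [map_mul, hFe, hFe, smul_one_mul_smul_one, W.e_mul_of_ne i j h, zero_smul, map_zero]
    | ye l i => rw [map_mul, map_mul, hFe, hFy, smul_one_mul_smul_one, smul_one_mul_smul_one,
        mul_comm]
    | psie k i =>
      rw [map_mul, map_mul, hFψ, hFe, hFe, (hψ.isCrossing k).mul_e, smul_one_mul, swapSeq]
    | yy l m => rw [map_mul, map_mul, hFy, hFy, smul_one_mul_smul_one, smul_one_mul_smul_one,
        mul_comm]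
    | psiy_eq k i h =>
      have := (hψ.isCrossing k).mul_y_right i
      rw [if_pos h] at this
      simp only [map_mul, map_add, hFψ, hFy, hFe, smul_one_mul, add_mul, one_mul, this]
    | psiy_ne k i h =>
      have := (hψ.isCrossing k).mul_y_right i
      rw [if_neg h, add_zero] at this
      simp only [map_mul, hFψ, hFy, hFe, smul_one_mul, this]
    | ypsi_eq k i h =>
      have := (hψ.isCrossing k).mul_y_left i
      rw [if_pos h] at this
      simp only [map_mul, map_add, hFψ, hFy, hFe, smul_one_mul, add_mul, one_mul, this]
    | ypsi_ne k i h =>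
      have := (hψ.isCrossing k).mul_y_left i
      rw [if_neg h, add_zero] at this
      simp only [map_mul, hFψ, hFy, hFe, smul_one_mul, this]
    | psiy_far k l h1 h2 =>
      rw [map_mul, map_mul, hFψ, hFy, smul_one_mul,
        (hψ.isCrossing k).y_smul (fun h ↦ h1 (congrArg Fin.val h))
          (fun h ↦ h2 (congrArg Fin.val h))]
    | psipsi_far k m h => rw [map_mul, map_mul, hFψ, hFψ, hψ.comm k m h]
    | e_first h0 i h => rw [hFe, he h0 i h, zero_smul, map_zero]
    | y_first h0 i =>
      rw [map_mul, hFe, hFy, smul_one_mul_smul_one, W.y_mul_e, hx h0, map_zero]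
      by_cases h : i ⟨0, h0⟩ = 0
      · simp [h]
      · simp [he h0 i h]
    | braid_up k hk i h2 h1 =>
      have := hψ.braid_mul_e k hk i
      rw [braidConst, if_pos ⟨h2, h1⟩] at this
      simp only [map_mul, map_sub, map_neg, hFψ, hFe, this, neg_mul, one_mul, neg_smul]
    | braid_down k hk i h2 h1 =>
      have := hψ.braid_mul_e k hk i
      rw [braidConst, if_neg, if_pos ⟨h2, h1⟩] at this
      · simp only [map_mul, map_sub, hFψ, hFe, this, one_mul]
      · rintro ⟨-, h⟩
        exact two_ne_zero_of_two_lt hp (by linear_combination h1 - h)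
    | braid_other k hk i hu hd =>
      have := hψ.braid_mul_e k hk i
      rw [braidConst, if_neg hu, if_neg hd, zero_mul, zero_smul] at this
      simp only [map_mul, map_sub, hFψ, hFe, this, map_zero]
    | sq_up k i h1 h2 =>
      have := hψ.mul_self_mul_e k i
      rw [W.Q_mul_e_of_up hp h1, if_neg h2, add_zero] at this
      simp only [map_mul, map_sub, hFψ, hFy, hFe, this, ← sub_smul, smul_one_mul_smul_one]
    | sq_up_zero k i h1 h2 =>
      have := hψ.mul_self_mul_e k i
      rw [W.Q_mul_e_of_up hp h1, if_pos h2] at this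
      simp only [map_mul, map_sub, map_add, map_natCast, hpA, hFψ, hFy, hFe, this, ← sub_smul,
        ← add_smul, smul_one_mul_smul_one]
    | sq_down k i h1 h2 =>
      have := hψ.mul_self_mul_e k i
      rw [W.Q_mul_e_of_down hp h1, if_neg h2, add_zero] at this
      simp only [map_mul, map_sub, hFψ, hFy, hFe, this, ← sub_smul, smul_one_mul_smul_one]
    | sq_down_zero k i h1 h2 =>
      have := hψ.mul_self_mul_e k i
      rw [W.Q_mul_e_of_down hp h1, if_pos h2] at this
      simp only [map_mul, map_sub, map_add, map_natCast, hpA, hFψ, hFy, hFe, this, ← sub_smul,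
        ← add_smul, smul_one_mul_smul_one]
    | sq_same k i h =>
      have := hψ.mul_self_mul_e k i
      rw [Q, if_pos h, zero_mul, zero_smul] at this
      simp only [map_mul, hFψ, hFe, this, map_zero]
    | sq_other k i h1 h2 h3 =>
      have := hψ.mul_self_mul_e k i
      rw [Q, if_neg h1, if_neg h2, if_neg h3, one_mul] at this
      simp only [map_mul, hFψ, hFe, this]
  refine ⟨RingQuot.liftAlgHom (Zp p) ⟨F, hrel⟩, fun i ↦ ?_, fun k ↦ ?_, fun l ↦ ?_⟩
  · rw [RingQuot.liftAlgHom_mkAlgHom_apply, hFe]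
  · rw [RingQuot.liftAlgHom_mkAlgHom_apply, hFψ]
  · rw [RingQuot.liftAlgHom_mkAlgHom_apply, hFy]

end Hom

section CoxeterSide

open Polynomial

variable {p n : ℕ}

theorem ResidueSystem.x_eq_y_add [NeZero p] {C : Type*} [CommRing C] (W : ResidueSystem p n C)
    (k : Fin n) : W.x k = W.y k + ∑ i, W.e i * ((i k).val : C) := by
  refine W.ext_e fun i ↦ ?_
  rw [smul_eq_mul, smul_eq_mul, mul_comm, mul_comm (W.e i), add_mul, y_mul_e, sum_e_mul]
  ring

theorem reflectionOf_smul_add [NeZero p] {C A : Type*} [CommRing C] [Ring A] [Module C A]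
    (W : ResidueSystem p n C) (k l : Fin n) (s : A) :
    reflectionOf W k l (W.h k l • (s + W.b k l • (1 : A))) = s := by
  rw [reflectionOf, smul_smul, g_mul_h, one_smul, add_sub_cancel_right]

/-- An algebra with a Coxeter family of type `A` receives a map from the KLR algebra whose range
contains the family. -/
theorem IsCoxeterFamily.exists_algHom [Fact p.Prime] {A : Type*} [Ring A] [Algebra (Zp p) A]
    (hp : 2 < p) {s : ℕ → A} (hs : IsCoxeterFamily (n - 1) s) :
    ∃ f : KLR p n →ₐ[Zp p] A, ∀ k < n - 1, s k ∈ f.range := by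
  have hle (k : Fin n) : (k : ℕ) ≤ n - 1 := by omega
  choose m hm using fun k : Fin n ↦ hs.exists_aeval_jucysMurphy_eq_zero (Zp p) (hle k)
  obtain ⟨C, _, _, _, _, φ, hφ, hφr, hφs⟩ := exists_commRing_range_eq_adjoin (Zp p)
    (Set.range fun k : Fin n ↦ jucysMurphy s k) (by
      rintro _ ⟨k, rfl⟩ _ ⟨l, rfl⟩
      exact hs.commute_jucysMurphy (hle k) (hle l))
  have hxφ (k : Fin n) : ∃ x, φ x = jucysMurphy s k :=
    hφr.ge (Algebra.subset_adjoin ⟨k, rfl⟩)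
  choose x hxφ using hxφ
  set M : Multiset ℤ := {0} + ∑ k, m k with hM
  have hx (k : Fin n) : aeval (x k) (ofIntRoots (Zp p) M) = 0 := by
    have hk : aeval (x k) (ofIntRoots (Zp p) (m k)) = 0 :=
      hφ (by rw [← aeval_algHom_apply, hxφ, hm, map_zero])
    have hd : ofIntRoots (Zp p) (m k) ∣ ofIntRoots (Zp p) M :=
      ofIntRoots_dvd_of_le _ ((Finset.single_le_sum_of_canonicallyOrdered
        (Finset.mem_univ k)).trans (Multiset.le_add_left _ _))
    exact zero_dvd_iff.1 (hk ▸ map_dvd (aeval (x k)) hd)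
  obtain ⟨ε, hsum, hε⟩ := exists_spectral_polynomials (isUnit_intCast_Zp (p := p)) M
  obtain ⟨W, hWe, hWx⟩ := exists_residueSystem isUnit_intCast_Zp
    (completeOrthogonalIdempotents_prod_aeval hsum hε hx) x fun i k ↦
      ⟨_, fun c hc ↦ (Multiset.mem_filter.1 hc).2, aeval_filter_mul_prod_aeval hε hx i k⟩
  have hφW (k) : φ (W.x k) = jucysMurphy s k := by rw [hWx, hxφ]
  have hrefl (k : Fin (n - 1)) : IsReflection W (ka n k) (kb n k) (s k) := by
    refine .of_prod_aeval hφs (fun i ↦ by rw [hWe, hWx]) (by simp [ka, kb]) (fun q hk hl ↦ ?_)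
      ?_ ?_
    · rw [hφW]
      simp only [ka, kb, ne_eq, Fin.ext_iff] at hk hl
      rcases lt_or_gt_of_ne hk with h | h
      · exact hs.commute_jucysMurphy_of_lt k.2 h
      · exact hs.commute_jucysMurphy_of_gt (hle q) (by omega)
    · rw [hφW, hφW]
      exact hs.mul_jucysMurphy_succ k.2
    · rw [hφW, hφW]
      exact eq_sub_of_add_eq (hs.jucysMurphy_succ_mul k.2).symm
  set ψ : Fin (n - 1) → A := fun k ↦
    W.h (ka n k) (kb n k) • (s k + W.b (ka n k) (kb n k) • (1 : A)) with hψ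
  have hsψ (k : Fin (n - 1)) : s k = reflectionOf W (ka n k) (kb n k) (ψ k) :=
    (reflectionOf_smul_add W _ _ _).symm
  have hfam : IsKLRFamily W ψ :=
    (isKLRFamily_iff_isCoxeterFamily hp (fun k ↦ (hrefl k).isCrossing) hsψ).2 hs
  have hx0 (h0 : 0 < n) : W.x ⟨0, h0⟩ = 0 := hφ (by rw [hφW, map_zero]; rfl)
  obtain ⟨f, hfe, hfψ, hfy⟩ := hfam.exists_algHom hp (fun h0 i hi ↦ by
    have hd : ofIntRoots (Zp p) {0} ∣ ε (i ⟨0, h0⟩) :=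
      (ofIntRoots_dvd_of_le _ (Multiset.singleton_le.2 (Multiset.mem_filter.2
        ⟨by simp [hM], by simp⟩))).trans (ofIntRoots_filter_dvd hε hi)
    rw [hWe]
    refine Finset.prod_eq_zero (Finset.mem_univ ⟨0, h0⟩) (zero_dvd_iff.1 ?_)
    have := map_dvd (aeval (x ⟨0, h0⟩)) hd
    rw [aeval_ofIntRoots, Multiset.map_singleton, Multiset.prod_singleton, Int.cast_zero,
      sub_zero] at this
    exact ((congrFun hWx _).symm.trans (hx0 h0)).symm.dvd.trans this) hx0
  have hCx (k : Fin n) : W.x k • (1 : A) ∈ f.range := by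
    rw [x_eq_y_add, add_smul, Finset.sum_smul]
    refine add_mem (AlgHom.mem_range _ |>.2 ⟨_, hfy k⟩) (sum_mem fun i _ ↦ ?_)
    rw [mul_comm, mul_smul, Nat.cast_smul_eq_nsmul]
    exact nsmul_mem (AlgHom.mem_range _ |>.2 ⟨_, hfe i⟩) _
  have hC (c : C) : φ c ∈ f.range := by
    have : Algebra.adjoin (Zp p) (Set.range fun k : Fin n ↦ jucysMurphy s k) ≤ f.range := by
      refine Algebra.adjoin_le ?_
      rintro _ ⟨k, rfl⟩
      have := hCx k
      rwa [hφs, mul_one, hφW] at this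
    exact this (hφr ▸ ⟨c, rfl⟩)
  refine ⟨f, fun k hk ↦ ?_⟩
  rw [hsψ ⟨k, hk⟩, reflectionOf, hφs, hφs, mul_one]
  exact sub_mem (mul_mem (hC _) (AlgHom.mem_range _ |>.2 ⟨_, hfψ _⟩)) (hC _)

end CoxeterSide

section CoxeterSpan

/-- The product `s (m - 1) * s (m - 2) * ⋯ * s j`. -/
def descProd {A : Type*} [Monoid A] (s : ℕ → A) : ℕ → ℕ → A
  | 0, _ => 1
  | m + 1, j => if j ≤ m then s m * descProd s m j else 1

section

variable {A : Type*} [Monoid A] {N : ℕ} {s : ℕ → A}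

theorem descProd_succ {m j : ℕ} (h : j ≤ m) : descProd s (m + 1) j = s m * descProd s m j :=
  if_pos h

theorem descProd_of_le {m j : ℕ} (h : m ≤ j) : descProd s m j = 1 := by
  cases m with
  | zero => rfl
  | succ m => exact if_neg (by omega)

theorem descProd_succ_mul {m j : ℕ} (h : j < m) :
    descProd s m (j + 1) * s j = descProd s m j := by
  induction m with
  | zero => omega
  | succ m ih =>
    rcases Nat.lt_succ_iff_lt_or_eq.1 h with h | rfl
    · rw [descProd_succ h, descProd_succ h.le, mul_assoc, ih h]
    · rw [descProd_of_le le_rfl, descProd_succ le_rfl, descProd_of_le le_rfl, one_mul, mul_one]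

namespace IsCoxeterFamily

variable (hs : IsCoxeterFamily N s)

include hs

theorem descProd_mul {m j : ℕ} (h : j < m) (hm : m ≤ N) :
    descProd s m j * s j = descProd s m (j + 1) := by
  rw [← descProd_succ_mul h, mul_assoc, hs.mul_self j (by omega), mul_one]

theorem commute_descProd_of_lt {m j k : ℕ} (h : m < k) (hk : k < N) :
    Commute (s k) (descProd s m j) := by
  induction m with
  | zero => exact Commute.one_right _
  | succ m ih =>
    by_cases hj : j ≤ m
    · rw [descProd_succ hj]
      exact Commute.mul_right (hs.comm m k h hk).symm (ih (by omega))
    · rw [descProd_of_le (by omega)]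
      exact Commute.one_right _

theorem commute_descProd_of_gt {m j k : ℕ} (h : k + 1 < j) (hm : m ≤ N) :
    Commute (s k) (descProd s m j) := by
  induction m with
  | zero => exact Commute.one_right _
  | succ m ih =>
    by_cases hj : j ≤ m
    · rw [descProd_succ hj]
      exact Commute.mul_right (hs.comm k m (by omega) hm) (ih (by omega))
    · rw [descProd_of_le (by omega)]
      exact Commute.one_right _

theorem descProd_mul_succ {m j k : ℕ} (hj : j ≤ k) (hk : k + 1 < m) (hm : m ≤ N) :
    descProd s m j * s (k + 1) = s k * descProd s m j := by
  induction m with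
  | zero => omega
  | succ m ih =>
    rw [descProd_succ (by omega)]
    rcases Nat.lt_succ_iff_lt_or_eq.1 hk with h | rfl
    · rw [mul_assoc, ih h (by omega), ← mul_assoc, ← mul_assoc, hs.comm k m h hm]
    · rw [descProd_succ hj, mul_assoc, mul_assoc, ← (hs.commute_descProd_of_lt
        (Nat.lt_succ_self k) hm).eq, ← mul_assoc, ← mul_assoc, ← mul_assoc, ← mul_assoc,
        hs.braid k hm]

theorem exists_finset_mul_mem {m : ℕ} (hm : m ≤ N) :
    ∃ T : Finset A, T.card ≤ (m + 1).factorial ∧ 1 ∈ T ∧ ∀ t ∈ T, ∀ k < m, t * s k ∈ T := by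
  classical
  induction m with
  | zero => exact ⟨{1}, by simp⟩
  | succ m ih =>
    obtain ⟨T, hT, h1, hTs⟩ := ih (by omega)
    have hmem {a : A} : a ∈ (T ×ˢ Finset.range (m + 2)).image
        (fun q ↦ q.1 * descProd s (m + 1) q.2) ↔
        ∃ t ∈ T, ∃ j ≤ m + 1, t * descProd s (m + 1) j = a := by
      simp only [Finset.mem_image, Finset.mem_product, Finset.mem_range, Prod.exists]
      constructor
      · rintro ⟨t, j, ⟨ht, hj⟩, h⟩
        exact ⟨t, ht, j, by omega, h⟩
      · rintro ⟨t, ht, j, hj, h⟩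
        exact ⟨t, j, ⟨ht, by omega⟩, h⟩
    refine ⟨(T ×ˢ Finset.range (m + 2)).image fun q ↦ q.1 * descProd s (m + 1) q.2,
      ?_, hmem.2 ⟨1, h1, m + 1, le_rfl, by rw [descProd_of_le le_rfl, mul_one]⟩, ?_⟩
    · refine Finset.card_image_le.trans ?_
      rw [Finset.card_product, Finset.card_range, Nat.factorial_succ (m + 1), mul_comm]
      exact Nat.mul_le_mul_left _ hT
    · intro a ha k hk
      obtain ⟨t, ht, j, hj, rfl⟩ := hmem.1 ha
      rw [hmem]
      rcases lt_trichotomy j k with h | rfl | h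
      · obtain ⟨k, rfl⟩ := Nat.exists_eq_succ_of_ne_zero (show k ≠ 0 by omega)
        refine ⟨t * s k, hTs t ht k (by omega), j, hj, ?_⟩
        rw [mul_assoc, mul_assoc, hs.descProd_mul_succ (by omega) hk hm]
      · exact ⟨t, ht, j + 1, hk, by rw [mul_assoc, hs.descProd_mul hk hm]⟩
      · rcases eq_or_lt_of_le (Nat.succ_le_of_lt h) with rfl | h'
        · exact ⟨t, ht, k, hk.le, by rw [mul_assoc, descProd_succ_mul hk]⟩
        · refine ⟨t * s k, hTs t ht k (by omega), j, hj, ?_⟩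
          rw [mul_assoc, mul_assoc, (hs.commute_descProd_of_gt h' hm).eq]

end IsCoxeterFamily

end

/-- An algebra generated by a Coxeter family of type `A` is spanned by at most `(N + 1)!`
elements. -/
theorem IsCoxeterFamily.exists_span_eq_top {R A : Type*} [CommRing R] [Ring A] [Algebra R A]
    {N : ℕ} {s : ℕ → A} (hs : IsCoxeterFamily N s)
    (hgen : Algebra.adjoin R (s '' Set.Iio N) = ⊤) :
    ∃ T : Finset A, T.card ≤ (N + 1).factorial ∧ Submodule.span R (T : Set A) = ⊤ := by
  obtain ⟨T, hT, h1, hTs⟩ := hs.exists_finset_mul_mem le_rfl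
  refine ⟨T, hT, eq_top_iff.2 ?_⟩
  rw [← Algebra.top_toSubmodule, ← hgen, Algebra.adjoin_eq_span]
  refine Submodule.span_mono fun a ha ↦ ?_
  refine Submonoid.closure_induction_right h1 ?_ ha
  rintro x hx _ ⟨k, hk, rfl⟩ h
  exact hTs x h k hk

/-- A surjection from an algebra generated by a Coxeter family of type `A` onto a free module of
rank `(N + 1)!` is injective. -/
theorem IsCoxeterFamily.injective_of_surjective {R A : Type*} [CommRing R] [Ring A] [Algebra R A]
    {N : ℕ} {s : ℕ → A} (hs : IsCoxeterFamily N s)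
    (hgen : Algebra.adjoin R (s '' Set.Iio N) = ⊤) {ι : Type*} [Finite ι]
    (hι : Nat.card ι = (N + 1).factorial) (f : A →ₗ[R] ι →₀ R) (hf : Function.Surjective f) :
    Function.Injective f := by
  classical
  cases nonempty_fintype ι
  obtain ⟨T, hT, hspan⟩ := hs.exists_span_eq_top hgen
  have hg : Function.Surjective (Finsupp.linearCombination R ((↑) : T → A)) := by
    rw [← LinearMap.range_eq_top, Finsupp.range_linearCombination, Subtype.range_coe_subtype]
    exact hspan
  obtain ⟨j⟩ := Function.Embedding.nonempty_of_card_le (α := T) (β := ι)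
    (by rwa [Fintype.card_coe, ← Nat.card_eq_fintype_card, hι])
  have hinj := OrzechProperty.injective_of_surjective_of_injective
    (Finsupp.lmapDomain R R j) (f ∘ₗ Finsupp.linearCombination R ((↑) : T → A))
    (Finsupp.mapDomain_injective j.injective) (hf.comp hg)
  rw [LinearMap.coe_comp] at hinj
  exact hinj.of_comp_right hg

end CoxeterSpan

section SymmetricGroup

/-- The simple transpositions of the symmetric group, extended by `1`. -/
def simpleTransposition (n k : ℕ) : Equiv.Perm (Fin n) :=
  if h : k + 1 < n then Equiv.swap ⟨k, by omega⟩ ⟨k + 1, h⟩ else 1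

theorem isCoxeterFamily_simpleTransposition (n : ℕ) :
    IsCoxeterFamily (n - 1) (simpleTransposition n) where
  mul_self k hk := by rw [simpleTransposition, dif_pos (by omega), Equiv.swap_mul_self]
  braid k hk := by
    rw [simpleTransposition, simpleTransposition, dif_pos (by omega), dif_pos (by omega)]
    rw [Equiv.swap_mul_swap_mul_swap (by simp) (by simp; omega),
      Equiv.swap_comm (⟨k, by omega⟩ : Fin n) ⟨k + 1, by omega⟩,
      Equiv.swap_comm (⟨k + 1, by omega⟩ : Fin n) ⟨k + 1 + 1, by omega⟩,
      Equiv.swap_mul_swap_mul_swap (by simp) (by simp; omega), Equiv.swap_comm]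
  comm k l hkl hl := by
    rw [simpleTransposition, simpleTransposition, dif_pos (by omega), dif_pos (by omega)]
    refine (Equiv.Perm.disjoint_swap_swap ?_).commute.eq
    simp
    omega

theorem closure_simpleTransposition (n : ℕ) :
    Submonoid.closure (simpleTransposition n '' Set.Iio (n - 1)) = ⊤ := by
  cases n with
  | zero => exact Subsingleton.elim _ _
  | succ n =>
    rw [eq_top_iff, ← Equiv.Perm.mclosure_swap_castSucc_succ]
    refine Submonoid.closure_mono ?_
    rintro _ ⟨k, rfl⟩
    refine ⟨k, k.2, ?_⟩
    rw [simpleTransposition, dif_pos (by omega)]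
    rfl

theorem IsCoxeterFamily.map {A B F : Type*} [Monoid A] [Monoid B] [FunLike F A B]
    [MonoidHomClass F A B] {N : ℕ} {s : ℕ → A} (hs : IsCoxeterFamily N s) (f : F) :
    IsCoxeterFamily N fun k ↦ f (s k) where
  mul_self k hk := by rw [← map_mul, hs.mul_self k hk, map_one]
  braid k hk := by simp only [← map_mul, hs.braid k hk]
  comm k l hkl hl := by rw [← map_mul, hs.comm k l hkl hl, map_mul]

theorem MonoidAlgebra.eq_top_of_of_mem {R G : Type*} [CommRing R] [Monoid G]
    (S : Subalgebra R (MonoidAlgebra R G)) {X : Set G} (hX : Submonoid.closure X = ⊤)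
    (h : ∀ g ∈ X, MonoidAlgebra.of R G g ∈ S) : S = ⊤ := by
  have hle : Submonoid.closure X ≤ S.toSubmonoid.comap (MonoidAlgebra.of R G) :=
    Submonoid.closure_le.2 h
  rw [hX] at hle
  refine eq_top_iff.2 fun a _ ↦ ?_
  induction a using MonoidAlgebra.induction_on with
  | of g => exact hle (Submonoid.mem_top g)
  | add a b ha hb => exact add_mem (ha trivial) (hb trivial)
  | smul r a ha => exact S.smul_mem (ha trivial) r

end SymmetricGroup

section ShiftedRelations

/-- The relations of the integral KLR algebra in terms of the dots shifted by the residues. -/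
structure IsShiftedKLR {p n : ℕ} [NeZero p] {A : Type*} [Ring A] (E : (Fin n → ZMod p) → A)
    (X : Fin n → A) (P : Fin (n - 1) → A) : Prop where
  sum_e : ∑ i, E i = 1
  e_mul_self : ∀ i, E i * E i = E i
  e_mul_of_ne : ∀ i j, i ≠ j → E i * E j = 0
  commute_x_e : ∀ l i, Commute (X l) (E i)
  commute_x : ∀ l m, Commute (X l) (X m)
  psi_mul_e : ∀ k i, P k * E i = E (i ∘ Equiv.swap (ka n k) (kb n k)) * P k
  psi_mul_x_mul_e : ∀ k i, P k * X (kb n k) * E i =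
    X (ka n k) * P k * E i + if i (ka n k) = i (kb n k) then E i else 0
  x_mul_psi_mul_e : ∀ k i, X (kb n k) * P k * E i =
    P k * X (ka n k) * E i + if i (ka n k) = i (kb n k) then E i else 0
  commute_psi_x : ∀ k l, l ≠ ka n k → l ≠ kb n k → Commute (P k) (X l)
  commute_psi : ∀ k m, 1 < Nat.dist k.val m.val → Commute (P k) (P m)
  e_first : ∀ h : 0 < n, ∀ i, i ⟨0, h⟩ ≠ 0 → E i = 0
  x_first : ∀ h : 0 < n, X ⟨0, h⟩ = 0
  psi_mul_psi_mul_e : ∀ k i, P k * P k * E i =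
    (if i (ka n k) = i (kb n k) then 0
      else if i (kb n k) = i (ka n k) + 1 then 1 + X (ka n k) - X (kb n k)
      else if i (ka n k) = i (kb n k) + 1 then 1 - X (ka n k) + X (kb n k) else 1) * E i
  braid : ∀ (k : ℕ) (hk : k + 1 < n - 1) (i : Fin n → ZMod p),
    (P ⟨k, by omega⟩ * P ⟨k + 1, hk⟩ * P ⟨k, by omega⟩ -
      P ⟨k + 1, hk⟩ * P ⟨k, by omega⟩ * P ⟨k + 1, hk⟩) * E i =
    braidConst A ⟨k, by omega⟩ ⟨k + 1, by omega⟩ ⟨k + 2, by omega⟩ i * E i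

theorem shifted_sub_mul_eq {A : Type*} [Ring A] {x y x' y' e : A} {a b : ℕ} (c : ℕ)
    (hx : x * e = y * e + a * e) (hx' : x' * e = y' * e + b * e) (h : c + b = 1 + a) :
    (y + c - y') * e = (1 + x - x') * e := by
  have h' : (c : A) * e + b * e = e + a * e := by
    rw [← add_mul, ← Nat.cast_add, h, Nat.cast_add, add_mul, Nat.cast_one, one_mul]
  rw [sub_mul, sub_mul, add_mul, add_mul, one_mul, hx, hx', eq_sub_of_add_eq h']
  abel

theorem one_sub_add_eq_one_add_sub {A : Type*} [Ring A] (x y : A) : 1 - x + y = 1 + y - x :=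
  sub_add_eq_add_sub _ _ _

theorem neg_eq_neg_one_mul_of_ring {A : Type*} [Ring A] (x : A) : -x = -1 * x :=
  neg_eq_neg_one_mul x

theorem Subalgebra.mem_of_add_mem {R A : Type*} [CommRing R] [Ring A] [Algebra R A]
    (S : Subalgebra R A) {a b : A} (hab : a + b ∈ S) (hb : b ∈ S) : a ∈ S := by
  simpa using sub_mem hab hb

variable (p n : ℕ) [Fact p.Prime]

/-- The crossing generators of the KLR algebra. -/
noncomputable def KLRpsi (k : Fin (n - 1)) : KLR p n :=
  RingQuot.mkAlgHom (Zp p) (KLRRel p n) (Ψgen p n k)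

/-- The dots of the KLR algebra shifted by the residues. -/
noncomputable def KLRx (l : Fin n) : KLR p n :=
  KLRy p n l + ∑ i : Fin n → ZMod p, ((i l).val : KLR p n) * KLRe p n i

variable {p n}

theorem KLRe_mul_self (i : Fin n → ZMod p) : KLRe p n i * KLRe p n i = KLRe p n i := by
  simpa [KLRe] using RingQuot.mkAlgHom_rel (Zp p) (KLRRel.ee_same i)

theorem KLRe_mul_of_ne {i j : Fin n → ZMod p} (h : i ≠ j) : KLRe p n i * KLRe p n j = 0 := by
  simpa [KLRe] using RingQuot.mkAlgHom_rel (Zp p) (KLRRel.ee_diff i j h)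

theorem sum_KLRe : ∑ i, KLRe p n i = 1 := by
  simpa [KLRe] using RingQuot.mkAlgHom_rel (Zp p) (KLRRel.unit (p := p) (n := n))

theorem KLR_ext {a b : KLR p n} (h : ∀ i, a * KLRe p n i = b * KLRe p n i) : a = b := by
  rw [← mul_one a, ← mul_one b, ← sum_KLRe, Finset.mul_sum, Finset.mul_sum]
  exact Finset.sum_congr rfl fun i _ ↦ h i

theorem commute_KLRy_KLRe (l : Fin n) (i : Fin n → ZMod p) :
    Commute (KLRy p n l) (KLRe p n i) := by
  simpa [KLRe, KLRy, commute_iff_eq] using RingQuot.mkAlgHom_rel (Zp p) (KLRRel.ye l i)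

theorem KLRx_mul_KLRe (l : Fin n) (i : Fin n → ZMod p) :
    KLRx p n l * KLRe p n i = KLRy p n l * KLRe p n i + ((i l).val : KLR p n) * KLRe p n i := by
  rw [KLRx, add_mul, Finset.sum_mul, Finset.sum_eq_single i]
  · rw [mul_assoc, KLRe_mul_self]
  · intro j _ hj
    rw [mul_assoc, KLRe_mul_of_ne hj, mul_zero]
  · simp

theorem commute_KLRx_KLRe (l : Fin n) (i : Fin n → ZMod p) :
    Commute (KLRx p n l) (KLRe p n i) := by
  refine (commute_KLRy_KLRe l i).add_left (Commute.sum_left _ _ _ fun j _ ↦ ?_)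
  refine (Nat.cast_commute _ _).mul_left ?_
  by_cases h : j = i
  · rw [h]; exact Commute.refl _
  · rw [commute_iff_eq, KLRe_mul_of_ne h, KLRe_mul_of_ne (Ne.symm h)]

theorem KLRpsi_mul_KLRe (k : Fin (n - 1)) (i : Fin n → ZMod p) :
    KLRpsi p n k * KLRe p n i =
      KLRe p n (i ∘ Equiv.swap (ka n k) (kb n k)) * KLRpsi p n k := by
  simpa [KLRe, KLRpsi, swapSeq] using RingQuot.mkAlgHom_rel (Zp p) (KLRRel.psie k i)

theorem KLRx_mul_KLRpsi_mul_KLRe (l : Fin n) (k : Fin (n - 1)) (i : Fin n → ZMod p) :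
    KLRx p n l * KLRpsi p n k * KLRe p n i = KLRy p n l * KLRpsi p n k * KLRe p n i +
      ((i (Equiv.swap (ka n k) (kb n k) l)).val : KLR p n) * (KLRpsi p n k * KLRe p n i) := by
  rw [mul_assoc, KLRpsi_mul_KLRe, ← mul_assoc, KLRx_mul_KLRe, add_mul, mul_assoc, mul_assoc,
    ← KLRpsi_mul_KLRe, mul_assoc]
  rfl

theorem KLRpsi_mul_KLRx_mul_KLRe (l : Fin n) (k : Fin (n - 1)) (i : Fin n → ZMod p) :
    KLRpsi p n k * KLRx p n l * KLRe p n i = KLRpsi p n k * KLRy p n l * KLRe p n i +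
      ((i l).val : KLR p n) * (KLRpsi p n k * KLRe p n i) := by
  rw [mul_assoc, KLRx_mul_KLRe, mul_add, ← mul_assoc, ← mul_assoc, ← mul_assoc,
    Nat.cast_comm]

theorem KLRpsi_mul_KLRy_mul_KLRe (k : Fin (n - 1)) (i : Fin n → ZMod p) :
    KLRpsi p n k * KLRy p n (kb n k) * KLRe p n i =
      KLRy p n (ka n k) * KLRpsi p n k * KLRe p n i +
        if i (ka n k) = i (kb n k) then KLRe p n i else 0 := by
  split_ifs with h
  · simpa [KLRe, KLRpsi, KLRy, add_mul] using
      RingQuot.mkAlgHom_rel (Zp p) (KLRRel.psiy_eq k i h)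
  · simpa [KLRe, KLRpsi, KLRy] using RingQuot.mkAlgHom_rel (Zp p) (KLRRel.psiy_ne k i h)

theorem KLRy_mul_KLRpsi_mul_KLRe (k : Fin (n - 1)) (i : Fin n → ZMod p) :
    KLRy p n (kb n k) * KLRpsi p n k * KLRe p n i =
      KLRpsi p n k * KLRy p n (ka n k) * KLRe p n i +
        if i (ka n k) = i (kb n k) then KLRe p n i else 0 := by
  split_ifs with h
  · simpa [KLRe, KLRpsi, KLRy, add_mul] using
      RingQuot.mkAlgHom_rel (Zp p) (KLRRel.ypsi_eq k i h)
  · simpa [KLRe, KLRpsi, KLRy] using RingQuot.mkAlgHom_rel (Zp p) (KLRRel.ypsi_ne k i h)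

theorem isShiftedKLR (p n : ℕ) [Fact p.Prime] :
    IsShiftedKLR (KLRe p n) (KLRx p n) (KLRpsi p n) where
  sum_e := sum_KLRe
  e_mul_self := KLRe_mul_self
  e_mul_of_ne _ _ := KLRe_mul_of_ne
  commute_x_e := commute_KLRx_KLRe
  commute_x l m := by
    have h (l : Fin n) : Commute (KLRx p n l)
        (∑ i : Fin n → ZMod p, ((i m).val : KLR p n) * KLRe p n i) :=
      Commute.sum_right _ _ _ fun i _ ↦
        (Nat.cast_commute _ _).symm.mul_right (commute_KLRx_KLRe l i)
    have hy : Commute (KLRy p n l) (KLRy p n m) := by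
      simpa [KLRy, commute_iff_eq] using RingQuot.mkAlgHom_rel (Zp p) (KLRRel.yy l m)
    refine Commute.add_right (Commute.add_left hy ?_) (h l)
    exact Commute.sum_left _ _ _ fun i _ ↦
        (Nat.cast_commute _ _).mul_left (commute_KLRy_KLRe m i).symm
  psi_mul_e := KLRpsi_mul_KLRe
  psi_mul_x_mul_e k i := by
    rw [KLRpsi_mul_KLRx_mul_KLRe, KLRx_mul_KLRpsi_mul_KLRe, KLRpsi_mul_KLRy_mul_KLRe,
      Equiv.swap_apply_left]
    abel
  x_mul_psi_mul_e k i := by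
    rw [KLRpsi_mul_KLRx_mul_KLRe, KLRx_mul_KLRpsi_mul_KLRe, KLRy_mul_KLRpsi_mul_KLRe,
      Equiv.swap_apply_right]
    abel
  commute_psi_x k l ha hb := by
    refine KLR_ext fun i ↦ ?_
    have : KLRpsi p n k * KLRy p n l = KLRy p n l * KLRpsi p n k := by
      simpa [KLRpsi, KLRy] using RingQuot.mkAlgHom_rel (Zp p) (KLRRel.psiy_far k l
        (fun h ↦ ha (Fin.ext h)) fun h ↦ hb (Fin.ext h))
    rw [KLRpsi_mul_KLRx_mul_KLRe, KLRx_mul_KLRpsi_mul_KLRe, this,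
      Equiv.swap_apply_of_ne_of_ne ha hb]
  commute_psi k m h := by
    simpa [KLRpsi, commute_iff_eq] using RingQuot.mkAlgHom_rel (Zp p) (KLRRel.psipsi_far k m h)
  e_first h i hi := by
    simpa [KLRe] using RingQuot.mkAlgHom_rel (Zp p) (KLRRel.e_first h i hi)
  x_first h := by
    refine KLR_ext fun i ↦ ?_
    have : KLRy p n ⟨0, h⟩ * KLRe p n i = 0 := by
      simpa [KLRy, KLRe] using RingQuot.mkAlgHom_rel (Zp p) (KLRRel.y_first h i)
    rw [KLRx_mul_KLRe, this, zero_mul, zero_add]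
    by_cases hi : i ⟨0, h⟩ = 0
    · rw [hi, ZMod.val_zero, Nat.cast_zero, zero_mul]
    · rw [show KLRe p n i = 0 by
        simpa [KLRe] using RingQuot.mkAlgHom_rel (Zp p) (KLRRel.e_first h i hi), mul_zero]
  psi_mul_psi_mul_e k i := by
    split_ifs with h h1 h2
    · simpa [KLRe, KLRpsi] using RingQuot.mkAlgHom_rel (Zp p) (KLRRel.sq_same k i h)
    · by_cases h0 : i (kb n k) = 0
      · refine Eq.trans ?_ (shifted_sub_mul_eq p (KLRx_mul_KLRe (ka n k) i)
          (KLRx_mul_KLRe (kb n k) i) ?_)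
        · simpa [KLRe, KLRpsi, KLRy] using
            RingQuot.mkAlgHom_rel (Zp p) (KLRRel.sq_up_zero k i h1 h0)
        · rw [h0, ZMod.val_zero, add_zero, add_comm,
            ZMod.val_add_one_eq_of_add_one_eq_zero (h1.symm.trans h0)]
      · refine Eq.trans ?_ (shifted_sub_mul_eq 0 (KLRx_mul_KLRe (ka n k) i)
          (KLRx_mul_KLRe (kb n k) i) ?_)
        · simpa [KLRe, KLRpsi, KLRy] using
            RingQuot.mkAlgHom_rel (Zp p) (KLRRel.sq_up k i h1 h0)
        · rw [h1, ZMod.val_add_one_of_add_one_ne_zero (h1 ▸ h0), zero_add, add_comm]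
    · rw [one_sub_add_eq_one_add_sub]
      by_cases h0 : i (ka n k) = 0
      · refine Eq.trans ?_ (shifted_sub_mul_eq p (KLRx_mul_KLRe (kb n k) i)
          (KLRx_mul_KLRe (ka n k) i) ?_)
        · simpa [KLRe, KLRpsi, KLRy] using
            RingQuot.mkAlgHom_rel (Zp p) (KLRRel.sq_down_zero k i h2 h0)
        · rw [h0, ZMod.val_zero, add_zero, add_comm,
            ZMod.val_add_one_eq_of_add_one_eq_zero (h2.symm.trans h0)]
      · refine Eq.trans ?_ (shifted_sub_mul_eq 0 (KLRx_mul_KLRe (kb n k) i)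
          (KLRx_mul_KLRe (ka n k) i) ?_)
        · simpa [KLRe, KLRpsi, KLRy] using
            RingQuot.mkAlgHom_rel (Zp p) (KLRRel.sq_down k i h2 h0)
        · rw [h2, ZMod.val_add_one_of_add_one_ne_zero (h2 ▸ h0), zero_add, add_comm]
    · simpa [KLRe, KLRpsi] using RingQuot.mkAlgHom_rel (Zp p) (KLRRel.sq_other k i h h1 h2)
  braid k hk i := by
    unfold braidConst
    split_ifs with hu hd
    · refine Eq.trans ?_ (neg_eq_neg_one_mul_of_ring (KLRe p n i))
      simpa [KLRe, KLRpsi] using RingQuot.mkAlgHom_rel (Zp p) (KLRRel.braid_up k hk i hu.1 hu.2)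
    · simpa [KLRe, KLRpsi] using RingQuot.mkAlgHom_rel (Zp p) (KLRRel.braid_down k hk i hd.1 hd.2)
    · simpa [KLRe, KLRpsi] using RingQuot.mkAlgHom_rel (Zp p) (KLRRel.braid_other k hk i hu hd)

theorem adjoin_KLR_eq_top (S : Subalgebra (Zp p) (KLR p n)) (he : ∀ i, KLRe p n i ∈ S)
    (hx : ∀ l, KLRx p n l ∈ S) (hψ : ∀ k, KLRpsi p n k ∈ S) : S = ⊤ := by
  have hy (l) : KLRy p n l ∈ S := by
    have h : KLRy p n l + ∑ i : Fin n → ZMod p, ((i l).val : KLR p n) * KLRe p n i ∈ S := hx l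
    exact Subalgebra.mem_of_add_mem (A := KLR p n) S h
      (S.sum_mem fun i _ ↦ S.mul_mem (natCast_mem S (i l).val) (he i))
  have htop : S.comap (RingQuot.mkAlgHom (Zp p) (KLRRel p n)) = ⊤ := by
    rw [eq_top_iff, ← FreeAlgebra.adjoin_range_ι, Algebra.adjoin_le_iff]
    rintro _ ⟨g, rfl⟩
    cases g with
    | e i => exact he i
    | psi k => exact hψ k
    | y l => exact hy l
  refine eq_top_iff.2 fun a _ ↦ ?_
  obtain ⟨b, rfl⟩ := RingQuot.mkAlgHom_surjective (Zp p) (KLRRel p n) a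
  have : b ∈ S.comap (RingQuot.mkAlgHom (Zp p) (KLRRel p n)) := htop ▸ Algebra.mem_top
  exact this

end ShiftedRelations

section Nearness

open Polynomial

theorem aeval_mul_self_mul_eq_zero {R A : Type*} [CommRing R] [Ring A] [Algebra R A]
    {v e x x' : A} (hxx : Commute x x') (hex : Commute e x) (hex' : Commute e x')
    (hr : v * x' = x * v + e) (hl : v * x = x' * v - e) (hee : e * e = e) (hev : e * v = v)
    (hve : v * e = v) (hvv : v * v = 0) {q : R[X]} (hq : aeval x q * e = 0) :
    aeval x' (q * q) * e = 0 := by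
  obtain ⟨D, hD, hd, hDr, hDl⟩ := exists_divided_difference hxx hex hex' hr hl q
  have hDe : Commute e D := hD e hex hex'
  have hDx : Commute x D := hD x (Commute.refl x) hxx
  have hDx' : Commute x' D := hD x' hxx.symm (Commute.refl x')
  have hqe : e * aeval x q = 0 := by
    rw [(SemiconjBy.aeval hex q).eq, hq]
  have h₁ : D * e = v * aeval x' q := by
    rw [hDr, ← hev, ← mul_assoc, hq, zero_mul, zero_add]
  have h₂ : D * e = aeval x' q * v := by
    rw [eq_comm, ← sub_eq_zero, ← hDl, ← hve, mul_assoc, hqe, mul_zero]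
  have hDD : D * D * e = 0 := by
    rw [← hee, ← mul_assoc, mul_assoc D D, ← hDe.eq, ← mul_assoc, mul_assoc (D * e), h₁]
    nth_rewrite 1 [← h₁]
    rw [h₂, mul_assoc, ← mul_assoc v, hvv, zero_mul, mul_zero]
  have hf : aeval x' q * e = (x' - x) * D * e := by
    rw [hd, sub_mul, hq, sub_zero]
  have hg : Commute D (x' - x) := (hDx'.sub_left hDx).symm
  have hgD : Commute ((x' - x) * D) x' :=
    (((Commute.refl x').sub_left hxx).mul_left hDx'.symm)
  have hgq : Commute ((x' - x) * D) (aeval x' q) := SemiconjBy.aeval hgD q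
  rw [map_mul, mul_assoc, hf, ← mul_assoc, ← hgq.eq, mul_assoc, hf, ← mul_assoc, ← mul_assoc,
    mul_assoc (x' - x) D, hg.eq, mul_assoc, mul_assoc, mul_assoc (x' - x) D, ← mul_assoc D, hDD,
    mul_zero, mul_zero]

end Nearness

namespace IsShiftedKLR

open Polynomial

variable {p n : ℕ} [NeZero p] {A : Type*} [Ring A] {E : (Fin n → ZMod p) → A} {X : Fin n → A}
  {P : Fin (n - 1) → A} (h : IsShiftedKLR E X P) {k : Fin (n - 1)} {i : Fin n → ZMod p}

include h

omit h in
theorem ka_ne_kb (k : Fin (n - 1)) : ka n k ≠ kb n k := by simp [ka, kb]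

theorem e_mul_psi (k i) : E i * P k = P k * E (i ∘ Equiv.swap (ka n k) (kb n k)) := by
  rw [h.psi_mul_e, Function.comp_assoc, ← Equiv.coe_trans, ← Equiv.Perm.mul_def,
    Equiv.swap_mul_self, Equiv.Perm.coe_one, Function.comp_id]

theorem e_mul_psi_mul_x_right (k i) : E i * (P k * X (kb n k)) =
    E i * X (ka n k) * P k + if i (ka n k) = i (kb n k) then E i else 0 := by
  rw [← mul_assoc, h.e_mul_psi, mul_assoc, ← (h.commute_x_e _ _).eq, ← mul_assoc,
    h.psi_mul_x_mul_e, mul_assoc, ← h.e_mul_psi, ← mul_assoc, (h.commute_x_e _ _).eq]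
  simp only [Function.comp_apply, Equiv.swap_apply_left, Equiv.swap_apply_right]
  by_cases hi : i (ka n k) = i (kb n k)
  · rw [if_pos hi, if_pos hi.symm, comp_swap_of_eq hi]
  · rw [if_neg hi, if_neg (Ne.symm hi)]

theorem e_mul_psi_mul_x_left (k i) : E i * (P k * X (ka n k)) =
    E i * X (kb n k) * P k - if i (ka n k) = i (kb n k) then E i else 0 := by
  rw [← mul_assoc, h.e_mul_psi, mul_assoc, ← (h.commute_x_e _ _).eq, ← mul_assoc,
    eq_sub_of_add_eq (h.x_mul_psi_mul_e _ _).symm, mul_assoc, ← h.e_mul_psi, ← mul_assoc,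
    (h.commute_x_e _ _).eq]
  simp only [Function.comp_apply, Equiv.swap_apply_left, Equiv.swap_apply_right]
  by_cases hi : i (ka n k) = i (kb n k)
  · rw [if_pos hi, if_pos hi.symm, comp_swap_of_eq hi]
  · rw [if_neg hi, if_neg (Ne.symm hi)]

theorem commute_aeval_e {R : Type*} [CommRing R] [Algebra R A] (l i) (q : R[X]) :
    Commute (aeval (X l) q) (E i) :=
  Commute.symm (SemiconjBy.aeval (h.commute_x_e l i).symm q)

theorem psi_mul_psi_mul_e_mul_aeval {R : Type*} [CommRing R] [Algebra R A]
    (hi : i (ka n k) ≠ i (kb n k)) {q : R[X]}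
    (hq : aeval (X (ka n k)) q * E (i ∘ Equiv.swap (ka n k) (kb n k)) = 0) :
    P k * P k * E i * aeval (X (kb n k)) q = 0 := by
  have hv : SemiconjBy (P k * E i) (X (kb n k)) (X (ka n k)) := by
    rw [SemiconjBy, mul_assoc, ← (h.commute_x_e _ _).eq, ← mul_assoc, h.psi_mul_x_mul_e,
      if_neg hi, add_zero, mul_assoc]
  rw [mul_assoc (P k), mul_assoc, (SemiconjBy.aeval hv q).eq, h.psi_mul_e,
    ← mul_assoc (aeval _ _), hq,
    zero_mul, mul_zero]

theorem aeval_kb_of_eq {R : Type*} [CommRing R] [Algebra R A] (hi : i (ka n k) = i (kb n k))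
    {q : R[X]} (hq : aeval (X (ka n k)) q * E i = 0) :
    aeval (X (kb n k)) (q * q) * E i = 0 := by
  have hP : P k * E i = E i * P k := by rw [h.psi_mul_e, comp_swap_of_eq hi]
  refine aeval_mul_self_mul_eq_zero (v := P k * E i) (h.commute_x _ _) (h.commute_x_e _ _).symm
    (h.commute_x_e _ _).symm ?_ ?_ (h.e_mul_self i) ?_ ?_ ?_ hq
  · rw [mul_assoc, ← (h.commute_x_e _ _).eq, ← mul_assoc, h.psi_mul_x_mul_e, if_pos hi, mul_assoc]
  · rw [mul_assoc, ← (h.commute_x_e _ _).eq, ← mul_assoc, ← mul_assoc, h.x_mul_psi_mul_e,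
      if_pos hi, add_sub_cancel_right]
  · rw [hP, ← mul_assoc, h.e_mul_self]
  · rw [mul_assoc, h.e_mul_self]
  · rw [mul_assoc, ← mul_assoc (E i), ← hP, mul_assoc, h.e_mul_self, ← mul_assoc,
      h.psi_mul_psi_mul_e, if_pos hi, zero_mul]

/-- The eigenvalues of each `X k` on the image of `E i` are integers of residue `i k`. -/
theorem exists_ofIntRoots {R C : Type*} [CommRing R] [Algebra R A] [CommRing C] [Algebra R C]
    {φ : C →ₐ[R] A} (hφ : Function.Injective φ) {e : (Fin n → ZMod p) → C} {x : Fin n → C}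
    (he : ∀ i, φ (e i) = E i) (hx : ∀ l, φ (x l) = X l) (i : Fin n → ZMod p) (k : Fin n) :
    ∃ m, AllResidue p m (i k) ∧ aeval (x k) (ofIntRoots R m) * e i = 0 := by
  have hφq (l : Fin n) (q : R[X]) (i) : φ (aeval (x l) q * e i) = aeval (X l) q * E i := by
    rw [map_mul, ← aeval_algHom_apply, he, hx]
  obtain ⟨k, hk⟩ := k
  induction k generalizing i with
  | zero =>
    by_cases hi : i ⟨0, hk⟩ = 0
    · refine ⟨{0}, by simp [AllResidue, hi], hφ ?_⟩
      rw [hφq, h.x_first]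
      simp [ofIntRoots]
    · exact ⟨0, by simp [AllResidue], hφ (by rw [hφq, h.e_first hk i hi, mul_zero, map_zero])⟩
  | succ k ih =>
    replace ih := fun i ↦ ih i (by omega)
    have hc : k < n - 1 := by omega
    set c : Fin (n - 1) := ⟨k, hc⟩
    change ∀ i, ∃ m, AllResidue p m (i (ka n c)) ∧
      aeval (x (ka n c)) (ofIntRoots R m) * e i = 0 at ih
    change ∃ m, AllResidue p m (i (kb n c)) ∧ aeval (x (kb n c)) (ofIntRoots R m) * e i = 0
    obtain ⟨m, hm, hmi⟩ := ih i
    by_cases hi : i (ka n c) = i (kb n c)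
    · refine ⟨m + m, hi ▸ hm.add hm, hφ ?_⟩
      rw [hφq, ofIntRoots_add, h.aeval_kb_of_eq hi (by rw [← hφq, hmi, map_zero]), map_zero]
    · obtain ⟨m', hm', hmi'⟩ := ih (i ∘ Equiv.swap (ka n c) (kb n c))
      rw [Function.comp_apply, Equiv.swap_apply_left] at hm'
      have key := h.psi_mul_psi_mul_e_mul_aeval hi (q := ofIntRoots R m')
        (by rw [← hφq, hmi', map_zero])
      rw [h.psi_mul_psi_mul_e, if_neg hi] at key
      split_ifs at key with h1 h2
      · refine ⟨m' + m.map (· + (1 : ℤ)), hm'.add ?_, ?_⟩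
        · have := hm.map_add (1 : ℤ)
          rwa [Int.cast_one, ← h1] at this
        · have hs : (x (kb n c) - x (ka n c) - (1 : ℤ)) *
              (aeval (x (kb n c)) (ofIntRoots R m') * e i) = 0 := by
            refine hφ ?_
            rw [map_mul, hφq, (h.commute_aeval_e _ _ _).eq, ← mul_assoc, map_zero,
              ← neg_eq_zero, ← key]
            simp only [map_sub, hx, Int.cast_one, map_one, ← neg_mul]
            congr 2
            abel
          have := aeval_ofIntRoots_shift (R := R) (m := m) (x := x (ka n c))
            (by rw [mul_left_comm, hmi, mul_zero]) hs
          rw [ofIntRoots_add, map_mul, mul_right_comm, mul_comm, this]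
      · refine ⟨m' + m.map (· + (-1 : ℤ)), hm'.add ?_, ?_⟩
        · have := hm.map_add (-1 : ℤ)
          rwa [h2, Int.cast_neg, Int.cast_one, add_neg_cancel_right] at this
        · have hs : (x (kb n c) - x (ka n c) - (-1 : ℤ)) *
              (aeval (x (kb n c)) (ofIntRoots R m') * e i) = 0 := by
            refine hφ ?_
            rw [map_mul, hφq, (h.commute_aeval_e _ _ _).eq, ← mul_assoc, map_zero, ← key]
            simp only [map_sub, hx, Int.cast_neg, Int.cast_one, map_one, map_neg]
            congr 2
            abel
          have := aeval_ofIntRoots_shift (R := R) (m := m) (x := x (ka n c))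
            (by rw [mul_left_comm, hmi, mul_zero]) hs
          rw [ofIntRoots_add, map_mul, mul_right_comm, mul_comm, this]
      · refine ⟨m', hm', hφ ?_⟩
        rw [hφq, (h.commute_aeval_e _ _ _).eq, map_zero, ← key, one_mul]

end IsShiftedKLR

section KLRSide

open Polynomial

/-- Idempotents cutting out the generalised eigenspaces are polynomials in the `x k`. -/
theorem exists_eq_prod_aeval {p n : ℕ} [NeZero p] {R B : Type*} [CommRing R] [CommRing B]
    [Algebra R B] (hR : ∀ c : ℤ, (c : ZMod p) ≠ 0 → IsUnit (c : R))
    {e : (Fin n → ZMod p) → B} (he : CompleteOrthogonalIdempotents e) {x : Fin n → B}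
    (hx : ∀ i k, ∃ m, AllResidue p m (i k) ∧ aeval (x k) (ofIntRoots R m) * e i = 0) :
    ∃ ε : ZMod p → R[X], ∀ i, e i = ∏ k, aeval (x k) (ε (i k)) := by
  choose m hm hmi using hx
  obtain ⟨ε, hsum, hε⟩ := exists_spectral_polynomials hR (∑ i, ∑ k, m i k)
  have hkill (i k) (a : ZMod p) (ha : a ≠ i k) : aeval (x k) (ε a) * e i = 0 := by
    have hle : m i k ≤ (∑ i, ∑ k, m i k).filter fun c : ℤ ↦ (c : ZMod p) = i k :=
      Multiset.le_filter.2 ⟨(Finset.single_le_sum_of_canonicallyOrdered (f := m i)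
        (Finset.mem_univ k)).trans (Finset.single_le_sum_of_canonicallyOrdered
          (f := fun i ↦ ∑ k, m i k) (Finset.mem_univ i)), hm i k⟩
    obtain ⟨q, hq⟩ := (ofIntRoots_dvd_of_le R hle).trans (ofIntRoots_filter_dvd hε ha)
    rw [hq, map_mul, mul_right_comm, hmi, zero_mul]
  have hid (i k) : aeval (x k) (ε (i k)) * e i = e i := by
    conv_rhs => rw [← one_mul (e i), ← map_one (aeval (R := R) (x k)), ← hsum, map_sum,
      Finset.sum_mul]
    exact (Finset.sum_eq_single (i k) (fun a _ ha ↦ hkill i k a ha) (by simp)).symm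
  have hprod (i) (s : Finset (Fin n)) : (∏ k ∈ s, aeval (x k) (ε (i k))) * e i = e i := by
    induction s using Finset.cons_induction with
    | empty => rw [Finset.prod_empty, one_mul]
    | cons k s hk ih => rw [Finset.prod_cons, mul_assoc, ih, hid]
  refine ⟨ε, fun i ↦ ?_⟩
  rw [← mul_one (∏ k, _), ← he.complete, Finset.mul_sum, Finset.sum_eq_single i, hprod]
  · intro j _ hj
    obtain ⟨k, hk⟩ := Function.ne_iff.1 hj.symm
    rw [← Finset.mul_prod_erase _ _ (Finset.mem_univ k), mul_right_comm, hkill j k _ hk, zero_mul]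
  · simp

theorem map_braidConst {p n : ℕ} {A B F : Type*} [Ring A] [Ring B] [FunLike F A B]
    [RingHomClass F A B] (f : F) (k l m : Fin n) (i : Fin n → ZMod p) :
    f (braidConst A k l m i) = braidConst B k l m i := by
  unfold braidConst
  split_ifs <;> simp

namespace IsShiftedKLR

variable {p n : ℕ} [NeZero p] {R C A : Type*} [CommRing R] [CommRing C] [Ring A] [Algebra R C]
  [Algebra R A] [Module C A] [IsScalarTower C A A] {E : (Fin n → ZMod p) → A} {X : Fin n → A}
  {P : Fin (n - 1) → A} (h : IsShiftedKLR E X P) {W : ResidueSystem p n C} {φ : C →ₐ[R] A}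
  (hφs : ∀ (c : C) (a : A), c • a = φ c * a) (he : ∀ i, φ (W.e i) = E i)
  (hx : ∀ l, φ (W.x l) = X l)

include h hφs he hx

omit [IsScalarTower C A A] in
theorem isCrossing (k : Fin (n - 1)) : IsCrossing W (ka n k) (kb n k) (P k) where
  ne := ka_ne_kb k
  e_smul i := by rw [hφs, hφs, mul_one, he, he, h.e_mul_psi]
  x_smul m hk hl := by rw [hφs, hφs, mul_one, hx, (h.commute_psi_x k m hk hl).eq]
  mul_x_right i := by
    simp only [hφs, mul_one, map_mul, he, hx]
    exact h.e_mul_psi_mul_x_right k i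
  mul_x_left i := by
    simp only [hφs, mul_one, map_mul, he, hx]
    exact h.e_mul_psi_mul_x_left k i

theorem isKLRFamily : IsKLRFamily W P where
  isCrossing := h.isCrossing hφs he hx
  mul_self k i := by
    rw [hφs, hφs, mul_one, he, h.e_mul_psi, mul_assoc, h.e_mul_psi, Function.comp_assoc,
      ← Equiv.coe_trans, ← Equiv.Perm.mul_def, Equiv.swap_mul_self, Equiv.Perm.coe_one,
      Function.comp_id, ← mul_assoc, h.psi_mul_psi_mul_e]
    congr 1
    unfold Q
    split_ifs <;> simp [hx]
  comm k m hkm := (h.commute_psi k m hkm).eq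
  braid k hk := by
    refine ((h.isCrossing hφs he hx ⟨k, by omega⟩).braid_mul_e_iff
      (h.isCrossing hφs he hx ⟨k + 1, hk⟩)
      (by simp only [ka, kb, ne_eq, Fin.mk.injEq]; omega)).1 fun i ↦ ?_
    rw [hφs, hφs, mul_one, mul_one, map_mul, he]
    refine (h.braid k hk i).trans (congrArg (· * E i) (map_braidConst φ _ _ _ i).symm)

end IsShiftedKLR

namespace IsShiftedKLR

variable {p n : ℕ} {R A : Type*} [CommRing R] [Ring A] [Algebra R A]
  {E : (Fin n → ZMod p) → A} {X : Fin n → A} {P : Fin (n - 1) → A}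

theorem x_mem [NeZero p] (h : IsShiftedKLR E X P) {S : Subalgebra R A} {s : ℕ → A}
    (hs : ∀ k < n - 1, s k ∈ S) (hss : ∀ k < n - 1, s k * s k = 1)
    (hsx : ∀ k : Fin (n - 1), s k * X (kb n k) = X (ka n k) * s k + 1) (l : Fin n) : X l ∈ S := by
  obtain ⟨l, hl⟩ := l
  induction l with
  | zero => rw [h.x_first]; exact zero_mem S
  | succ l ih =>
    have hl' : l < n - 1 := by omega
    have hx := congrArg (s l * ·) (hsx ⟨l, hl'⟩)
    simp only [← mul_assoc, hss l hl', one_mul] at hx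
    exact hx ▸ mul_mem (hs l hl') (add_mem (mul_mem (ih _) (hs l hl')) (one_mem S))

/-- An algebra generated by elements satisfying the KLR relations is generated by a Coxeter
family. -/
theorem exists_isCoxeterFamily [Fact p.Prime] (hp : 2 < p) (h : IsShiftedKLR E X P)
    (hR : ∀ c : ℤ, (c : ZMod p) ≠ 0 → IsUnit (c : R))
    (hgen : ∀ S : Subalgebra R A, (∀ i, E i ∈ S) → (∀ l, X l ∈ S) → (∀ k, P k ∈ S) → S = ⊤) :
    ∃ s : ℕ → A, IsCoxeterFamily (n - 1) s ∧ Algebra.adjoin R (s '' Set.Iio (n - 1)) = ⊤ := by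
  obtain ⟨C, _, _, _, _, φ, hφ, hφr, hφs⟩ := exists_commRing_range_eq_adjoin R
    (Set.range X ∪ Set.range E) (by
      rintro _ (⟨k, rfl⟩ | ⟨i, rfl⟩) _ (⟨l, rfl⟩ | ⟨j, rfl⟩)
      · exact h.commute_x k l
      · exact h.commute_x_e k j
      · exact (h.commute_x_e l i).symm
      · rcases eq_or_ne i j with rfl | hij
        · rfl
        · rw [h.e_mul_of_ne i j hij, h.e_mul_of_ne j i hij.symm])
  have hxφ (l) : ∃ x, φ x = X l := hφr.ge (Algebra.subset_adjoin (.inl ⟨l, rfl⟩))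
  have heφ (i) : ∃ e, φ e = E i := hφr.ge (Algebra.subset_adjoin (.inr ⟨i, rfl⟩))
  choose x hx using hxφ
  choose e he using heφ
  have hce : CompleteOrthogonalIdempotents e :=
    CompleteOrthogonalIdempotents.iff_ortho_complete.2
      ⟨fun i j hij ↦ hφ (by rw [map_mul, he, he, h.e_mul_of_ne i j hij, map_zero]),
        hφ (by simp only [map_sum, he, h.sum_e, map_one])⟩
  have hroots := h.exists_ofIntRoots hφ he hx
  obtain ⟨W, rfl, rfl⟩ := exists_residueSystem hR hce x hroots
  obtain ⟨ε, hε⟩ := exists_eq_prod_aeval hR hce hroots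
  have hcr := h.isCrossing hφs he hx
  set s : ℕ → A := fun k ↦ if hk : k < n - 1 then
    reflectionOf W (ka n ⟨k, hk⟩) (kb n ⟨k, hk⟩) (P ⟨k, hk⟩) else 1
  have hsk (k : Fin (n - 1)) : s k = reflectionOf W (ka n k) (kb n k) (P k) := dif_pos k.2
  have hcox := (isKLRFamily_iff_isCoxeterFamily hp hcr hsk).1 (h.isKLRFamily hφs he hx)
  refine ⟨s, hcox, ?_⟩
  set S := Algebra.adjoin R (s '' Set.Iio (n - 1)) with hS
  have hsS (k : ℕ) (hk : k < n - 1) : s k ∈ S := Algebra.subset_adjoin ⟨k, hk, rfl⟩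
  have hX : ∀ l, X l ∈ S := by
    refine h.x_mem hsS hcox.mul_self fun k ↦ ?_
    have : s k * W.x (kb n k) • (1 : A) = W.x (ka n k) • s k + 1 :=
      hsk k ▸ (hcr k).isReflection.mul_x_right
    rwa [hφs, hφs, hx, hx, mul_one] at this
  have hE (i) : E i ∈ S := by
    have hle (c : C) (hc : c ∈ Algebra.adjoin R (Set.range W.x)) : φ c ∈ S := by
      have : Algebra.adjoin R (Set.range W.x) ≤ S.comap φ := Algebra.adjoin_le (by
        rintro _ ⟨l, rfl⟩
        exact (Subalgebra.mem_comap S φ _).2 ((hx l).symm ▸ hX l))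
      exact this hc
    rw [← he, hε]
    exact hle _ (prod_mem fun k _ ↦ Algebra.adjoin_mono
      (Set.singleton_subset_iff.2 (Set.mem_range_self k)) (aeval_mem_adjoin_singleton _ _))
  have hC (c : C) : φ c ∈ S := by
    have : Algebra.adjoin R (Set.range X ∪ Set.range E) ≤ S := Algebra.adjoin_le (by
      rintro _ (⟨l, rfl⟩ | ⟨i, rfl⟩)
      · exact hX l
      · exact hE i)
    exact this (hφr ▸ ⟨c, rfl⟩)
  refine hgen S hE hX fun k ↦ ?_
  have hP : P k = φ (W.h (ka n k) (kb n k)) * (s k + φ (W.b (ka n k) (kb n k))) := by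
    rw [hsk, reflectionOf, hφs, hφs, mul_one, sub_add_cancel, ← mul_assoc, ← map_mul,
      mul_comm (W.h _ _), g_mul_h, map_one, one_mul]
  exact hP ▸ mul_mem (hC _) (add_mem (hsS k k.2) (hC _))

end IsShiftedKLR

end KLRSide

/-- **Hu–Mathas.** For every prime `p > 2` and every `n ≥ 0`, the
integral KLR algebra `R_n^{ℤ_(p)}` is isomorphic, as a `ℤ_(p)`-algebra, to the group
algebra `ℤ_(p)𝔖_n` of the symmetric group. -/
theorem KLR_iso_symmetricGroupAlgebra (p n : ℕ) [Fact p.Prime] (hp2 : 2 < p) :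
    Nonempty (KLR p n ≃ₐ[Zp p] MonoidAlgebra (Zp p) (Equiv.Perm (Fin n))) := by
  obtain ⟨s, hs, hgen⟩ :=
    (isShiftedKLR p n).exists_isCoxeterFamily (R := Zp p) hp2 isUnit_intCast_Zp adjoin_KLR_eq_top
  obtain ⟨f, hf⟩ := ((isCoxeterFamily_simpleTransposition n).map
    (MonoidAlgebra.of (Zp p) (Equiv.Perm (Fin n)))).exists_algHom hp2
  have hrange : f.range = ⊤ := MonoidAlgebra.eq_top_of_of_mem _ (closure_simpleTransposition n) (by
    rintro _ ⟨k, hk, rfl⟩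
    exact hf k hk)
  have hsurj : Function.Surjective f := (AlgHom.range_eq_top f).1 hrange
  have hcard : Nat.card (Equiv.Perm (Fin n)) = (n - 1 + 1).factorial := by
    rw [Nat.card_perm, Nat.card_fin]
    cases n <;> rfl
  let c := MonoidAlgebra.coeffLinearEquiv (M := Equiv.Perm (Fin n)) (S := Zp p) (Zp p)
  have hinj := hs.injective_of_surjective hgen hcard (c.toLinearMap ∘ₗ f.toLinearMap)
    (c.surjective.comp hsurj)
  rw [LinearMap.coe_comp] at hinj
  exact ⟨AlgEquiv.ofBijective f ⟨hinj.of_comp, hsurj⟩⟩
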